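/- Let p > 1, let f : [0,∞) → ℝ be continuous with lim_{u→+∞} u^{−p} f(u) = ℓ for some ℓ ∈ (0,∞), let Ω ⊆ ℝ² be a nonempty open set and let −∞ ≤ T₁ < T₂ ≤ +∞. Then there exists C > 0 depending only on f (and not on Ω, T₁, T₂ or u) such that every nonnegative classical solution u of ∂ₜu = Δu + f(u) in Ω×(T₁,T₂) satisfies u(x,t) ≤ C(1 + (t−T₁)^{−β} + (T₂−t)^{−β} + dist(x,∂Ω)^{−2β}) for all (x,t) ∈ Ω×(T₁,T₂), where β = 1/(p−1), with the conventions (t−T₁)^{−β} := 0 if T₁ = −∞, (T₂−t)^{−β} := 0 if T₂ = +∞, and dist(x,∂Ω)^{−2β} := 0 if Ω = ℝ². -/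

import Mathlib

open scoped BigOperators Classical
open Set

/-- The Laplacian of `f : ℝⁿ → ℝ` at `x`, as the sum of the second partial
derivatives in the coordinate directions. -/
noncomputable def lap {n : ℕ} (f : EuclideanSpace ℝ (Fin n) → ℝ)
    (x : EuclideanSpace ℝ (Fin n)) : ℝ :=
  ∑ i : Fin n,
    fderiv ℝ (fun y => fderiv ℝ f y (EuclideanSpace.single i 1)) x
      (EuclideanSpace.single i 1)

section Interior

open MeasureTheory Filter Topology
open scoped ContDiff

/-- The Euclidean plane. -/
abbrev Plane := EuclideanSpace ℝ (Fin 2)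

/-- Directional derivative. -/
noncomputable def dd {V : Type*} [NormedAddCommGroup V] [NormedSpace ℝ V] (v : V) (F : V → ℝ)
    (P : V) : ℝ :=
  fderiv ℝ F P v

/-- The unit time vector in `ℝ² × ℝ`. -/
def et : Plane × ℝ := (0, 1)

/-- The coordinate space vectors in `ℝ² × ℝ`. -/
noncomputable def ex (i : Fin 2) : Plane × ℝ := (EuclideanSpace.single i 1, 0)

/-- The spatial Laplacian on `ℝ² × ℝ`. -/
noncomputable def Lx (F : Plane × ℝ → ℝ) (P : Plane × ℝ) : ℝ :=
  ∑ i, dd (ex i) (dd (ex i) F) P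

section Calculus

variable {V : Type*} [NormedAddCommGroup V] [NormedSpace ℝ V]

theorem dd_congr {v : V} {F G : V → ℝ} {P : V} (h : F =ᶠ[𝓝 P] G) : dd v F P = dd v G P := by
  simp only [dd, h.fderiv_eq]

theorem dd_eventuallyEq {v : V} {F G : V → ℝ} {P : V} (h : F =ᶠ[𝓝 P] G) :
    dd v F =ᶠ[𝓝 P] dd v G := by
  filter_upwards [h.eventuallyEq_nhds] with Q hQ using dd_congr hQ

theorem contDiffAt_dd {v : V} {F : V → ℝ} {P : V} {n m : ℕ∞ω} (h : ContDiffAt ℝ n F P)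
    (hmn : m + 1 ≤ n) : ContDiffAt ℝ m (dd v F) P :=
  (h.fderiv_right hmn).clm_apply contDiffAt_const

theorem contDiff_dd {v : V} {F : V → ℝ} {n m : ℕ∞ω} (h : ContDiff ℝ n F)
    (hmn : m + 1 ≤ n) : ContDiff ℝ m (dd v F) :=
  contDiff_iff_contDiffAt.2 fun _ => contDiffAt_dd h.contDiffAt hmn

theorem smooth_dd {v : V} {F : V → ℝ} (h : ContDiff ℝ ∞ F) : ContDiff ℝ ∞ (dd v F) :=
  contDiff_dd h (by simp)

theorem dd_mul {v : V} {F G : V → ℝ} {P : V} (hF : DifferentiableAt ℝ F P)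
    (hG : DifferentiableAt ℝ G P) :
    dd v (fun Q => F Q * G Q) P = F P * dd v G P + dd v F P * G P := by
  simp only [dd, fderiv_fun_mul hF hG]
  simp
  ring

theorem dd_add {v : V} {F G : V → ℝ} {P : V} (hF : DifferentiableAt ℝ F P)
    (hG : DifferentiableAt ℝ G P) :
    dd v (fun Q => F Q + G Q) P = dd v F P + dd v G P := by
  simp only [dd, fderiv_fun_add hF hG]
  simp

theorem dd_sub {v : V} {F G : V → ℝ} {P : V} (hF : DifferentiableAt ℝ F P)
    (hG : DifferentiableAt ℝ G P) :
    dd v (fun Q => F Q - G Q) P = dd v F P - dd v G P := by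
  simp only [dd, fderiv_fun_sub hF hG]
  simp

theorem dd_const_mul {v : V} {F : V → ℝ} {P : V} (c : ℝ) :
    dd v (fun Q => c * F Q) P = c * dd v F P := by
  have h2 : (fun Q => c * F Q) = c • F := rfl
  simp only [dd, h2, fderiv_const_smul_field]
  simp

theorem dd_const {v : V} (c : ℝ) (P : V) : dd v (fun _ => c) P = 0 := by
  simp [dd]

theorem dd_comp {v : V} {F : V → ℝ} {P : V} {φ : ℝ → ℝ} {φ' : ℝ} (hφ : HasDerivAt φ φ' (F P))
    (hF : DifferentiableAt ℝ F P) : dd v (fun Q => φ (F Q)) P = φ' * dd v F P := by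
  have := (hφ.comp_hasFDerivAt P hF.hasFDerivAt).fderiv
  simp only [dd]
  change fderiv ℝ (φ ∘ F) P v = _
  rw [this]
  simp

theorem dd_pow {v : V} {F : V → ℝ} {P : V} (n : ℕ) (hF : DifferentiableAt ℝ F P) :
    dd v (fun Q => F Q ^ n) P = n * F P ^ (n - 1) * dd v F P :=
  dd_comp (hasDerivAt_pow n (F P)) hF

theorem dd_rpow {v : V} {F : V → ℝ} {P : V} {q : ℝ} (hq : 1 ≤ q) (hF : DifferentiableAt ℝ F P) :
    dd v (fun Q => F Q ^ q) P = q * F P ^ (q - 1) * dd v F P :=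
  dd_comp (Real.hasDerivAt_rpow_const (Or.inr hq)) hF

theorem dd_dd_mul {v : V} {F G : V → ℝ} {P : V} (hF : ContDiffAt ℝ 2 F P)
    (hG : ContDiffAt ℝ 2 G P) :
    dd v (dd v (fun Q => F Q * G Q)) P =
      F P * dd v (dd v G) P + 2 * (dd v F P * dd v G P) + dd v (dd v F) P * G P := by
  have e : dd v (fun Q => F Q * G Q) =ᶠ[𝓝 P] fun Q => F Q * dd v G Q + dd v F Q * G Q := by
    filter_upwards [hF.eventually (by simp), hG.eventually (by simp)] with Q h1 h2
    exact dd_mul (h1.differentiableAt (by simp)) (h2.differentiableAt (by simp))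
  have hF1 := hF.differentiableAt (by simp)
  have hG1 := hG.differentiableAt (by simp)
  have hF2 : DifferentiableAt ℝ (dd v F) P :=
    (contDiffAt_dd (m := 1) hF (by norm_num)).differentiableAt (by simp)
  have hG2 : DifferentiableAt ℝ (dd v G) P :=
    (contDiffAt_dd (m := 1) hG (by norm_num)).differentiableAt (by simp)
  rw [dd_congr e, dd_add (F := fun Q => F Q * dd v G Q) (G := fun Q => dd v F Q * G Q)
    (hF1.mul hG2) (hF2.mul hG1), dd_mul hF1 hG2, dd_mul hF2 hG1]
  ring

theorem dd_comm {v w : V} {F : V → ℝ} {P : V} (hF : ContDiffAt ℝ 2 F P) :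
    dd v (dd w F) P = dd w (dd v F) P := by
  have h1 : DifferentiableAt ℝ (fderiv ℝ F) P :=
    (hF.fderiv_right (m := 1) (by norm_num)).differentiableAt (by simp)
  have h2 : IsSymmSndFDerivAt ℝ F P := hF.isSymmSndFDerivAt (by simp)
  have key : ∀ a b : V, dd a (dd b F) P = fderiv ℝ (fderiv ℝ F) P a b := by
    intro a b
    change fderiv ℝ (fun Q => fderiv ℝ F Q b) P a = _
    rw [fderiv_clm_apply h1 (differentiableAt_const b)]
    simp
  rw [key, key]
  exact h2 v w

theorem dd_comp_affine {v : V} {F : V → ℝ} (A : V →L[ℝ] V) (b : V) {P : V}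
    (hF : DifferentiableAt ℝ F (b + A P)) :
    dd v (fun Q => F (b + A Q)) P = dd (A v) F (b + A P) := by
  have h : HasFDerivAt (fun Q => b + A Q) A P := A.hasFDerivAt.const_add b
  have := (hF.hasFDerivAt.comp P h).fderiv
  simp only [dd]
  change fderiv ℝ (F ∘ fun Q => b + A Q) P v = _
  rw [this]
  simp

theorem dd_smul_left {v : V} {F : V → ℝ} {P : V} (c : ℝ) : dd (c • v) F P = c * dd v F P := by
  simp [dd]

theorem dd_eq_zero_of_eventuallyEq_zero {v : V} {F : V → ℝ} {P : V}
    (h : ∀ᶠ Q in 𝓝 P, F Q = 0) : dd v F P = 0 := by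
  have : F =ᶠ[𝓝 P] fun _ => 0 := h
  rw [dd_congr this, dd_const]

theorem dd_eq_zero_of_notMem {v : V} {F : V → ℝ} {K : Set V} (hK : IsClosed K)
    (h : ∀ P ∉ K, F P = 0) : ∀ P ∉ K, dd v F P = 0 := fun P hP =>
  dd_eq_zero_of_eventuallyEq_zero <| by
    filter_upwards [hK.isOpen_compl.mem_nhds hP] with Q hQ using h Q hQ

end Calculus

theorem Lx_mul {F G : Plane × ℝ → ℝ} {P : Plane × ℝ} (hF : ContDiffAt ℝ 2 F P)
    (hG : ContDiffAt ℝ 2 G P) :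
    Lx (fun Q => F Q * G Q) P =
      F P * Lx G P + 2 * (∑ i, dd (ex i) F P * dd (ex i) G P) + Lx F P * G P := by
  simp only [Lx, dd_dd_mul hF hG, Fin.sum_univ_two]
  ring

theorem Lx_add {F G : Plane × ℝ → ℝ} {P : Plane × ℝ} (hF : ContDiffAt ℝ 2 F P)
    (hG : ContDiffAt ℝ 2 G P) : Lx (fun Q => F Q + G Q) P = Lx F P + Lx G P := by
  simp only [Lx, ← Finset.sum_add_distrib]
  refine Finset.sum_congr rfl fun i _ => ?_
  have e : dd (ex i) (fun Q => F Q + G Q) =ᶠ[𝓝 P] fun Q => dd (ex i) F Q + dd (ex i) G Q := by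
    filter_upwards [hF.eventually (by simp), hG.eventually (by simp)] with Q h1 h2
    exact dd_add (h1.differentiableAt (by simp)) (h2.differentiableAt (by simp))
  rw [dd_congr e, dd_add]
  · exact (contDiffAt_dd (m := 1) hF (by norm_num)).differentiableAt (by simp)
  · exact (contDiffAt_dd (m := 1) hG (by norm_num)).differentiableAt (by simp)

theorem smooth_Lx {F : Plane × ℝ → ℝ} (h : ContDiff ℝ ∞ F) : ContDiff ℝ ∞ (Lx F) := by
  have : Lx F = fun P => ∑ i, dd (ex i) (dd (ex i) F) P := rfl
  rw [this]
  exact ContDiff.sum fun i _ => smooth_dd (smooth_dd h)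

theorem contDiffAt_Lx {F : Plane × ℝ → ℝ} {P : Plane × ℝ} (h : ContDiffAt ℝ 2 F P) :
    ContinuousAt (Lx F) P := by
  have : Lx F = fun P => ∑ i, dd (ex i) (dd (ex i) F) P := rfl
  rw [this]
  exact (ContDiffAt.sum fun i _ => contDiffAt_dd (m := 0)
    (contDiffAt_dd (m := 1) h (by norm_num)) (by norm_num)).continuousAt

theorem Lx_eq_zero_of_notMem {F : Plane × ℝ → ℝ} {K : Set (Plane × ℝ)} (hK : IsClosed K)
    (h : ∀ P ∉ K, F P = 0) : ∀ P ∉ K, Lx F P = 0 := fun P hP =>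
  Finset.sum_eq_zero fun _ _ => dd_eq_zero_of_notMem hK (dd_eq_zero_of_notMem hK h) P hP

theorem dd_et_eq_deriv {F : Plane × ℝ → ℝ} {x : Plane} {t : ℝ}
    (h : DifferentiableAt ℝ F (x, t)) : HasDerivAt (fun s => F (x, s)) (dd et F (x, t)) t := by
  have h1 : HasDerivAt (fun s : ℝ => (x, s)) ((0 : Plane), (1 : ℝ)) t :=
    (hasDerivAt_const t x).prodMk (hasDerivAt_id t)
  exact h.hasFDerivAt.comp_hasDerivAt t h1

theorem dd_ex_eq {F : Plane × ℝ → ℝ} {x : Plane} {t : ℝ} (i : Fin 2)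
    (h : DifferentiableAt ℝ F (x, t)) :
    dd (EuclideanSpace.single i 1) (fun y => F (y, t)) x = dd (ex i) F (x, t) := by
  have h1 : HasFDerivAt (fun y : Plane => (y, t)) (ContinuousLinearMap.inl ℝ Plane ℝ) x :=
    hasFDerivAt_prodMk_left x t
  have := (h.hasFDerivAt.comp x h1).fderiv
  simp only [dd]
  change fderiv ℝ (F ∘ fun y : Plane => (y, t)) x _ = _
  rw [this]
  simp [ex]

theorem lap_slice {F : Plane × ℝ → ℝ} {x : Plane} {t : ℝ} (h : ContDiffAt ℝ 2 F (x, t)) :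
    lap (fun y => F (y, t)) x = Lx F (x, t) := by
  refine Finset.sum_congr rfl fun i _ => ?_
  have hc : ContinuousAt (fun y : Plane => (y, t)) x := by fun_prop
  have e : dd (EuclideanSpace.single i 1) (fun y => F (y, t)) =ᶠ[𝓝 x]
      fun y => dd (ex i) F (y, t) := by
    filter_upwards [hc.eventually (h.eventually (by simp))] with y hy
    exact dd_ex_eq i (hy.differentiableAt (by simp))
  change dd _ (dd _ (fun y => F (y, t))) x = _
  rw [dd_congr e]
  exact dd_ex_eq i ((contDiffAt_dd (m := 1) h (by norm_num)).differentiableAt (by simp))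

instance : (volume : Measure (Plane × ℝ)).IsAddHaarMeasure :=
  inferInstanceAs ((volume : Measure Plane).prod (volume : Measure ℝ)).IsAddHaarMeasure

/-- The integral of a derivative of a compactly supported function vanishes. -/
theorem setIntegral_dd_eq_zero {V : Type*} [NormedAddCommGroup V] [NormedSpace ℝ V]
    [FiniteDimensional ℝ V] [MeasurableSpace V] [BorelSpace V] {μ : Measure V}
    [μ.IsAddHaarMeasure] {F : V → ℝ} {K : Set V} (hK : IsCompact K) (hF : ContDiff ℝ 1 F)
    (h0 : ∀ P ∉ K, F P = 0) (v : V) : ∫ P in K, dd v F P ∂μ = 0 := by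
  have h1 := dd_eq_zero_of_notMem (v := v) hK.isClosed h0
  rw [setIntegral_eq_integral_of_forall_compl_eq_zero h1]
  have hc : HasCompactSupport F := HasCompactSupport.intro hK h0
  have hc' : HasCompactSupport (dd v F) := HasCompactSupport.intro hK h1
  have hi : Integrable F μ := hF.continuous.integrable_of_hasCompactSupport hc
  have hi' : Integrable (dd v F) μ :=
    (contDiff_dd (m := 0) hF (by simp)).continuous.integrable_of_hasCompactSupport hc'
  have := integral_mul_fderiv_eq_neg_fderiv_mul_of_integrable (𝕜 := ℝ) (μ := μ) (v := v)
    (f := fun _ : V => (1 : ℝ)) (g := F) (by simp) (by simp only [one_mul]; exact hi') (by simpa only [one_mul] using hi)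
    (fun x _ => by simp) (fun x _ => hF.differentiable (by simp) x)
  simpa [dd] using this

theorem exists_cutoff : ∃ C : ℝ, 0 < C ∧ ∀ α b : ℝ, 0 < α → 0 < b → ∃ ψ : Plane × ℝ → ℝ,
    ContDiff ℝ ∞ ψ ∧ (∀ P, 0 ≤ ψ P) ∧ (∀ P, ψ P ≤ 1) ∧
    (∀ P ∈ Metric.closedBall (0 : Plane) (α / 2) ×ˢ Icc (-(b / 2)) (b / 2), ψ P = 1) ∧
    (∀ P ∉ Metric.closedBall (0 : Plane) α ×ˢ Icc (-b) b, ψ P = 0) ∧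
    (∀ i P, |dd (ex i) ψ P| ≤ C / α) ∧ (∀ P, |dd et ψ P| ≤ C / b) ∧
    (∀ P, |Lx ψ P| ≤ C / α ^ 2) := by
  let Φ : ContDiffBump (0 : Plane × ℝ) := ⟨1 / 2, 1, by norm_num, by norm_num⟩
  have hΦ : ContDiff ℝ ∞ Φ := Φ.contDiff
  have hΦ0 : ∀ P ∉ Metric.closedBall (0 : Plane × ℝ) 1, Φ P = 0 := fun P hP =>
    Φ.zero_of_le_dist (by
      simp only [Metric.mem_closedBall, not_le] at hP; exact hP.le)
  have hK : IsCompact (Metric.closedBall (0 : Plane × ℝ) 1) := isCompact_closedBall _ _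
  have bdd : ∀ F : Plane × ℝ → ℝ, Continuous F →
      (∀ P ∉ Metric.closedBall (0 : Plane × ℝ) 1, F P = 0) → ∃ C, ∀ P, |F P| ≤ C := by
    intro F hF h0
    obtain ⟨C, hC⟩ := (HasCompactSupport.intro hK h0).exists_bound_of_continuous hF
    exact ⟨C, hC⟩
  obtain ⟨C0, h0⟩ := bdd _ (smooth_dd (v := ex 0) hΦ).continuous
    (dd_eq_zero_of_notMem hK.isClosed hΦ0)
  obtain ⟨C1, h1⟩ := bdd _ (smooth_dd (v := ex 1) hΦ).continuous
    (dd_eq_zero_of_notMem hK.isClosed hΦ0)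
  obtain ⟨Ct, ht⟩ := bdd _ (smooth_dd (v := et) hΦ).continuous
    (dd_eq_zero_of_notMem hK.isClosed hΦ0)
  obtain ⟨CL, hL⟩ := bdd _ (smooth_Lx hΦ).continuous (Lx_eq_zero_of_notMem hK.isClosed hΦ0)
  have p0 := (abs_nonneg _).trans (h0 0)
  have p1 := (abs_nonneg _).trans (h1 0)
  have pt := (abs_nonneg _).trans (ht 0)
  have pL := (abs_nonneg _).trans (hL 0)
  refine ⟨C0 + C1 + Ct + CL + 1, by positivity, fun α b hα hb => ?_⟩
  set C := C0 + C1 + Ct + CL + 1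
  let A : Plane × ℝ →L[ℝ] Plane × ℝ :=
    (α⁻¹ • ContinuousLinearMap.id ℝ Plane).prodMap (b⁻¹ • ContinuousLinearMap.id ℝ ℝ)
  have hA : ∀ x t, A (x, t) = (α⁻¹ • x, b⁻¹ * t) := fun x t => by simp [A]
  have hAx : ∀ i, A (ex i) = α⁻¹ • ex i := fun i => by simp [ex, A]
  have hAt : A et = b⁻¹ • et := by simp [et, A]
  have hd : ∀ (F : Plane × ℝ → ℝ), ContDiff ℝ ∞ F → ∀ v P,
      dd v (fun Q => F (0 + A Q)) P = dd (A v) F (0 + A P) := fun F hF v P =>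
    dd_comp_affine A 0 (hF.differentiable (by simp) _)
  have hdx : ∀ (F : Plane × ℝ → ℝ), ContDiff ℝ ∞ F → ∀ i P,
      dd (ex i) (fun Q => F (0 + A Q)) P = α⁻¹ * dd (ex i) F (0 + A P) := fun F hF i P => by
    rw [hd F hF, hAx, dd_smul_left]
  refine ⟨fun P => Φ (0 + A P), hΦ.comp (contDiff_const.add A.contDiff), fun P => Φ.nonneg,
    fun P => Φ.le_one, ?_, ?_, ?_, ?_, ?_⟩
  · rintro ⟨x, t⟩ ⟨hx, ht⟩
    apply Φ.one_of_mem_closedBall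
    rw [zero_add, hA]
    simp only [Metric.mem_closedBall, dist_zero_right, Prod.norm_mk, sup_le_iff, norm_smul,
      Real.norm_eq_abs, abs_mul, mem_Icc] at hx ht ⊢
    rw [abs_of_pos (inv_pos.2 hα), abs_of_pos (inv_pos.2 hb), inv_mul_le_iff₀ hα,
      inv_mul_le_iff₀ hb]
    constructor
    · change _ ≤ α * (1 / 2); linarith
    · change _ ≤ b * (1 / 2); rw [abs_le]; constructor <;> linarith
  · rintro ⟨x, t⟩ h
    apply hΦ0
    rw [zero_add, hA]
    contrapose! h
    simp only [Metric.mem_closedBall, dist_zero_right, Prod.norm_mk, sup_le_iff, norm_smul,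
      Real.norm_eq_abs, abs_mul, mem_Icc, mem_prod] at h ⊢
    rw [abs_of_pos (inv_pos.2 hα), abs_of_pos (inv_pos.2 hb), inv_mul_le_iff₀ hα,
      inv_mul_le_iff₀ hb, abs_le] at h
    refine ⟨by linarith [h.1], by linarith [h.2.1], by linarith [h.2.2]⟩
  · intro i P
    rw [hdx _ hΦ, abs_mul, abs_of_pos (inv_pos.2 hα), inv_mul_le_iff₀ hα]
    have : α * (C / α) = C := by field_simp
    rw [this]
    fin_cases i
    · exact (h0 _).trans (by simp only [C]; linarith)
    · exact (h1 _).trans (by simp only [C]; linarith)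
  · intro P
    rw [hd _ hΦ, hAt, dd_smul_left, abs_mul, abs_of_pos (inv_pos.2 hb), inv_mul_le_iff₀ hb]
    have : b * (C / b) = C := by field_simp
    rw [this]
    exact (ht _).trans (by simp only [C]; linarith)
  · intro P
    have : Lx (fun P => Φ (0 + A P)) P = (α ^ 2)⁻¹ * Lx Φ (0 + A P) := by
      simp only [Lx, Finset.mul_sum]
      refine Finset.sum_congr rfl fun i _ => ?_
      have e : dd (ex i) (fun Q => Φ (0 + A Q)) = fun Q => α⁻¹ * dd (ex i) Φ (0 + A Q) :=
        funext fun Q => hdx _ hΦ i Q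
      rw [e, dd_const_mul, hdx _ (smooth_dd hΦ)]
      field_simp
    have h2 : 0 < α ^ 2 := by positivity
    rw [this, abs_mul, abs_of_pos (inv_pos.2 h2), inv_mul_le_iff₀ h2]
    have : α ^ 2 * (C / α ^ 2) = C := by field_simp
    rw [this]
    exact (hL _).trans (by simp only [C]; linarith)

theorem dd_pow_add_two {ψ : Plane × ℝ → ℝ} (hψ : ContDiff ℝ ∞ ψ) (M : ℕ) (v P) :
    dd v (fun Q => ψ Q ^ (M + 2)) P = (M + 2) * ψ P ^ (M + 1) * dd v ψ P := by
  rw [dd_pow _ (hψ.differentiable (by simp) P)]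
  push_cast
  rfl

theorem Lx_pow_add_two {ψ : Plane × ℝ → ℝ} (hψ : ContDiff ℝ ∞ ψ) (M : ℕ) (P) :
    Lx (fun Q => ψ Q ^ (M + 2)) P = (M + 2) * ψ P ^ (M + 1) * Lx ψ P +
      (M + 2) * (M + 1) * ψ P ^ M * ∑ i, dd (ex i) ψ P ^ 2 := by
  simp only [Lx, Finset.mul_sum, ← Finset.sum_add_distrib]
  refine Finset.sum_congr rfl fun i _ => ?_
  have e : dd (ex i) (fun Q => ψ Q ^ (M + 2)) =
      fun Q => ((M + 2) * ψ Q ^ (M + 1)) * dd (ex i) ψ Q :=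
    funext fun Q => dd_pow_add_two hψ M _ Q
  have d1 := hψ.differentiable (by simp) P
  have d2 := (smooth_dd (v := ex i) hψ).differentiable (by simp) P
  rw [e, dd_mul ((d1.fun_pow _).const_mul _) d2, dd_const_mul, dd_pow _ d1]
  push_cast
  ring_nf

theorem abs_dd_et_add_Lx_pow_le {ψ : Plane × ℝ → ℝ} (hψ : ContDiff ℝ ∞ ψ) (M : ℕ) {P} {a : ℝ}
    (h0 : 0 ≤ ψ P) (h1 : ψ P ≤ 1) (ht : |dd et ψ P| ≤ a)
    (hx : ∀ i, dd (ex i) ψ P ^ 2 ≤ a) (hL : |Lx ψ P| ≤ a) :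
    |dd et (fun Q => ψ Q ^ (M + 2)) P| + |Lx (fun Q => ψ Q ^ (M + 2)) P| ≤
      (2 * (M + 2) ^ 2 * a) * ψ P ^ M := by
  rw [dd_pow_add_two hψ, Lx_pow_add_two hψ]
  have e1 : ψ P ^ (M + 1) ≤ ψ P ^ M := pow_le_pow_of_le_one h0 h1 (by omega)
  have e0 : 0 ≤ ψ P ^ M := by positivity
  have e2 : 0 ≤ ψ P ^ (M + 1) := by positivity
  have t1 : |(M + 2 : ℝ) * ψ P ^ (M + 1) * dd et ψ P| ≤ (M + 2) * ψ P ^ M * a := by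
    rw [abs_mul, abs_of_nonneg (by positivity)]; gcongr
  have t2 : |(M + 2 : ℝ) * ψ P ^ (M + 1) * Lx ψ P| ≤ (M + 2) * ψ P ^ M * a := by
    rw [abs_mul, abs_of_nonneg (by positivity)]; gcongr
  have t3 : |(M + 2 : ℝ) * (M + 1) * ψ P ^ M * ∑ i, dd (ex i) ψ P ^ 2| ≤
      (M + 2) * (M + 1) * ψ P ^ M * (2 * a) := by
    rw [abs_of_nonneg (by positivity)]
    gcongr
    rw [Fin.sum_univ_two]
    linarith [hx 0, hx 1]
  calc _ ≤ _ := add_le_add t1 ((abs_add_le _ _).trans (add_le_add t2 t3))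
    _ = (2 * (M + 2) ^ 2 * a) * ψ P ^ M := by ring

theorem young_cutoff {p ℓ A w θ : ℝ} {M : ℕ} (hp : 1 < p) (hℓ : 0 < ℓ) (hA : 0 ≤ A) (hw : 0 ≤ w)
    (h0 : 0 ≤ θ) (h1 : θ ≤ 1) (hM : 2 ≤ M * (p - 1)) :
    A * w * θ ^ M ≤ ℓ / 2 * w ^ p * θ ^ (M + 2) + A * (2 * A / ℓ) ^ (1 / (p - 1)) := by
  have hp' : 0 < p - 1 := by linarith
  set B := (2 * A / ℓ) ^ (1 / (p - 1)) with hB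
  have hB0 : 0 ≤ B := by positivity
  rcases le_or_gt (w * θ ^ M) B with h | h
  · have : 0 ≤ ℓ / 2 * w ^ p * θ ^ (M + 2) := by positivity
    nlinarith [mul_le_mul_of_nonneg_left h hA]
  · have hpos : 0 < w * θ ^ M := lt_of_le_of_lt hB0 h
    have hw0 : 0 < w := by
      rcases hw.eq_or_lt with h | h
      · rw [← h] at hpos; simp at hpos
      · exact h
    have hM0 : M ≠ 0 := by
      rintro rfl; simp at hM; linarith
    have hθ0 : 0 < θ := by
      rcases h0.eq_or_lt with h | h
      · rw [← h] at hpos; simp [hM0] at hpos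
      · exact h
    have k1 : 2 * A / ℓ ≤ w ^ (p - 1) * θ ^ 2 := by
      have e1 : (2 * A / ℓ) = B ^ (p - 1) := by
        rw [hB, ← Real.rpow_mul (by positivity), one_div_mul_cancel hp'.ne', Real.rpow_one]
      have e2 : B ^ (p - 1) ≤ (w * θ ^ M) ^ (p - 1) := Real.rpow_le_rpow hB0 h.le hp'.le
      rw [Real.mul_rpow hw (by positivity), ← Real.rpow_natCast θ M, ← Real.rpow_mul h0] at e2
      have e3 : θ ^ ((M : ℝ) * (p - 1)) ≤ θ ^ (2 : ℝ) :=
        Real.rpow_le_rpow_of_exponent_ge hθ0 h1 hM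
      rw [Real.rpow_two] at e3
      calc _ = _ := e1
        _ ≤ _ := e2
        _ ≤ _ := by gcongr
    have k2 : A ≤ ℓ / 2 * (w ^ (p - 1) * θ ^ 2) := by
      rw [div_le_iff₀ hℓ] at k1; linarith
    have e4 : w ^ p = w ^ (p - 1) * w := by
      rw [← Real.rpow_add_one hw0.ne']; ring_nf
    have : A * w * θ ^ M ≤ ℓ / 2 * w ^ p * θ ^ (M + 2) := by
      rw [e4, pow_add]
      calc A * w * θ ^ M = A * (w * θ ^ M) := by ring
        _ ≤ ℓ / 2 * (w ^ (p - 1) * θ ^ 2) * (w * θ ^ M) := by gcongr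
        _ = _ := by ring
    have : 0 ≤ A * B := by positivity
    linarith

/-- Integrated form of a pointwise inequality up to a divergence. -/
theorem setIntegral_le_of_div {K : Set (Plane × ℝ)} (hK : IsCompact K)
    {F G T : Plane × ℝ → ℝ} {S : Fin 2 → Plane × ℝ → ℝ} (hF : Continuous F) (hG : Continuous G)
    (hT : ContDiff ℝ 1 T) (hS : ∀ i, ContDiff ℝ 1 (S i)) (hT0 : ∀ P ∉ K, T P = 0)
    (hS0 : ∀ i, ∀ P ∉ K, S i P = 0)
    (h : ∀ P ∈ K, F P ≤ G P + dd et T P + ∑ i, dd (ex i) (S i) P) :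
    ∫ P in K, F P ≤ ∫ P in K, G P := by
  have cT : Continuous (dd et T) := (contDiff_dd (m := 0) hT (by simp)).continuous
  have cS : ∀ i, Continuous (dd (ex i) (S i)) :=
    fun i => (contDiff_dd (m := 0) (hS i) (by simp)).continuous
  have ii : ∀ H : Plane × ℝ → ℝ, Continuous H → IntegrableOn H K volume :=
    fun H hH => hH.continuousOn.integrableOn_compact hK
  calc ∫ P in K, F P ≤ ∫ P in K, (G P + dd et T P + ∑ i, dd (ex i) (S i) P) :=
        setIntegral_mono_on (ii _ hF) (ii _ (by fun_prop)) hK.measurableSet h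
    _ = ∫ P in K, G P := by
        rw [integral_add (ii _ (by fun_prop)) (ii _ (by fun_prop)),
          integral_add (ii _ hG) (ii _ cT), integral_finsetSum _ fun i _ => ii _ (cS i),
          setIntegral_dd_eq_zero hK hT hT0]
        simp [fun i => setIntegral_dd_eq_zero (μ := volume) hK (hS i) (hS0 i) (ex i)]

theorem dd_et_Lx_mul_sub {η W : Plane × ℝ → ℝ} (hη : ContDiff ℝ ∞ η) (hW : ContDiff ℝ ∞ W) (P) :
    η P * (dd et W P - Lx W P) = -(W P * (dd et η P + Lx η P)) + dd et (fun Q => η Q * W Q) P +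
      ∑ i, dd (ex i) (fun Q => W Q * dd (ex i) η Q - η Q * dd (ex i) W Q) P := by
  have d1 := hη.differentiable (by simp) P
  have d2 := hW.differentiable (by simp) P
  have d3 := fun i => (smooth_dd (v := ex i) hη).differentiable (by simp) P
  have d4 := fun i => (smooth_dd (v := ex i) hW).differentiable (by simp) P
  rw [dd_mul d1 d2]
  have : ∀ i, dd (ex i) (fun Q => W Q * dd (ex i) η Q - η Q * dd (ex i) W Q) P =
      W P * dd (ex i) (dd (ex i) η) P - η P * dd (ex i) (dd (ex i) W) P := by
    intro i
    rw [dd_sub (F := fun Q => W Q * dd (ex i) η Q) (d2.fun_mul (d3 i)) (d1.fun_mul (d4 i)),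
      dd_mul d2 (d3 i), dd_mul d1 (d4 i)]
    ring
  simp only [this, Lx, Fin.sum_univ_two]
  ring

theorem two_le_infty : (2 : ℕ∞ω) ≤ ∞ := by
  exact ENat.LEInfty.out

/-- A smooth cutoff function supported in `K`, with parabolic derivative bound `a`. -/
structure IsCutoff (K : Set (Plane × ℝ)) (ψ : Plane × ℝ → ℝ) (a : ℝ) : Prop where
  isCompact : IsCompact K
  smooth : ContDiff ℝ ∞ ψ
  nonneg : ∀ P, 0 ≤ ψ P
  le_one : ∀ P, ψ P ≤ 1
  zero : ∀ P ∉ K, ψ P = 0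
  dt : ∀ P, |dd et ψ P| ≤ a
  dx : ∀ i P, dd (ex i) ψ P ^ 2 ≤ a
  lx : ∀ P, |Lx ψ P| ≤ a

theorem IsCutoff.pos {K ψ a} (h : IsCutoff K ψ a) : 0 ≤ a :=
  (abs_nonneg _).trans (h.dt 0)

theorem IsCutoff.pow_zero {K ψ a} (h : IsCutoff K ψ a) (n : ℕ) : ∀ P ∉ K, ψ P ^ (n + 1) = 0 :=
  fun P hP => by simp [h.zero P hP]

theorem continuous_rpow_of_one_lt {W : Plane × ℝ → ℝ} {p : ℝ} (hp : 1 < p) (hW : ContDiff ℝ ∞ W) :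
    Continuous fun P => W P ^ p :=
  hW.continuous.rpow_const fun _ => Or.inr (by linarith)

section Energy

variable {K : Set (Plane × ℝ)} {ψ W : Plane × ℝ → ℝ} {a p ℓ ε : ℝ} {M : ℕ}

theorem integral_rpow_cutoff_le (h : IsCutoff K ψ a) (hp : 1 < p) (hℓ : 0 < ℓ)
    (hM : 2 ≤ M * (p - 1)) (hW : ContDiff ℝ ∞ W) (hW0 : ∀ P, 0 ≤ W P)
    (hε : ∀ P ∈ K, |dd et W P - Lx W P - ℓ * W P ^ p| ≤ ε) {A Y : ℝ}
    (hA : A = 2 * (M + 2) ^ 2 * a) (hY : Y = A * (2 * A / ℓ) ^ (1 / (p - 1))) :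
    ℓ / 2 * (∫ P in K, W P ^ p * ψ P ^ (M + 2)) ≤ volume.real K * (Y + ε) ∧
    ∫ P in K, A * W P * ψ P ^ M ≤ volume.real K * (2 * Y + ε) := by
  have hA0 : 0 ≤ A := by have := h.pos; subst hA; positivity
  have cW := hW.continuous
  have cp := continuous_rpow_of_one_lt hp hW
  have cψ := h.smooth.continuous
  have hη : ContDiff ℝ ∞ fun P => ψ P ^ (M + 2) := h.smooth.pow _
  have ii : ∀ H : Plane × ℝ → ℝ, Continuous H → IntegrableOn H K volume :=
    fun H hH => hH.continuousOn.integrableOn_compact h.isCompact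
  have hfin : volume K ≠ ⊤ := h.isCompact.measure_lt_top.ne
  have young : ∀ P, A * W P * ψ P ^ M ≤ ℓ / 2 * W P ^ p * ψ P ^ (M + 2) + Y := fun P => by
    rw [hY]; exact young_cutoff hp hℓ hA0 (hW0 P) (h.nonneg P) (h.le_one P) hM
  have s1 : ∫ P in K, ℓ / 2 * (W P ^ p * ψ P ^ (M + 2)) ≤ ∫ P in K, (Y + ε) := by
    refine setIntegral_le_of_div h.isCompact (by fun_prop) (by fun_prop)
      (T := fun Q => ψ Q ^ (M + 2) * W Q)
      (S := fun i Q => W Q * dd (ex i) (fun Q => ψ Q ^ (M + 2)) Q - ψ Q ^ (M + 2) * dd (ex i) W Q)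
      ((hη.mul hW).of_le (by simp))
      (fun i => ((hW.mul (smooth_dd hη)).sub (hη.mul (smooth_dd hW))).of_le (by simp))
      (fun P hP => by simp [h.zero P hP])
      (fun i P hP => by
        simp [h.zero P hP,
          dd_eq_zero_of_notMem h.isCompact.isClosed (h.pow_zero (M + 1)) P hP]) ?_
    intro P hP
    have e1 := dd_et_Lx_mul_sub hη hW P
    have e2 := abs_dd_et_add_Lx_pow_le h.smooth M (h.nonneg P) (h.le_one P) (h.dt P)
      (fun i => h.dx i P) (h.lx P)
    rw [← hA] at e2
    have e3 := young P
    have e4 := abs_le.1 (hε P hP)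
    have e5 : 0 ≤ ψ P ^ (M + 2) := pow_nonneg (h.nonneg P) _
    have e6 : ψ P ^ (M + 2) ≤ 1 := pow_le_one₀ (h.nonneg P) (h.le_one P)
    have e7 : -(W P * (dd et (fun Q => ψ Q ^ (M + 2)) P + Lx (fun Q => ψ Q ^ (M + 2)) P)) ≤
        A * W P * ψ P ^ M := by
      have := (abs_add_le _ _).trans e2
      have := (neg_le_abs _).trans this
      nlinarith [mul_le_mul_of_nonneg_left this (hW0 P)]
    have hε0 : 0 ≤ ε := (abs_nonneg _).trans (hε P hP)
    have e8 : -(ψ P ^ (M + 2) * (dd et W P - Lx W P - ℓ * W P ^ p)) ≤ ε := by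
      nlinarith [mul_le_mul_of_nonneg_left e4.1 e5]
    nlinarith
  have s2 : ∫ P in K, A * W P * ψ P ^ M ≤ ∫ P in K, (ℓ / 2 * (W P ^ p * ψ P ^ (M + 2)) + Y) :=
    setIntegral_mono_on (ii _ (by fun_prop)) (ii _ (by fun_prop)) h.isCompact.measurableSet
      fun P _ => by linarith [young P]
  rw [integral_add (ii _ (by fun_prop)) (ii _ (by fun_prop))] at s2
  simp only [setIntegral_const, smul_eq_mul, integral_const_mul] at s1 s2 ⊢
  constructor
  · linarith
  · linarith

theorem integral_grad_cutoff_le (h : IsCutoff K ψ a) (hp : 1 < p) (hℓ : 0 < ℓ)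
    (hM : 2 ≤ M * (p - 1)) (hW : ContDiff ℝ ∞ W) (hW0 : ∀ P, 0 ≤ W P)
    (hW2 : ∀ P ∈ K, W P ≤ 2)
    (hε : ∀ P ∈ K, |dd et W P - Lx W P - ℓ * W P ^ p| ≤ ε) {A Y : ℝ}
    (hA : A = 2 * (M + 2) ^ 2 * a) (hY : Y = A * (2 * A / ℓ) ^ (1 / (p - 1))) :
    ∫ P in K, ψ P ^ (M + 2) * ∑ i, dd (ex i) W P ^ 2 ≤ volume.real K * (6 * Y + 7 * ε) := by
  obtain ⟨b1, b2⟩ := integral_rpow_cutoff_le h hp hℓ hM hW hW0 hε hA hY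
  have hA0 : 0 ≤ A := by have := h.pos; subst hA; positivity
  have cW := hW.continuous
  have cp := continuous_rpow_of_one_lt hp hW
  have cψ := h.smooth.continuous
  have cd : ∀ v, Continuous (dd v W) := fun v => (smooth_dd hW).continuous
  have hη : ContDiff ℝ ∞ fun P => ψ P ^ (M + 2) := h.smooth.pow _
  have ii : ∀ H : Plane × ℝ → ℝ, Continuous H → IntegrableOn H K volume :=
    fun H hH => hH.continuousOn.integrableOn_compact h.isCompact
  have s1 : ∫ P in K, ψ P ^ (M + 2) * ∑ i, dd (ex i) W P ^ 2 ≤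
      ∫ P in K, (2 * ℓ * (W P ^ p * ψ P ^ (M + 2)) + A * W P * ψ P ^ M + 2 * ε) := by
    refine setIntegral_le_of_div h.isCompact (by fun_prop) (by fun_prop)
      (T := fun Q => (-(1 / 2)) * (ψ Q ^ (M + 2) * (W Q * W Q)))
      (S := fun i Q => ψ Q ^ (M + 2) * (W Q * dd (ex i) W Q) -
        1 / 2 * ((W Q * W Q) * dd (ex i) (fun Q => ψ Q ^ (M + 2)) Q))
      ((contDiff_const.mul (hη.mul (hW.mul hW))).of_le (by simp))
      (fun i => ((hη.mul (hW.mul (smooth_dd hW))).sub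
        (contDiff_const.mul ((hW.mul hW).mul (smooth_dd hη)))).of_le (by simp))
      (fun P hP => by simp [h.zero P hP])
      (fun i P hP => by
        simp [h.zero P hP,
          dd_eq_zero_of_notMem h.isCompact.isClosed (h.pow_zero (M + 1)) P hP]) ?_
    intro P hP
    have d1 := hη.differentiable (by simp) P
    have d2 := hW.differentiable (by simp) P
    have d3 := fun i => (smooth_dd (v := ex i) hη).differentiable (by simp) P
    have d4 := fun i => (smooth_dd (v := ex i) hW).differentiable (by simp) P
    have f1 : dd et (fun Q => (-(1 / 2)) * (ψ Q ^ (M + 2) * (W Q * W Q))) P =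
        -(1 / 2) * (W P ^ 2 * dd et (fun Q => ψ Q ^ (M + 2)) P) -
          ψ P ^ (M + 2) * W P * dd et W P := by
      rw [dd_const_mul, dd_mul d1 (d2.fun_mul d2), dd_mul d2 d2]
      ring
    have f2 : ∀ i, dd (ex i) (fun Q => ψ Q ^ (M + 2) * (W Q * dd (ex i) W Q) -
        1 / 2 * ((W Q * W Q) * dd (ex i) (fun Q => ψ Q ^ (M + 2)) Q)) P =
        ψ P ^ (M + 2) * dd (ex i) W P ^ 2 + ψ P ^ (M + 2) * W P * dd (ex i) (dd (ex i) W) P -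
        1 / 2 * (W P ^ 2 * dd (ex i) (dd (ex i) (fun Q => ψ Q ^ (M + 2))) P) := by
      intro i
      rw [dd_sub (d1.fun_mul (d2.fun_mul (d4 i))) (((d2.fun_mul d2).fun_mul (d3 i)).const_mul _),
        dd_const_mul, dd_mul d1 (d2.fun_mul (d4 i)), dd_mul d2 (d4 i),
        dd_mul (d2.fun_mul d2) (d3 i), dd_mul d2 d2]
      ring
    have e2 := abs_dd_et_add_Lx_pow_le h.smooth M (h.nonneg P) (h.le_one P) (h.dt P)
      (fun i => h.dx i P) (h.lx P)
    rw [← hA] at e2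
    have e4 := abs_le.1 (hε P hP)
    have e5 : 0 ≤ ψ P ^ (M + 2) := pow_nonneg (h.nonneg P) _
    have e6 : ψ P ^ (M + 2) ≤ 1 := pow_le_one₀ (h.nonneg P) (h.le_one P)
    have hε0 : 0 ≤ ε := (abs_nonneg _).trans (hε P hP)
    have g0 : 0 ≤ ψ P ^ (M + 2) * W P := mul_nonneg e5 (hW0 P)
    have g1 : ψ P ^ (M + 2) * W P * (dd et W P - Lx W P - ℓ * W P ^ p) ≤ 2 * ε := by
      have : ψ P ^ (M + 2) * W P ≤ 2 := by nlinarith [hW0 P, hW2 P hP]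
      nlinarith [mul_le_mul_of_nonneg_left e4.2 g0]
    have g2 : ψ P ^ (M + 2) * W P * (ℓ * W P ^ p) ≤ 2 * ℓ * (W P ^ p * ψ P ^ (M + 2)) := by
      have : 0 ≤ ℓ * (W P ^ p * ψ P ^ (M + 2)) :=
        mul_nonneg hℓ.le (mul_nonneg (Real.rpow_nonneg (hW0 P) _) e5)
      nlinarith [hW2 P hP]
    have g3 : 1 / 2 * (W P ^ 2 * (dd et (fun Q => ψ Q ^ (M + 2)) P +
        Lx (fun Q => ψ Q ^ (M + 2)) P)) ≤ A * W P * ψ P ^ M := by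
      have := (le_abs_self _).trans ((abs_add_le _ _).trans e2)
      have l1 : W P ^ 2 ≤ 2 * W P := by nlinarith [hW0 P, hW2 P hP]
      have l2 : 0 ≤ A * ψ P ^ M := mul_nonneg hA0 (pow_nonneg (h.nonneg P) _)
      nlinarith [mul_le_mul_of_nonneg_left this (sq_nonneg (W P))]
    rw [f1]
    simp only [f2, Lx, Fin.sum_univ_two] at *
    nlinarith
  rw [integral_add (ii _ (by fun_prop)) (ii _ (by fun_prop)),
    integral_add (ii _ (by fun_prop)) (ii _ (by fun_prop))] at s1
  simp only [setIntegral_const, smul_eq_mul, integral_const_mul] at s1 b1 b2 ⊢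
  linarith

set_option maxHeartbeats 1000000 in
theorem integral_dt_sq_cutoff_le (h : IsCutoff K ψ a) (hp : 1 < p) (hℓ : 0 < ℓ)
    (hM : 2 ≤ M * (p - 1)) (hW : ContDiff ℝ ∞ W) (hW0 : ∀ P, 0 ≤ W P)
    (hW2 : ∀ P ∈ K, W P ≤ 2)
    (hε : ∀ P ∈ K, |dd et W P - Lx W P - ℓ * W P ^ p| ≤ ε) {A Y : ℝ}
    (hA : A = 2 * (M + 2) ^ 2 * a) (hY : Y = A * (2 * A / ℓ) ^ (1 / (p - 1))) :
    ∫ P in K, ψ P ^ (M + 4) * dd et W P ^ 2 ≤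
      2 * volume.real K * ((M + 4) ^ 2 * a * (22 * Y + 25 * ε) + ε ^ 2) := by
  obtain ⟨b1, b2⟩ := integral_rpow_cutoff_le h hp hℓ hM hW hW0 hε hA hY
  have b3 := integral_grad_cutoff_le h hp hℓ hM hW hW0 hW2 hε hA hY
  have ha := h.pos
  have cW := hW.continuous
  have cp := continuous_rpow_of_one_lt hp hW
  have cψ := h.smooth.continuous
  have cd : ∀ v, Continuous (dd v W) := fun v => (smooth_dd hW).continuous
  have hη : ContDiff ℝ ∞ fun P => ψ P ^ (M + 4) := h.smooth.pow _
  have hle : (1 : ℕ∞ω) ≤ ∞ := by simp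
  have hWp : ContDiff ℝ 1 fun P => W P ^ (p + 1) :=
    ContDiff.rpow_const_of_le (m := 1) (hW.of_le hle) (by push_cast; linarith)
  have ii : ∀ H : Plane × ℝ → ℝ, Continuous H → IntegrableOn H K volume :=
    fun H hH => hH.continuousOn.integrableOn_compact h.isCompact
  have s1 : ∫ P in K, 1 / 2 * (ψ P ^ (M + 4) * dd et W P ^ 2) ≤
      ∫ P in K, (3 * (M + 4) ^ 2 * a * (ψ P ^ (M + 2) * ∑ i, dd (ex i) W P ^ 2) +
        2 * ℓ * (M + 4) * a * (W P ^ p * ψ P ^ (M + 2)) + ε ^ 2) := by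
    refine setIntegral_le_of_div h.isCompact (by fun_prop) (by fun_prop)
      (T := fun Q => ψ Q ^ (M + 4) *
        (ℓ / (p + 1) * W Q ^ (p + 1) - 1 / 2 * ∑ i, dd (ex i) W Q ^ 2))
      (S := fun i Q => ψ Q ^ (M + 4) * (dd et W Q * dd (ex i) W Q))
      ((hη.of_le hle).mul ((contDiff_const.mul hWp).sub (contDiff_const.mul
        ((ContDiff.sum fun i _ => (smooth_dd hW).pow 2).of_le hle))))
      (fun i => (hη.mul ((smooth_dd hW).mul (smooth_dd hW))).of_le (by simp))
      (fun P hP => by simp [h.zero P hP])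
      (fun i P hP => by simp [h.zero P hP]) ?_
    intro P hP
    have d1 := hη.differentiable (by simp) P
    have d2 := hW.differentiable (by simp) P
    have d4 := fun v => (smooth_dd (v := v) hW).differentiable (by simp) P
    have d5 := hWp.differentiable (by simp) P
    have dc : ∀ i, dd (ex i) (dd et W) P = dd et (dd (ex i) W) P :=
      fun i => dd_comm (hW.contDiffAt.of_le two_le_infty)
    have hz : ∀ v, dd v (fun Q => ψ Q ^ (M + 4)) P = (M + 4) * ψ P ^ (M + 3) * dd v ψ P := by
      intro v
      have := dd_pow_add_two h.smooth (M + 2) v P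
      push_cast at this
      rw [this]
      ring
    have f1 : dd et (fun Q => ψ Q ^ (M + 4) *
        (ℓ / (p + 1) * W Q ^ (p + 1) - 1 / 2 * ∑ i, dd (ex i) W Q ^ 2)) P =
        ψ P ^ (M + 4) * (ℓ * W P ^ p * dd et W P - ∑ i, dd (ex i) W P * dd et (dd (ex i) W) P) +
        (M + 4) * ψ P ^ (M + 3) * dd et ψ P *
          (ℓ / (p + 1) * W P ^ (p + 1) - 1 / 2 * ∑ i, dd (ex i) W P ^ 2) := by
      simp only [Fin.sum_univ_two]
      have q1 := fun i => (d4 (ex i)).fun_pow 2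
      rw [dd_mul d1 ((d5.const_mul _).fun_sub (((q1 0).fun_add (q1 1)).const_mul _)),
        dd_sub (d5.const_mul _) (((q1 0).fun_add (q1 1)).const_mul _), dd_const_mul, dd_const_mul,
        dd_add (q1 0) (q1 1), dd_pow _ (d4 (ex 0)), dd_pow _ (d4 (ex 1)),
        dd_rpow (by linarith) d2, hz, add_sub_cancel_right]
      field_simp
      push_cast
      ring
    have f2 : ∀ i, dd (ex i) (fun Q => ψ Q ^ (M + 4) * (dd et W Q * dd (ex i) W Q)) P =
        ψ P ^ (M + 4) * (dd et W P * dd (ex i) (dd (ex i) W) P +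
          dd et (dd (ex i) W) P * dd (ex i) W P) +
        (M + 4) * ψ P ^ (M + 3) * dd (ex i) ψ P * (dd et W P * dd (ex i) W P) := by
      intro i
      rw [dd_mul d1 ((d4 et).fun_mul (d4 (ex i))), dd_mul (d4 et) (d4 (ex i)), hz, dc]
    have hε0 : 0 ≤ ε := (abs_nonneg _).trans (hε P hP)
    set e := dd et W P - Lx W P - ℓ * W P ^ p with he
    have e4 : e ^ 2 ≤ ε ^ 2 := sq_le_sq' (by linarith [(abs_le.1 (hε P hP)).1])
      (abs_le.1 (hε P hP)).2
    set z := ψ P with hz'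
    have z0 : 0 ≤ z := h.nonneg P
    have z1 : z ≤ 1 := h.le_one P
    set m : ℝ := (M : ℝ) + 4 with hm
    have hm0 : 4 ≤ m := by simp [hm]
    set G := ∑ i, dd (ex i) W P ^ 2 with hG
    have hG0 : 0 ≤ G := Finset.sum_nonneg fun i _ => sq_nonneg _
    have p2 : 0 ≤ z ^ (M + 2) := by positivity
    have p3 : z ^ (M + 3) ≤ z ^ (M + 2) := pow_le_pow_of_le_one z0 z1 (by omega)
    have p3' : 0 ≤ z ^ (M + 3) := by positivity
    have p4 : z ^ (M + 4) ≤ 1 := pow_le_one₀ z0 z1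
    have p4' : 0 ≤ z ^ (M + 4) := by positivity
    have k1 : z ^ (M + 4) * (dd et W P * e) ≤ 1 / 4 * (z ^ (M + 4) * dd et W P ^ 2) + ε ^ 2 := by
      nlinarith [mul_nonneg p4' (sq_nonneg (dd et W P / 2 - e))]
    have k2 : m * z ^ (M + 3) * dd et ψ P * (1 / 2 * G - ℓ / (p + 1) * W P ^ (p + 1)) ≤
        m * a * z ^ (M + 2) * G + 2 * ℓ * m * a * (W P ^ p * z ^ (M + 2)) := by
      have t1 := abs_le.1 (h.dt P)
      have t2 : 0 ≤ ℓ / (p + 1) * W P ^ (p + 1) :=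
        mul_nonneg (by positivity) (Real.rpow_nonneg (hW0 P) _)
      have t3 : ℓ / (p + 1) * W P ^ (p + 1) ≤ 2 * ℓ * W P ^ p := by
        have : W P ^ (p + 1) ≤ 2 * W P ^ p := by
          rw [Real.rpow_add_one' (hW0 P) (by linarith), mul_comm]
          exact mul_le_mul_of_nonneg_right (hW2 P hP) (Real.rpow_nonneg (hW0 P) _)
        have h3 : ℓ / (p + 1) ≤ ℓ := div_le_self hℓ.le (by linarith)
        calc _ ≤ ℓ * (2 * W P ^ p) := mul_le_mul h3 this (Real.rpow_nonneg (hW0 P) _) hℓ.le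
          _ = _ := by ring
      have t4 : dd et ψ P * (1 / 2 * G - ℓ / (p + 1) * W P ^ (p + 1)) ≤
          a * (G + 2 * ℓ * W P ^ p) := by nlinarith
      have t5 : 0 ≤ a * (G + 2 * ℓ * W P ^ p) :=
        mul_nonneg ha (by have := Real.rpow_nonneg (hW0 P) p; positivity)
      calc _ = m * (z ^ (M + 3) * (dd et ψ P * (1 / 2 * G - ℓ / (p + 1) * W P ^ (p + 1)))) := by
            ring
        _ ≤ m * (z ^ (M + 2) * (a * (G + 2 * ℓ * W P ^ p))) := by
            refine mul_le_mul_of_nonneg_left ?_ (by linarith)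
            exact (mul_le_mul_of_nonneg_left t4 p3').trans (mul_le_mul_of_nonneg_right p3 t5)
        _ = _ := by ring
    have k3 : -(m * z ^ (M + 3) * (∑ i, dd (ex i) ψ P * dd (ex i) W P) * dd et W P) ≤
        1 / 4 * (z ^ (M + 4) * dd et W P ^ 2) + 2 * m ^ 2 * a * z ^ (M + 2) * G := by
      have c1 : (∑ i, dd (ex i) ψ P * dd (ex i) W P) ^ 2 ≤ 2 * a * G := by
        refine (Finset.sum_mul_sq_le_sq_mul_sq _ _ _).trans ?_
        refine mul_le_mul_of_nonneg_right ?_ hG0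
        rw [Fin.sum_univ_two]
        linarith [h.dx 0 P, h.dx 1 P]
      set s := ∑ i, dd (ex i) ψ P * dd (ex i) W P
      have : 0 ≤ z ^ (M + 2) * (1 / 2 * z * dd et W P + m * s) ^ 2 := by positivity
      have c2 : z ^ (M + 2) * (m ^ 2 * s ^ 2) ≤ z ^ (M + 2) * (m ^ 2 * (2 * a * G)) := by gcongr
      have c3 : z ^ (M + 3) = z ^ (M + 2) * z := by ring
      have c4 : z ^ (M + 4) = z ^ (M + 2) * z ^ 2 := by ring
      rw [c3, c4]
      linarith
    have k4 : m * a * z ^ (M + 2) * G ≤ m ^ 2 * a * z ^ (M + 2) * G := by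
      have : 0 ≤ a * z ^ (M + 2) * G := by positivity
      nlinarith
    rw [f1]
    simp only [f2]
    have e5 : dd et W P ^ 2 = dd et W P * (e + Lx W P + ℓ * W P ^ p) := by rw [he]; ring
    have e6 : z ^ (M + 4) * dd et W P ^ 2 = z ^ (M + 4) * (dd et W P * e) +
      z ^ (M + 4) * dd et W P * Lx W P + z ^ (M + 4) * (dd et W P * (ℓ * W P ^ p)) := by
      rw [e5]; ring
    simp only [Lx, Fin.sum_univ_two] at *
    linarith
  rw [integral_add (ii _ (by fun_prop)) (ii _ (by fun_prop)),
    integral_add (ii _ (by fun_prop)) (ii _ (by fun_prop))] at s1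
  simp only [setIntegral_const, smul_eq_mul, integral_const_mul] at s1 b1 b2 b3 ⊢
  have m0 : (0 : ℝ) ≤ M := Nat.cast_nonneg M
  have u1 : 3 * (M + 4) ^ 2 * a * (∫ P in K, ψ P ^ (M + 2) * ∑ i, dd (ex i) W P ^ 2) ≤
    3 * (M + 4) ^ 2 * a * (volume.real K * (6 * Y + 7 * ε)) := by gcongr
  have u2 : 2 * ℓ * (M + 4) * a * (∫ P in K, W P ^ p * ψ P ^ (M + 2)) ≤
      (M + 4) ^ 2 * a * (volume.real K * (4 * (Y + ε))) := by
    have i0 : 0 ≤ ∫ P in K, W P ^ p * ψ P ^ (M + 2) := setIntegral_nonneg h.isCompact.measurableSet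
      fun P _ => mul_nonneg (Real.rpow_nonneg (hW0 P) _) (pow_nonneg (h.nonneg P) _)
    have : 2 * ℓ * (∫ P in K, W P ^ p * ψ P ^ (M + 2)) ≤ volume.real K * (4 * (Y + ε)) := by
      linarith
    have m1 : (M + 4 : ℝ) ≤ (M + 4) ^ 2 := by nlinarith
    calc _ = (M + 4) * a * (2 * ℓ * (∫ P in K, W P ^ p * ψ P ^ (M + 2))) := by ring
      _ ≤ _ := by gcongr
  linarith

end Energy

theorem abs_Lx_pow_le {ψ : Plane × ℝ → ℝ} (hψ : ContDiff ℝ ∞ ψ) (M : ℕ) {P} {a : ℝ}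
    (h0 : 0 ≤ ψ P) (h1 : ψ P ≤ 1)
    (hx : ∀ i, dd (ex i) ψ P ^ 2 ≤ a) (hL : |Lx ψ P| ≤ a) :
    |Lx (fun Q => ψ Q ^ (M + 2)) P| ≤ (2 * (M + 2) ^ 2 * a) * ψ P ^ M := by
  rw [Lx_pow_add_two hψ]
  have ha : 0 ≤ a := (abs_nonneg _).trans hL
  have e1 : ψ P ^ (M + 1) ≤ ψ P ^ M := pow_le_pow_of_le_one h0 h1 (by omega)
  have e0 : 0 ≤ ψ P ^ M := by positivity
  have t2 : |(M + 2 : ℝ) * ψ P ^ (M + 1) * Lx ψ P| ≤ (M + 2) * ψ P ^ M * a := by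
    rw [abs_mul, abs_of_nonneg (by positivity)]; gcongr
  have t3 : |(M + 2 : ℝ) * (M + 1) * ψ P ^ M * ∑ i, dd (ex i) ψ P ^ 2| ≤
      (M + 2) * (M + 1) * ψ P ^ M * (2 * a) := by
    rw [abs_of_nonneg (by positivity)]
    gcongr
    rw [Fin.sum_univ_two]
    linarith [hx 0, hx 1]
  refine ((abs_add_le _ _).trans (add_le_add t2 t3)).trans ?_
  have : 0 ≤ (M + 2) * ψ P ^ M * a := by positivity
  linarith

theorem integral_rpow_cutoff_le_dt {K : Set (Plane × ℝ)} {ψ W : Plane × ℝ → ℝ} {a p ℓ ε δ : ℝ}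
    {M : ℕ} (hK : IsCompact K) (hψ : ContDiff ℝ ∞ ψ) (ψ0 : ∀ P, 0 ≤ ψ P) (ψ1 : ∀ P, ψ P ≤ 1)
    (ψz : ∀ P ∉ K, ψ P = 0) (hx : ∀ i P, dd (ex i) ψ P ^ 2 ≤ a) (hL : ∀ P, |Lx ψ P| ≤ a)
    (hp : 1 < p) (hℓ : 0 < ℓ)
    (hM : 2 ≤ M * (p - 1)) (hW : ContDiff ℝ ∞ W) (hW0 : ∀ P, 0 ≤ W P)
    (hε : ∀ P ∈ K, |dd et W P - Lx W P - ℓ * W P ^ p| ≤ ε) {A Y : ℝ} (hδ : 0 < δ)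
    (hA : A = 2 * (M + 2) ^ 2 * a) (hY : Y = A * (2 * A / ℓ) ^ (1 / (p - 1))) :
    ℓ / 2 * (∫ P in K, W P ^ p * ψ P ^ (M + 2)) ≤ volume.real K * (Y + ε + δ) +
      1 / (4 * δ) * ∫ P in K, dd et W P ^ 2 := by
  have ha : 0 ≤ a := (abs_nonneg _).trans (hL 0)
  have hA0 : 0 ≤ A := by subst hA; positivity
  have cW := hW.continuous
  have cp := continuous_rpow_of_one_lt hp hW
  have cψ := hψ.continuous
  have cd : Continuous (dd et W) := (smooth_dd hW).continuous
  have hη : ContDiff ℝ ∞ fun P => ψ P ^ (M + 2) := hψ.pow _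
  have ii : ∀ H : Plane × ℝ → ℝ, Continuous H → IntegrableOn H K volume :=
    fun H hH => hH.continuousOn.integrableOn_compact hK
  have hfin : volume K ≠ ⊤ := hK.measure_lt_top.ne
  have s1 : ∫ P in K, ℓ / 2 * (W P ^ p * ψ P ^ (M + 2)) ≤
      ∫ P in K, (1 / (4 * δ) * dd et W P ^ 2 + (Y + ε + δ)) := by
    refine setIntegral_le_of_div hK (by fun_prop) (by fun_prop)
      (T := fun Q => 0)
      (S := fun i Q => W Q * dd (ex i) (fun Q => ψ Q ^ (M + 2)) Q - ψ Q ^ (M + 2) * dd (ex i) W Q)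
      contDiff_const
      (fun i => ((hW.mul (smooth_dd hη)).sub (hη.mul (smooth_dd hW))).of_le (by simp))
      (fun P hP => rfl)
      (fun i P hP => by
        have : ∀ P ∉ K, ψ P ^ (M + 2) = 0 := fun P hP => by simp [ψz P hP]
        simp [ψz P hP, dd_eq_zero_of_notMem hK.isClosed this P hP]) ?_
    intro P hP
    have e1 := dd_et_Lx_mul_sub hη hW P
    rw [dd_mul (hη.differentiable (by simp) P) (hW.differentiable (by simp) P)] at e1
    have e2 := abs_Lx_pow_le hψ M (ψ0 P) (ψ1 P) (fun i => hx i P) (hL P)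
    rw [← hA] at e2
    have e3 := young_cutoff hp hℓ hA0 (hW0 P) (ψ0 P) (ψ1 P) hM
    rw [← hY] at e3
    have e4 := abs_le.1 (hε P hP)
    have e5 : 0 ≤ ψ P ^ (M + 2) := pow_nonneg (ψ0 P) _
    have e6 : ψ P ^ (M + 2) ≤ 1 := pow_le_one₀ (ψ0 P) (ψ1 P)
    have e7 : -(W P * Lx (fun Q => ψ Q ^ (M + 2)) P) ≤ A * W P * ψ P ^ M := by
      have := (neg_le_abs _).trans e2
      nlinarith [mul_le_mul_of_nonneg_left this (hW0 P)]
    have hε0 : 0 ≤ ε := (abs_nonneg _).trans (hε P hP)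
    have e8 : -(ψ P ^ (M + 2) * (dd et W P - Lx W P - ℓ * W P ^ p)) ≤ ε := by
      nlinarith [mul_le_mul_of_nonneg_left e4.1 e5]
    have e9 : dd et W P ≤ 1 / (4 * δ) * dd et W P ^ 2 + δ := by
      have : 1 / (4 * δ) * dd et W P ^ 2 + δ - dd et W P =
        1 / (4 * δ) * (dd et W P - 2 * δ) ^ 2 := by field_simp; ring
      have : 0 ≤ 1 / (4 * δ) * (dd et W P - 2 * δ) ^ 2 := by positivity
      linarith
    have e10 : ψ P ^ (M + 2) * dd et W P ≤ 1 / (4 * δ) * dd et W P ^ 2 + δ := by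
      have : 0 ≤ 1 / (4 * δ) * dd et W P ^ 2 + δ := by positivity
      nlinarith
    rw [dd_const]
    linarith
  rw [integral_add (ii _ (by fun_prop)) (ii _ (by fun_prop))] at s1
  simp only [setIntegral_const, smul_eq_mul, integral_const_mul] at s1 ⊢
  linarith

theorem volume_real_cylinder {R b : ℝ} (hR : 0 ≤ R) (hb : 0 ≤ b) (x : Plane) (t : ℝ) :
    volume.real (Metric.closedBall x R ×ˢ Icc (t - b) (t + b)) =
      R ^ 2 * volume.real (Metric.ball (0 : Plane) 1) * (2 * b) := by
  rw [Measure.volume_eq_prod, measureReal_prod_prod, Measure.addHaar_real_closedBall _ _ hR]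
  simp [Real.volume_real_Icc]
  left
  rw [max_eq_left] <;> linarith

set_option maxHeartbeats 2000000 in
/-- Smallness of nonnegative approximate solutions of `w_t = Δw + ℓ w ^ p` on large cylinders. -/
theorem exists_small_integral_rpow {p ℓ δ : ℝ} (hp : 1 < p) (hℓ : 0 < ℓ) (hδ : 0 < δ) :
    ∃ R ε : ℝ, 1 ≤ R ∧ 0 < ε ∧ ∀ W : Plane × ℝ → ℝ, ContDiff ℝ ∞ W → (∀ P, 0 ≤ W P) →
      (∀ P ∈ Metric.closedBall (0 : Plane) R ×ˢ Icc (-R ^ 2) (R ^ 2),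
        W P ≤ 2 ∧ |dd et W P - Lx W P - ℓ * W P ^ p| ≤ ε) →
      ∫ P in Metric.closedBall (0 : Plane) 1 ×ˢ Icc (-1 : ℝ) 1, W P ^ p ≤ δ := by
  obtain ⟨C, hC, hcut⟩ := exists_cutoff
  obtain ⟨M, hM'⟩ := exists_nat_ge (2 / (p - 1))
  have hp1 : 0 < p - 1 := by linarith
  have hM : 2 ≤ M * (p - 1) := by rwa [div_le_iff₀ hp1] at hM'
  set D := C + C ^ 2
  have hD : 0 < D := by positivity
  set β := 1 / (p - 1) with hβ
  have hβ0 : 0 < β := by positivity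
  set κ := volume.real (Metric.ball (0 : Plane) 1)
  have hκ : 0 ≤ κ := measureReal_nonneg
  set A : ℝ → ℝ := fun R => 2 * (M + 2) ^ 2 * (D / R ^ 2) with hAdef
  set Z : ℝ → ℝ := fun R => (2 * A R / ℓ) ^ β with hZdef
  have hZ : Tendsto Z atTop (𝓝 0) := by
    have h1 : Tendsto (fun R : ℝ => D / R ^ 2) atTop (𝓝 0) :=
      tendsto_const_nhds.div_atTop (tendsto_pow_atTop (by norm_num))
    have h2 : Tendsto (fun R => 2 * A R / ℓ) atTop (𝓝 (2 * (2 * (M + 2) ^ 2 * 0) / ℓ)) :=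
      ((h1.const_mul _).const_mul _).div_const _
    simp only [mul_zero, zero_div] at h2
    have := h2.rpow_const (p := β) (Or.inr hβ0.le)
    rwa [Real.zero_rpow hβ0.ne'] at this
  have hinv : Tendsto (fun R : ℝ => R⁻¹) atTop (𝓝 0) := tendsto_inv_atTop_zero
  -- first choose the inner radius
  set γ := ℓ / 2 * δ / 4 with hγ
  have hγ0 : 0 < γ := by positivity
  obtain ⟨r, hr2, hr⟩ : ∃ r : ℝ, 2 ≤ r ∧ 4 * κ * (2 * (M + 2) ^ 2 * D) * Z r ≤ γ := by
    have h1 := hZ.const_mul (4 * κ * (2 * (M + 2) ^ 2 * D))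
    rw [mul_zero] at h1
    exact ((eventually_ge_atTop 2).and (h1.eventually_le_const hγ0)).exists
  have hr0 : 0 < r := by linarith
  set V := r ^ 2 * κ * (2 * 2) with hV
  have hV0 : 0 ≤ V := by positivity
  set δ₁ := γ / (V + 1) with hδ₁
  have hδ₁0 : 0 < δ₁ := by positivity
  have hVδ : V * δ₁ ≤ γ := by
    rw [hδ₁, mul_div_assoc', div_le_iff₀ (by positivity)]; nlinarith
  -- then the outer radius
  set B : ℝ → ℝ := fun R => 4 * κ * ((M + 4) ^ 2 * (22 * D * (2 * (M + 2) ^ 2 * D) * Z R +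
    25 * D * R⁻¹) + R⁻¹) with hB
  have hBlim : Tendsto (fun R => 1 / (4 * δ₁) * B R) atTop (𝓝 0) := by
    have := (((((hZ.const_mul (22 * D * (2 * (M + 2) ^ 2 * D))).add
      (hinv.const_mul (25 * D))).const_mul ((M + 4 : ℝ) ^ 2)).add hinv).const_mul
      (4 * κ)).const_mul (1 / (4 * δ₁))
    simpa using this
  have hVlim : Tendsto (fun R : ℝ => V * R⁻¹) atTop (𝓝 0) := by simpa using hinv.const_mul V
  obtain ⟨R, hR1, hR2, hR3⟩ : ∃ R : ℝ, 2 * r ≤ R ∧ 1 / (4 * δ₁) * B R ≤ γ ∧ V * R⁻¹ ≤ γ :=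
    ((eventually_ge_atTop _).and ((hBlim.eventually_le_const hγ0).and
      (hVlim.eventually_le_const hγ0))).exists
  have hR0 : 4 ≤ R := by linarith
  have hRpos : 0 < R := by linarith
  set ε := (R ^ 5)⁻¹ with hε
  have hε0 : 0 < ε := by positivity
  have hεR : ε ≤ R⁻¹ := by
    rw [hε]; gcongr; exact le_self_pow₀ (by linarith) (by norm_num)
  refine ⟨R, ε, by linarith, hε0, fun W hW hW0 hWR => ?_⟩
  set Q := Metric.closedBall (0 : Plane) R ×ˢ Icc (-R ^ 2) (R ^ 2) with hQ
  obtain ⟨ψ, sψ, ψ0, ψ1, ψone, ψz, ψx, ψt, ψL⟩ := hcut R (R ^ 2) hRpos (by positivity)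
  have hcutoff : IsCutoff Q ψ (D / R ^ 2) := by
    refine ⟨(isCompact_closedBall _ _).prod isCompact_Icc, sψ, ψ0, ψ1, ψz, fun P => ?_,
      fun i P => ?_, fun P => ?_⟩
    · exact (ψt P).trans (by gcongr; simp only [D]; nlinarith)
    · have := abs_le.1 (ψx i P)
      calc _ ≤ (C / R) ^ 2 := sq_le_sq' this.1 this.2
        _ = C ^ 2 / R ^ 2 := by ring
        _ ≤ _ := by gcongr; simp only [D]; nlinarith
    · exact (ψL P).trans (by gcongr; simp only [D]; nlinarith)
  have I3 := integral_dt_sq_cutoff_le hcutoff hp hℓ hM hW hW0 (fun P hP => (hWR P hP).1)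
    (fun P hP => (hWR P hP).2) (A := A R) rfl rfl
  have hvol : volume.real Q = R ^ 2 * κ * (2 * R ^ 2) := by
    have := volume_real_cylinder (R := R) (b := R ^ 2) hRpos.le (by positivity) 0 0
    simpa [hQ] using this
  rw [hvol] at I3
  have I3' : ∫ P in Q, ψ P ^ (M + 4) * dd et W P ^ 2 ≤ B R := by
    refine I3.trans ?_
    have e1 : 2 * (R ^ 2 * κ * (2 * R ^ 2)) * ((M + 4) ^ 2 * (D / R ^ 2) *
        (22 * (A R * Z R) + 25 * ε) + ε ^ 2) = 4 * κ * ((M + 4) ^ 2 *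
          (22 * D * (2 * (M + 2) ^ 2 * D) * Z R + 25 * D * (R ^ 2 * ε)) + R ^ 4 * ε ^ 2) := by
      simp only [hAdef]
      field_simp
      ring
    have e2 : R ^ 2 * ε ≤ R⁻¹ := by
      rw [hε]
      have : R ^ 2 * (R ^ 5)⁻¹ = (R ^ 3)⁻¹ := by field_simp
      rw [this]; gcongr; exact le_self_pow₀ (by linarith) (by norm_num)
    have e3 : R ^ 4 * ε ^ 2 ≤ R⁻¹ := by
      rw [hε]
      have : R ^ 4 * (R ^ 5)⁻¹ ^ 2 = (R ^ 6)⁻¹ := by field_simp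
      rw [this]; gcongr; exact le_self_pow₀ (by linarith) (by norm_num)
    change 2 * (R ^ 2 * κ * (2 * R ^ 2)) * ((M + 4) ^ 2 * (D / R ^ 2) *
        (22 * (A R * Z R) + 25 * ε) + ε ^ 2) ≤ _
    rw [e1]
    change _ ≤ 4 * κ * ((M + 4) ^ 2 * (22 * D * (2 * (M + 2) ^ 2 * D) * Z R +
      25 * D * R⁻¹) + R⁻¹)
    gcongr
  obtain ⟨θ, sθ, θ0, θ1, θone, θz, θx, θt, θL⟩ := hcut r 2 hr0 (by norm_num)
  set Q' := Metric.closedBall (0 : Plane) r ×ˢ Icc (-2 : ℝ) 2 with hQ'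
  have hQ'c : IsCompact Q' := (isCompact_closedBall _ _).prod isCompact_Icc
  have hsub : Q' ⊆ Metric.closedBall (0 : Plane) (R / 2) ×ˢ Icc (-(R ^ 2 / 2)) (R ^ 2 / 2) := by
    refine prod_mono (Metric.closedBall_subset_closedBall (by linarith))
      (Icc_subset_Icc ?_ ?_) <;> nlinarith
  have hsub' : Q' ⊆ Q := hsub.trans (prod_mono (Metric.closedBall_subset_closedBall (by linarith))
      (Icc_subset_Icc (by nlinarith) (by nlinarith)))
  have cd : Continuous (dd et W) := (smooth_dd hW).continuous
  have cψ := sψ.continuous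
  have cθ := sθ.continuous
  have cp := continuous_rpow_of_one_lt hp hW
  have I4 : ∫ P in Q', dd et W P ^ 2 ≤ B R := by
    refine le_trans ?_ I3'
    have : ∫ P in Q', dd et W P ^ 2 = ∫ P in Q', ψ P ^ (M + 4) * dd et W P ^ 2 :=
      setIntegral_congr_fun hQ'c.measurableSet fun P hP => by simp [ψone P (hsub hP)]
    rw [this]
    refine setIntegral_mono_set ?_ ?_ hsub'.eventuallyLE
    · exact Continuous.continuousOn (by fun_prop) |>.integrableOn_compact hcutoff.isCompact
    · exact Eventually.of_forall fun P => mul_nonneg (pow_nonneg (ψ0 P) _) (sq_nonneg _)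
  have I5 := integral_rpow_cutoff_le_dt hQ'c sθ θ0 θ1 θz (a := D / r ^ 2)
    (fun i P => by
      have := abs_le.1 (θx i P)
      calc _ ≤ (C / r) ^ 2 := sq_le_sq' this.1 this.2
        _ = C ^ 2 / r ^ 2 := by ring
        _ ≤ _ := by gcongr; simp only [D]; nlinarith)
    (fun P => (θL P).trans (by gcongr; simp only [D]; nlinarith)) hp hℓ hM hW hW0
    (fun P hP => (hWR P (hsub' hP)).2) hδ₁0 (A := A r) rfl rfl
  have hvol' : volume.real Q' = V := by
    have := volume_real_cylinder (R := r) (b := 2) hr0.le (by norm_num) 0 0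
    simpa [hQ'] using this
  rw [hvol'] at I5
  have I6 : ∫ P in Metric.closedBall (0 : Plane) 1 ×ˢ Icc (-1 : ℝ) 1, W P ^ p ≤
      ∫ P in Q', W P ^ p * θ P ^ (M + 2) := by
    have hs : Metric.closedBall (0 : Plane) 1 ×ˢ Icc (-1 : ℝ) 1 ⊆
        Metric.closedBall (0 : Plane) (r / 2) ×ˢ Icc (-(2 / 2) : ℝ) (2 / 2) :=
      prod_mono (Metric.closedBall_subset_closedBall (by linarith))
        (Icc_subset_Icc (by norm_num) (by norm_num))
    have hs' : Metric.closedBall (0 : Plane) 1 ×ˢ Icc (-1 : ℝ) 1 ⊆ Q' :=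
      prod_mono (Metric.closedBall_subset_closedBall (by linarith))
        (Icc_subset_Icc (by norm_num) (by norm_num))
    have : ∫ P in Metric.closedBall (0 : Plane) 1 ×ˢ Icc (-1 : ℝ) 1, W P ^ p =
        ∫ P in Metric.closedBall (0 : Plane) 1 ×ˢ Icc (-1 : ℝ) 1, W P ^ p * θ P ^ (M + 2) :=
      setIntegral_congr_fun (measurableSet_closedBall.prod measurableSet_Icc) fun P hP => by
        simp [θone P (hs hP)]
    rw [this]
    refine setIntegral_mono_set ?_ ?_ hs'.eventuallyLE
    · exact Continuous.continuousOn (by fun_prop) |>.integrableOn_compact hQ'c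
    · exact Eventually.of_forall fun P =>
        mul_nonneg (Real.rpow_nonneg (hW0 P) _) (pow_nonneg (θ0 P) _)
  have I7 : V * (A r * Z r) ≤ γ := by
    refine le_trans (le_of_eq ?_) hr
    simp only [hAdef, hV]
    field_simp
    ring
  have I8 : V * ε ≤ γ := (mul_le_mul_of_nonneg_left hεR hV0).trans hR3
  have I9 : 1 / (4 * δ₁) * (∫ P in Q', dd et W P ^ 2) ≤ γ :=
    (mul_le_mul_of_nonneg_left I4 (by positivity)).trans hR2
  change _ ≤ V * (A r * Z r + ε + δ₁) + _ at I5
  have : ℓ / 2 * (∫ P in Q', W P ^ p * θ P ^ (M + 2)) ≤ ℓ / 2 * δ := by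
    calc _ ≤ _ := I5
      _ ≤ 4 * γ := by linarith
      _ = _ := by rw [hγ]; ring
  exact I6.trans (le_of_mul_le_mul_left this (by positivity))

/-- Slicewise weak formulation of `∂ₜ u = Δ u + g` on `B × I`. -/
def SW (u g : Plane × ℝ → ℝ) (B : Set Plane) (I : Set ℝ) : Prop :=
  ∀ (ψ : Plane × ℝ → ℝ) (K : Set Plane), IsCompact K → K ⊆ B →
    (∀ x ∉ K, ∀ t, ψ (x, t) = 0) → ∀ t₁ ∈ I, ∀ t₂ ∈ I, t₁ ≤ t₂ →
    (∀ x, ∀ t ∈ Icc t₁ t₂, ContDiffAt ℝ 2 ψ (x, t)) →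
    (∫ x, u (x, t₂) * ψ (x, t₂)) - (∫ x, u (x, t₁) * ψ (x, t₁)) =
      ∫ t in t₁..t₂, ∫ x, (u (x, t) * (dd et ψ (x, t) + Lx ψ (x, t)) + g (x, t) * ψ (x, t))

theorem SW.mono {u g B I B' I'} (h : SW u g B I) (hB : B' ⊆ B) (hI : I' ⊆ I) : SW u g B' I' :=
  fun ψ K hK hKB h0 t₁ h₁ t₂ h₂ => h ψ K hK (hKB.trans hB) h0 t₁ (hI h₁) t₂ (hI h₂)

/-- Parabolic dilation. -/
noncomputable def pscale (x₀ : Plane) (t₀ r : ℝ) (P : Plane × ℝ) : Plane × ℝ :=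
  (x₀ + r • P.1, t₀ + r ^ 2 * P.2)

theorem integral_scale (x₀ : Plane) {r : ℝ} (hr : 0 < r) (F : Plane → ℝ) :
    ∫ x, F x = r ^ 2 * ∫ y, F (x₀ + r • y) := by
  have h1 := Measure.integral_comp_smul (volume : Measure Plane) (fun y => F (x₀ + y)) r
  rw [h1, integral_add_left_eq_self F x₀]
  simp only [finrank_euclideanSpace, Fintype.card_fin, smul_eq_mul]
  rw [abs_of_pos (by positivity)]
  field_simp

theorem SW.scale {u g B I} (h : SW u g B I) (x₀ : Plane) (t₀ : ℝ) {r : ℝ} (hr : 0 < r)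
    {B' : Set Plane} {I' : Set ℝ} (hB : ∀ y ∈ B', x₀ + r • y ∈ B)
    (hI : ∀ s ∈ I', t₀ + r ^ 2 * s ∈ I) :
    SW (fun P => u (pscale x₀ t₀ r P)) (fun P => r ^ 2 * g (pscale x₀ t₀ r P)) B' I' := by
  intro ψ K hK hKB h0 t₁ h₁ t₂ h₂ ht hψ
  have hr2 : 0 < r ^ 2 := by positivity
  let A : Plane × ℝ →L[ℝ] Plane × ℝ :=
    (r⁻¹ • ContinuousLinearMap.id ℝ Plane).prodMap ((r ^ 2)⁻¹ • ContinuousLinearMap.id ℝ ℝ)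
  have hA : ∀ x t, A (x, t) = (r⁻¹ • x, (r ^ 2)⁻¹ * t) := fun x t => by simp [A]
  let b : Plane × ℝ := (-(r⁻¹ • x₀), -((r ^ 2)⁻¹ * t₀))
  have hAb : ∀ y s, b + A (x₀ + r • y, t₀ + r ^ 2 * s) = (y, s) := fun y s => by
    simp only [hA, b, Prod.mk_add_mk, smul_add, smul_smul, mul_add, ← mul_assoc]
    rw [inv_mul_cancel₀ hr.ne', inv_mul_cancel₀ hr2.ne']
    simp
  have hAx : ∀ i, A (ex i) = r⁻¹ • ex i := fun i => by simp [ex, A]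
  have hAt : A et = (r ^ 2)⁻¹ • et := by simp [et, A]
  set ψ' : Plane × ℝ → ℝ := fun Q => ψ (b + A Q) with hψ'
  have hbA : ∀ P : Plane × ℝ, (b + A P).1 = r⁻¹ • (P.1 - x₀) ∧
      (b + A P).2 = (r ^ 2)⁻¹ * (P.2 - t₀) := by
    rintro ⟨x, t⟩
    simp only [hA, b, Prod.mk_add_mk, smul_sub, mul_sub]
    exact ⟨by abel, by ring⟩
  have hin : ∀ t, t ∈ Icc (t₀ + r ^ 2 * t₁) (t₀ + r ^ 2 * t₂) →
      (r ^ 2)⁻¹ * (t - t₀) ∈ Icc t₁ t₂ := by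
    rintro t ⟨h1, h2⟩
    rw [mem_Icc, le_inv_mul_iff₀ hr2, inv_mul_le_iff₀ hr2]
    constructor <;> linarith
  have hcd : ∀ P : Plane × ℝ, P.2 ∈ Icc (t₀ + r ^ 2 * t₁) (t₀ + r ^ 2 * t₂) →
      ContDiffAt ℝ 2 ψ (b + A P) := by
    intro P hP
    have e := hbA P
    have := hψ (b + A P).1 (b + A P).2 (by rw [e.2]; exact hin _ hP)
    exact this
  have key := h ψ' ((fun y => x₀ + r • y) '' K) (hK.image (by fun_prop))
    (by rintro _ ⟨y, hy, rfl⟩; exact hB y (hKB hy)) ?_ (t₀ + r ^ 2 * t₁) (hI _ h₁)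
    (t₀ + r ^ 2 * t₂) (hI _ h₂) (by gcongr) ?_
  · rw [integral_scale x₀ hr (fun x => u (x, t₀ + r ^ 2 * t₂) * ψ' (x, t₀ + r ^ 2 * t₂)),
      integral_scale x₀ hr (fun x => u (x, t₀ + r ^ 2 * t₁) * ψ' (x, t₀ + r ^ 2 * t₁))] at key
    have e1 := intervalIntegral.integral_comp_add_mul (a := t₁) (b := t₂)
      (fun t => ∫ x, (u (x, t) * (dd et ψ' (x, t) + Lx ψ' (x, t)) + g (x, t) * ψ' (x, t)))
      hr2.ne' t₀
    simp only [smul_eq_mul] at e1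
    rw [eq_inv_mul_iff_mul_eq₀ hr2.ne'] at e1
    rw [← e1, ← mul_sub] at key
    have key2 := mul_left_cancel₀ hr2.ne' key
    simp only [hψ', hAb] at key2
    simp only [pscale]
    rw [key2]
    refine intervalIntegral.integral_congr fun s hs => ?_
    rw [uIcc_of_le ht] at hs
    rw [integral_scale x₀ hr]
    rw [← integral_const_mul]
    refine integral_congr_ae (Eventually.of_forall fun y => ?_)
    have hc := hψ y s hs
    have d1 : dd et (fun Q => ψ (b + A Q)) (x₀ + r • y, t₀ + r ^ 2 * s) =
        (r ^ 2)⁻¹ * dd et ψ (y, s) := by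
      rw [dd_comp_affine A b (by rw [hAb]; exact hc.differentiableAt (by simp)), hAt,
        dd_smul_left, hAb]
    have d2 : Lx (fun Q => ψ (b + A Q)) (x₀ + r • y, t₀ + r ^ 2 * s) =
        (r ^ 2)⁻¹ * Lx ψ (y, s) := by
      simp only [Lx, Finset.mul_sum]
      refine Finset.sum_congr rfl fun i _ => ?_
      have hcont : ContinuousAt (fun Q => b + A Q) (x₀ + r • y, t₀ + r ^ 2 * s) := by fun_prop
      have e : dd (ex i) (fun Q => ψ (b + A Q)) =ᶠ[𝓝 (x₀ + r • y, t₀ + r ^ 2 * s)]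
          fun Q => r⁻¹ * dd (ex i) ψ (b + A Q) := by
        have : ∀ᶠ Q in 𝓝 (x₀ + r • y, t₀ + r ^ 2 * s), ContDiffAt ℝ 2 ψ (b + A Q) := by
          refine hcont.eventually ?_
          simp only [hAb]
          exact hc.eventually (by simp)
        filter_upwards [this] with Q hQ
        rw [dd_comp_affine A b (hQ.differentiableAt (by simp)), hAx, dd_smul_left]
      rw [dd_congr e, dd_const_mul, dd_comp_affine A b, hAx, dd_smul_left, hAb]
      · field_simp
      · rw [hAb]
        exact (contDiffAt_dd (m := 1) hc (by norm_num)).differentiableAt (by simp)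
    simp only [d1, d2]
    field_simp
    rw [hAb]
  · intro x hx t
    have : (b + A (x, t)).1 ∉ K := by
      rw [(hbA _).1]
      intro hK'
      refine hx ⟨_, hK', ?_⟩
      simp [smul_smul, hr.ne']
    exact h0 _ this _
  · intro x t ht'
    exact (hcd (x, t) ht').comp (x, t) (by fun_prop : ContDiff ℝ 2 fun Q => b + A Q).contDiffAt

/-- Integrability in time of slice integrals of bounded measurable functions. -/
theorem intervalIntegrable_slice {F : Plane × ℝ → ℝ} (hF : Measurable F) {K : Set Plane}
    (hK : IsCompact K) {a b C : ℝ} (h0 : ∀ x ∉ K, ∀ t, F (x, t) = 0)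
    (hC : ∀ x ∈ K, ∀ t ∈ uIcc a b, |F (x, t)| ≤ C) :
    IntervalIntegrable (fun t => ∫ x, F (x, t)) volume a b := by
  have hsm : StronglyMeasurable fun t => ∫ x, F (x, t) :=
    StronglyMeasurable.integral_prod_right (f := fun t x => F (x, t))
      (hF.comp measurable_swap).stronglyMeasurable
  rw [intervalIntegrable_iff]
  refine Measure.integrableOn_of_bounded (M := C * volume.real K) (by simp)
    hsm.aestronglyMeasurable ?_
  refine (ae_restrict_mem measurableSet_uIoc).mono fun t ht => ?_
  have : ∫ x, F (x, t) = ∫ x in K, F (x, t) := by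
    rw [setIntegral_eq_integral_of_forall_compl_eq_zero fun x hx => h0 x hx t]
  rw [this]
  exact norm_setIntegral_le_of_norm_le_const hK.measure_lt_top
    fun x hx => hC x hx t (uIoc_subset_uIcc ht)

theorem integrable_slice {F : Plane × ℝ → ℝ} (hF : Measurable F) {K : Set Plane}
    (hK : IsCompact K) {C t : ℝ} (h0 : ∀ x ∉ K, F (x, t) = 0)
    (hC : ∀ x ∈ K, |F (x, t)| ≤ C) : Integrable fun x => F (x, t) := by
  have h1 : IntegrableOn (fun x => F (x, t)) K volume :=
    Measure.integrableOn_of_bounded (M := C) hK.measure_lt_top.ne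
      (hF.comp measurable_prodMk_right).aestronglyMeasurable
      ((ae_restrict_mem hK.measurableSet).mono fun x hx => hC x hx)
  rwa [integrableOn_iff_integrable_of_support_subset] at h1
  intro x hx
  by_contra h
  exact hx (h0 x h)

/-- The heat kernel on the plane. -/
noncomputable def HK (y : Plane) (τ : ℝ) : ℝ :=
  (4 * Real.pi * τ)⁻¹ * Real.exp (-(‖y‖ ^ 2 / (4 * τ)))

theorem HK_nonneg (y : Plane) {τ : ℝ} (hτ : 0 < τ) : 0 ≤ HK y τ := by
  unfold HK; positivity

theorem integral_HK {τ : ℝ} (hτ : 0 < τ) : ∫ y, HK y τ = 1 := by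
  have h := GaussianFourier.integral_rexp_neg_mul_sq_norm (V := Plane) (b := (4 * τ)⁻¹)
    (by positivity)
  simp only [finrank_euclideanSpace, Fintype.card_fin] at h
  simp only [HK]
  rw [integral_const_mul]
  have e : ∀ v : Plane, Real.exp (-(‖v‖ ^ 2 / (4 * τ))) = Real.exp (-(4 * τ)⁻¹ * ‖v‖ ^ 2) :=
    fun v => by congr 1; rw [div_eq_mul_inv]; ring
  simp only [e, h]
  norm_num
  have := Real.pi_pos
  field_simp

theorem integrable_HK {τ : ℝ} (hτ : 0 < τ) : Integrable fun y => HK y τ := by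
  by_contra h
  have := integral_HK hτ
  rw [integral_undef h] at this
  exact zero_ne_one this

theorem HK_scale {ε : ℝ} (hε : 0 < ε) (y : Plane) : HK (Real.sqrt ε • y) ε = ε⁻¹ * HK y 1 := by
  unfold HK
  rw [norm_smul, mul_pow, Real.norm_eq_abs, sq_abs, Real.sq_sqrt hε.le]
  have : ε * ‖y‖ ^ 2 / (4 * ε) = ‖y‖ ^ 2 / (4 * 1) := by field_simp
  rw [this]
  field_simp

theorem HK_mul_sq_le (y : Plane) {τ : ℝ} (hτ : 0 < τ) :
    HK y τ * ‖y‖ ^ 2 / τ ≤ 16 * HK y (2 * τ) := by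
  unfold HK
  have h1 := Real.add_one_le_exp (‖y‖ ^ 2 / (8 * τ))
  have e : Real.exp (-(‖y‖ ^ 2 / (4 * (2 * τ)))) =
      Real.exp (-(‖y‖ ^ 2 / (4 * τ))) * Real.exp (‖y‖ ^ 2 / (8 * τ)) := by
    rw [← Real.exp_add]; congr 1; field_simp; ring
  rw [e]
  set E := Real.exp (-(‖y‖ ^ 2 / (4 * τ)))
  have hE : 0 < E := Real.exp_pos _
  have hp := Real.pi_pos
  have : ‖y‖ ^ 2 / τ ≤ 8 * Real.exp (‖y‖ ^ 2 / (8 * τ)) := by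
    have : ‖y‖ ^ 2 / τ = 8 * (‖y‖ ^ 2 / (8 * τ)) := by field_simp
    linarith
  calc (4 * Real.pi * τ)⁻¹ * E * ‖y‖ ^ 2 / τ = (4 * Real.pi * τ)⁻¹ * E * (‖y‖ ^ 2 / τ) := by ring
    _ ≤ (4 * Real.pi * τ)⁻¹ * E * (8 * Real.exp (‖y‖ ^ 2 / (8 * τ))) := by gcongr
    _ = _ := by field_simp; norm_num

theorem HK_le_off {y : Plane} {τ : ℝ} (hτ : 0 < τ) (h : 1 / 4 ≤ ‖y‖ ∨ 1 / 4 ≤ τ) :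
    HK y τ ≤ 8192 ∧ HK y τ / τ ≤ 8192 := by
  have hp := Real.pi_gt_three
  unfold HK
  rcases h with h | h
  · have hx : 0 < (64 * τ)⁻¹ := by positivity
    have h0 : Real.exp (-(‖y‖ ^ 2 / (4 * τ))) ≤ (Real.exp (64 * τ)⁻¹)⁻¹ := by
      rw [← Real.exp_neg]
      refine Real.exp_le_exp.2 (neg_le_neg ?_)
      rw [inv_eq_one_div, div_le_div_iff₀ (by positivity) (by positivity)]
      have : 1 / 16 ≤ ‖y‖ ^ 2 := by nlinarith
      nlinarith
    have h1 : (Real.exp (64 * τ)⁻¹)⁻¹ ≤ 64 * τ := by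
      rw [inv_le_comm₀ (Real.exp_pos _) (by positivity)]
      linarith [Real.add_one_le_exp (64 * τ)⁻¹]
    have h2 : (Real.exp (64 * τ)⁻¹)⁻¹ ≤ 2 * (64 * τ) ^ 2 := by
      rw [inv_le_comm₀ (Real.exp_pos _) (by positivity)]
      have := Real.quadratic_le_exp_of_nonneg hx.le
      have e : (2 * (64 * τ) ^ 2)⁻¹ = ((64 * τ)⁻¹) ^ 2 / 2 := by field_simp
      rw [e]
      linarith
    constructor
    · calc (4 * Real.pi * τ)⁻¹ * Real.exp (-(‖y‖ ^ 2 / (4 * τ)))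
          ≤ (4 * Real.pi * τ)⁻¹ * (64 * τ) := by gcongr; exact h0.trans h1
        _ = 16 / Real.pi := by field_simp; norm_num
        _ ≤ 8192 := by rw [div_le_iff₀ (by positivity)]; linarith
    · calc (4 * Real.pi * τ)⁻¹ * Real.exp (-(‖y‖ ^ 2 / (4 * τ))) / τ
          ≤ (4 * Real.pi * τ)⁻¹ * (2 * (64 * τ) ^ 2) / τ := by gcongr; exact h0.trans h2
        _ = 2048 / Real.pi := by field_simp; norm_num
        _ ≤ 8192 := by rw [div_le_iff₀ (by positivity)]; linarith
  · have h0 : Real.exp (-(‖y‖ ^ 2 / (4 * τ))) ≤ 1 := Real.exp_le_one_iff.2 (by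
      rw [neg_nonpos]; positivity)
    have h1 : (4 * Real.pi * τ)⁻¹ ≤ 1 := inv_le_one_of_one_le₀ (by nlinarith)
    have h2 : (4 * Real.pi * τ)⁻¹ * Real.exp (-(‖y‖ ^ 2 / (4 * τ))) ≤ 1 :=
      mul_le_one₀ h1 (Real.exp_pos _).le h0
    refine ⟨h2.trans (by norm_num), ?_⟩
    rw [div_le_iff₀ hτ]
    linarith

theorem dd_eq_of_line {V : Type*} [NormedAddCommGroup V] [NormedSpace ℝ V] {v : V} {F : V → ℝ}
    {P : V} {d : ℝ} (hF : DifferentiableAt ℝ F P) (h : HasDerivAt (fun s : ℝ => F (P + s • v)) d 0) :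
    dd v F P = d := by
  unfold dd
  rw [← hF.lineDeriv_eq_fderiv]
  exact h.deriv

/-- The backward heat kernel with pole at time `ε`. -/
noncomputable def bk (ε : ℝ) (P : Plane × ℝ) : ℝ := HK P.1 (ε - P.2)

theorem contDiffAt_bk {ε : ℝ} {P : Plane × ℝ} (h : P.2 < ε) {n : ℕ∞ω} :
    ContDiffAt ℝ n (bk ε) P := by
  unfold bk HK
  have hτ : ε - P.2 ≠ 0 := by linarith
  have hp := Real.pi_pos.ne'
  have h2 : ContDiffAt ℝ n (fun Q : Plane × ℝ => ε - Q.2) P :=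
    contDiffAt_const.sub contDiffAt_snd
  refine ((contDiffAt_const.mul h2).inv (by positivity)).mul (ContDiffAt.exp ?_)
  exact ((contDiffAt_fst.norm_sq ℝ).div (contDiffAt_const.mul h2) (by positivity)).neg

theorem dd_ex_bk {ε : ℝ} {P : Plane × ℝ} (h : P.2 < ε) (i : Fin 2) :
    dd (ex i) (bk ε) P = -(2 * (ε - P.2))⁻¹ * (P.1 i * bk ε P) := by
  refine dd_eq_of_line ((contDiffAt_bk (n := 1) h).differentiableAt (by simp)) ?_
  have hτ : ε - P.2 ≠ 0 := by linarith
  have e : (fun s : ℝ => bk ε (P + s • ex i)) = fun s => (4 * Real.pi * (ε - P.2))⁻¹ *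
      Real.exp (-((‖P.1‖ ^ 2 + 2 * (s * P.1 i) + s ^ 2) / (4 * (ε - P.2)))) := by
    funext s
    simp only [bk, HK, ex, Prod.snd_add, Prod.smul_snd, Prod.fst_add, Prod.smul_fst, smul_zero,
      add_zero]
    rw [norm_add_sq_real, norm_smul, inner_smul_right, EuclideanSpace.inner_single_right]
    simp
  rw [e]
  have h1 : HasDerivAt (fun s : ℝ => -((‖P.1‖ ^ 2 + 2 * (s * P.1 i) + s ^ 2) / (4 * (ε - P.2))))
      (-((2 * (1 * P.1 i) + 2 * 0) / (4 * (ε - P.2)))) 0 := by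
    have h2 := (((hasDerivAt_id (0 : ℝ)).mul_const (P.1 i)).const_mul 2).const_add (‖P.1‖ ^ 2)
    have h3 := ((h2.add ((hasDerivAt_id (0 : ℝ)).pow 2)).div_const (4 * (ε - P.2))).neg
    refine h3.congr_deriv ?_
    simp
  refine (h1.exp.const_mul _).congr_deriv ?_
  simp only [bk, HK]
  field_simp
  simp
  ring

theorem dd_et_bk {ε : ℝ} {P : Plane × ℝ} (h : P.2 < ε) :
    dd et (bk ε) P = ((ε - P.2)⁻¹ - ‖P.1‖ ^ 2 / (4 * (ε - P.2) ^ 2)) * bk ε P := by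
  refine dd_eq_of_line ((contDiffAt_bk (n := 1) h).differentiableAt (by simp)) ?_
  have hτ : ε - P.2 ≠ 0 := by linarith
  have hp := Real.pi_pos.ne'
  have e : (fun s : ℝ => bk ε (P + s • et)) = fun s => (4 * Real.pi * (ε - (P.2 + s)))⁻¹ *
      Real.exp (-(‖P.1‖ ^ 2 / (4 * (ε - (P.2 + s))))) := by
    funext s
    simp [bk, HK, et]
  rw [e]
  have h0 : HasDerivAt (fun s : ℝ => ε - (P.2 + s)) (-1) 0 := by
    simpa using ((hasDerivAt_id (0 : ℝ)).const_add P.2).const_sub ε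
  have h1 := (h0.const_mul (4 * Real.pi)).inv (by simpa using hτ)
  have h2 := ((h0.const_mul 4).inv (by simpa using hτ)).const_mul (‖P.1‖ ^ 2)
  refine (h1.mul h2.neg.exp).congr_deriv ?_
  simp only [bk, HK, Pi.neg_apply, Pi.inv_apply, add_zero]
  have e3 : ‖P.1‖ ^ 2 * (4 * (ε - P.2))⁻¹ = ‖P.1‖ ^ 2 / (4 * (ε - P.2)) := (div_eq_mul_inv _ _).symm
  rw [e3]
  field_simp
  ring

theorem dd_dd_bk {ε : ℝ} {P : Plane × ℝ} (h : P.2 < ε) (i : Fin 2) :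
    dd (ex i) (dd (ex i) (bk ε)) P =
      (-(2 * (ε - P.2))⁻¹ + (P.1 i) ^ 2 / (4 * (ε - P.2) ^ 2)) * bk ε P := by
  have hτ : ε - P.2 ≠ 0 := by linarith
  have hev : ∀ᶠ Q : Plane × ℝ in 𝓝 P, Q.2 < ε :=
    (isOpen_lt continuous_snd continuous_const).mem_nhds h
  have e : dd (ex i) (bk ε) =ᶠ[𝓝 P] fun Q => -(2 * (ε - Q.2))⁻¹ * (Q.1 i * bk ε Q) := by
    filter_upwards [hev] with Q hQ using dd_ex_bk hQ i
  rw [dd_congr e]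
  have hb := (contDiffAt_bk (n := 1) h).differentiableAt (by simp)
  have hc : DifferentiableAt ℝ (fun Q : Plane × ℝ => Q.1 i) P := by fun_prop
  have h2 : DifferentiableAt ℝ (fun Q : Plane × ℝ => -(2 * (ε - Q.2))⁻¹) P := by
    refine DifferentiableAt.fun_neg (DifferentiableAt.fun_inv (by fun_prop) (by positivity))
  have d1 : dd (ex i) (fun Q : Plane × ℝ => Q.1 i) P = 1 := by
    refine dd_eq_of_line hc ?_
    simp only [ex]
    simpa using (hasDerivAt_id (0 : ℝ)).const_add (P.1 i)
  have d2 : dd (ex i) (fun Q : Plane × ℝ => -(2 * (ε - Q.2))⁻¹) P = 0 := by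
    refine dd_eq_of_line h2 ?_
    simp only [ex]
    simpa using hasDerivAt_const (0 : ℝ) _
  rw [dd_mul h2 (hc.fun_mul hb), dd_mul hc hb, d1, d2, dd_ex_bk h]
  field_simp
  ring

theorem Lx_bk {ε : ℝ} {P : Plane × ℝ} (h : P.2 < ε) : Lx (bk ε) P = -dd et (bk ε) P := by
  have hτ : ε - P.2 ≠ 0 := by linarith
  rw [dd_et_bk h]
  simp only [Lx, dd_dd_bk h, Fin.sum_univ_two, EuclideanSpace.norm_sq_eq, Real.norm_eq_abs, sq_abs]
  field_simp
  ring

/-- The radial derivative `x · ∇z`. -/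
noncomputable def rad (z : Plane → ℝ) (x : Plane) : ℝ :=
  ∑ i, x i * dd (EuclideanSpace.single i 1) z x

/-- The source produced by localizing the backward heat kernel with the cutoff `z ⊗ m`. -/
noncomputable def cutErr (z : Plane → ℝ) (m : ℝ → ℝ) (ε : ℝ) (x : Plane) (t : ℝ) : ℝ :=
  m t * lap z x + deriv m t * z x - m t * rad z x / (ε - t)

theorem dd_et_add_Lx_bk_mul {z : Plane → ℝ} {m : ℝ → ℝ} (hz : ContDiff ℝ 2 z) (hm : ContDiff ℝ 2 m)
    {ε t : ℝ} (x : Plane) (h : t < ε) :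
    dd et (fun P : Plane × ℝ => bk ε P * (z P.1 * m P.2)) (x, t) +
      Lx (fun P : Plane × ℝ => bk ε P * (z P.1 * m P.2)) (x, t) =
    HK x (ε - t) * cutErr z m ε x t := by
  have hτ : ε - t ≠ 0 := by linarith
  have hb : ContDiffAt ℝ 2 (bk ε) (x, t) := contDiffAt_bk h
  have hZ : ContDiffAt ℝ 2 (fun P : Plane × ℝ => z P.1 * m P.2) (x, t) := by
    have : ContDiff ℝ 2 (fun P : Plane × ℝ => z P.1 * m P.2) := by fun_prop
    exact this.contDiffAt
  have hbd := hb.differentiableAt (by simp)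
  have hZd := hZ.differentiableAt (by simp)
  have hzd : DifferentiableAt ℝ z x := hz.contDiffAt.differentiableAt (by simp)
  have e1 : dd et (fun P : Plane × ℝ => z P.1 * m P.2) (x, t) = deriv m t * z x := by
    have h1 := dd_et_eq_deriv hZd
    have h2 := (hm.differentiable (by simp) t).hasDerivAt.const_mul (z x)
    rw [h1.unique h2, mul_comm]
  have e2 : ∀ i, dd (ex i) (fun P : Plane × ℝ => z P.1 * m P.2) (x, t) =
      m t * dd (EuclideanSpace.single i 1) z x := by
    intro i
    rw [← dd_ex_eq i hZd]
    simp only [mul_comm _ (m t)]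
    exact dd_const_mul _
  have e3 : Lx (fun P : Plane × ℝ => z P.1 * m P.2) (x, t) = m t * lap z x := by
    rw [← lap_slice hZ]
    change ∑ i, dd _ (dd _ fun y => z y * m t) x = m t * ∑ i, dd _ (dd _ z) x
    have : ∀ v : Plane, dd v (fun y => z y * m t) = fun y => m t * dd v z y := fun v => by
      funext y
      simp only [mul_comm _ (m t)]
      exact dd_const_mul _
    simp only [this, dd_const_mul, Finset.mul_sum]
  rw [dd_mul hbd hZd, Lx_mul hb hZ, Lx_bk (P := (x, t)) h, e1, e3]
  simp only [e2, dd_ex_bk (P := (x, t)) h]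
  simp only [cutErr, rad, bk, Fin.sum_univ_two]
  field_simp
  ring

theorem SW.heat_repr {u g B I} (h : SW u g B I) {z : Plane → ℝ} {m : ℝ → ℝ} (hz : ContDiff ℝ 2 z)
    (hm : ContDiff ℝ 2 m) {K : Set Plane} (hK : IsCompact K) (hKB : K ⊆ B)
    (h0 : ∀ x ∉ K, z x = 0) {t₁ t₂ ε : ℝ} (h₁ : t₁ ∈ I) (h₂ : t₂ ∈ I) (ht : t₁ ≤ t₂) (hε : t₂ < ε) :
    m t₂ * (∫ x, HK x (ε - t₂) * (z x * u (x, t₂))) -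
      m t₁ * (∫ x, HK x (ε - t₁) * (z x * u (x, t₁))) =
    ∫ t in t₁..t₂, ∫ x, HK x (ε - t) * (u (x, t) * cutErr z m ε x t + z x * m t * g (x, t)) := by
  have key := h (fun P => bk ε P * (z P.1 * m P.2)) K hK hKB
    (fun x hx t => by simp [h0 x hx]) t₁ h₁ t₂ h₂ ht (fun x t ht' => by
      have : ContDiff ℝ 2 (fun P : Plane × ℝ => z P.1 * m P.2) := by fun_prop
      exact (contDiffAt_bk (ht'.2.trans_lt hε)).mul this.contDiffAt)
  rw [← integral_const_mul, ← integral_const_mul]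
  convert key using 1
  · congr 1 <;>
    · refine integral_congr_ae (Eventually.of_forall fun x => ?_)
      simp only [bk]
      ring
  · refine intervalIntegral.integral_congr fun t ht' => ?_
    rw [uIcc_of_le ht] at ht'
    refine integral_congr_ae (Eventually.of_forall fun x => ?_)
    simp only
    rw [dd_et_add_Lx_bk_mul hz hm x (ht'.2.trans_lt hε)]
    simp only [bk]
    ring

theorem tendsto_integral_HK_mul {h : Plane → ℝ} (hm : Measurable h) {C : ℝ} (hC : ∀ x, |h x| ≤ C)
    (hc : ContinuousAt h 0) :
    Tendsto (fun ε => ∫ x, HK x ε * h x) (𝓝[>] 0) (𝓝 (h 0)) := by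
  have e : ∀ ε > 0, ∫ x, HK x ε * h x = ∫ x, HK x 1 * h (Real.sqrt ε • x) := by
    intro ε hε
    rw [integral_scale 0 (Real.sqrt_pos.2 hε), ← integral_const_mul, Real.sq_sqrt hε.le]
    refine integral_congr_ae (Eventually.of_forall fun y => ?_)
    simp only [zero_add]
    rw [HK_scale hε]
    field_simp
  have e1 : ∫ x, HK x 1 * h 0 = h 0 := by
    rw [integral_mul_const, integral_HK one_pos, one_mul]
  rw [← e1]
  refine Tendsto.congr' (f₁ := fun ε => ∫ x, HK x 1 * h (Real.sqrt ε • x)) ?_ ?_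
  · filter_upwards [self_mem_nhdsWithin] with ε hε using (e ε hε).symm
  refine tendsto_integral_filter_of_dominated_convergence (fun x => HK x 1 * C) ?_ ?_
    ((integrable_HK one_pos).mul_const C) ?_
  · refine Eventually.of_forall fun ε => ?_
    refine ((integrable_HK one_pos).aestronglyMeasurable).mul ?_
    exact (hm.comp (measurable_const_smul _)).aestronglyMeasurable
  · refine Eventually.of_forall fun ε => Eventually.of_forall fun x => ?_
    rw [norm_mul, Real.norm_of_nonneg (HK_nonneg x one_pos)]
    exact mul_le_mul_of_nonneg_left (hC _) (HK_nonneg x one_pos)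
  · refine Eventually.of_forall fun x => ?_
    refine Tendsto.const_mul _ ?_
    have h1 : Tendsto (fun ε => Real.sqrt ε • x) (𝓝[>] 0) (𝓝 0) := by
      have : Tendsto (fun ε => Real.sqrt ε • x) (𝓝 0) (𝓝 (Real.sqrt 0 • x)) :=
        (Real.continuous_sqrt.tendsto 0).smul_const x
      rw [Real.sqrt_zero, zero_smul] at this
      exact this.mono_left nhdsWithin_le_nhds
    exact hc.tendsto.comp h1

theorem measurable_HK : Measurable fun P : Plane × ℝ => HK P.1 P.2 := by
  unfold HK
  fun_prop

theorem tendsto_integral_HK_add {h : Plane → ℝ} (hi : Integrable h) {δ : ℝ} (hδ : 0 < δ) :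
    Tendsto (fun ε => ∫ x, HK x (ε + δ) * h x) (𝓝[>] 0) (𝓝 (∫ x, HK x δ * h x)) := by
  have hp := Real.pi_pos
  refine tendsto_integral_filter_of_dominated_convergence
    (fun x => (4 * Real.pi * δ)⁻¹ * ‖h x‖) ?_ ?_ (hi.norm.const_mul _) ?_
  · refine Eventually.of_forall fun ε => ?_
    exact (measurable_HK.comp measurable_prodMk_right).aestronglyMeasurable.mul
      hi.aestronglyMeasurable
  · filter_upwards [self_mem_nhdsWithin] with ε (hε : 0 < ε)
    refine Eventually.of_forall fun x => ?_
    rw [norm_mul, Real.norm_of_nonneg (HK_nonneg x (by linarith))]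
    gcongr
    unfold HK
    calc _ ≤ (4 * Real.pi * δ)⁻¹ * 1 := by
          gcongr
          · linarith
          · exact Real.exp_le_one_iff.2 (by rw [neg_nonpos]; positivity)
      _ = _ := mul_one _
  · refine Eventually.of_forall fun x => ?_
    refine Tendsto.mul_const _ ?_
    have : ContinuousAt (fun ε => HK x (ε + δ)) 0 := by
      unfold HK
      have h4 : 4 * Real.pi * (0 + δ) ≠ 0 := by positivity
      have h5 : 4 * (0 + δ) ≠ 0 := by positivity
      fun_prop (disch := assumption)
    have h2 := this.tendsto
    rw [zero_add] at h2
    exact h2.mono_left nhdsWithin_le_nhds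

theorem continuous_lap {z : Plane → ℝ} (hz : ContDiff ℝ 2 z) : Continuous (lap z) := by
  change Continuous fun x => ∑ i, dd (EuclideanSpace.single i 1) (dd (EuclideanSpace.single i 1) z) x
  refine continuous_finsetSum _ fun i _ => ?_
  exact (contDiff_dd (m := 0) (contDiff_dd (m := 1) hz (by norm_num)) (by norm_num)).continuous

theorem continuous_rad {z : Plane → ℝ} (hz : ContDiff ℝ 2 z) : Continuous (rad z) := by
  refine continuous_finsetSum _ fun i _ => ?_
  exact Continuous.mul (by fun_prop) (contDiff_dd (m := 1) hz (by norm_num)).continuous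

theorem lap_eq_zero_of_notMem {z : Plane → ℝ} {K : Set Plane} (hK : IsClosed K)
    (h : ∀ x ∉ K, z x = 0) : ∀ x ∉ K, lap z x = 0 := fun P hP =>
  Finset.sum_eq_zero fun _ _ => dd_eq_zero_of_notMem hK (dd_eq_zero_of_notMem hK h) P hP

theorem rad_eq_zero_of_notMem {z : Plane → ℝ} {K : Set Plane} (hK : IsClosed K)
    (h : ∀ x ∉ K, z x = 0) : ∀ x ∉ K, rad z x = 0 := fun P hP =>
  Finset.sum_eq_zero fun _ _ => by rw [dd_eq_zero_of_notMem hK h P hP, mul_zero]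

theorem lap_rad_eq_zero_of_eventuallyEq {z : Plane → ℝ} {c : ℝ} {x : Plane}
    (h : z =ᶠ[𝓝 x] fun _ => c) : lap z x = 0 ∧ rad z x = 0 := by
  have h1 : ∀ v : Plane, dd v z =ᶠ[𝓝 x] fun _ => 0 := fun v => by
    filter_upwards [dd_eventuallyEq (v := v) h] with y hy
    rw [hy, dd_const]
  constructor
  · exact Finset.sum_eq_zero fun i _ => by
      change dd _ (dd _ z) x = 0
      rw [dd_congr (h1 _), dd_const]
  · exact Finset.sum_eq_zero fun i _ => by rw [(h1 _).self_of_nhds, mul_zero]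

theorem exists_bound_of_compactSupport {E : Type*} [TopologicalSpace E] {F : E → ℝ} {K : Set E}
    (hK : IsCompact K) (hF : Continuous F) (h : ∀ x ∉ K, F x = 0) : ∃ C, 0 ≤ C ∧ ∀ x, |F x| ≤ C := by
  obtain ⟨C, hC⟩ := hK.exists_bound_of_continuousOn hF.continuousOn
  refine ⟨max C 0, le_max_right _ _, fun x => ?_⟩
  by_cases hx : x ∈ K
  · exact (hC x hx).trans (le_max_left _ _)
  · rw [h x hx, abs_zero]; exact le_max_right _ _

theorem exists_plane_bump : ∃ (z : Plane → ℝ) (C : ℝ), ContDiff ℝ 2 z ∧ 0 ≤ C ∧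
    (∀ x, 0 ≤ z x ∧ z x ≤ 1) ∧ z 0 = 1 ∧ (∀ x ∉ Metric.closedBall (0 : Plane) (1 / 2), z x = 0) ∧
    (∀ x, |lap z x| ≤ C) ∧ (∀ x, |rad z x| ≤ C) ∧ (∀ x, |rad z x| ≤ C * ‖x‖ ^ 2) ∧
    (∀ x, ‖x‖ < 1 / 4 → lap z x = 0 ∧ rad z x = 0) := by
  let b : ContDiffBump (0 : Plane) := ⟨1 / 4, 1 / 2, by norm_num, by norm_num⟩
  have hb : ContDiff ℝ 2 b := b.contDiff
  have h0 : ∀ x ∉ Metric.closedBall (0 : Plane) (1 / 2), b x = 0 := fun x hx =>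
    b.zero_of_le_dist (le_of_lt (not_le.1 hx))
  have hnear : ∀ x : Plane, ‖x‖ < 1 / 4 → lap b x = 0 ∧ rad b x = 0 := fun x hx => by
    refine lap_rad_eq_zero_of_eventuallyEq (c := 1) ?_
    have : Metric.ball (0 : Plane) (1 / 4) ∈ 𝓝 x := Metric.isOpen_ball.mem_nhds (by simpa using hx)
    filter_upwards [this] with y hy
    exact b.one_of_mem_closedBall (Metric.ball_subset_closedBall hy)
  obtain ⟨C1, hC1, h1⟩ := exists_bound_of_compactSupport (isCompact_closedBall _ _)
    (continuous_lap hb) (lap_eq_zero_of_notMem Metric.isClosed_closedBall h0)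
  obtain ⟨C2, hC2, h2⟩ := exists_bound_of_compactSupport (isCompact_closedBall _ _)
    (continuous_rad hb) (rad_eq_zero_of_notMem Metric.isClosed_closedBall h0)
  refine ⟨b, C1 + 16 * C2, hb, by positivity, fun x => ⟨b.nonneg, b.le_one⟩,
    b.one_of_mem_closedBall (by simp [b]), h0, fun x => (h1 x).trans (by linarith),
    fun x => (h2 x).trans (by linarith), fun x => ?_, hnear⟩
  rcases lt_or_ge ‖x‖ (1 / 4) with hx | hx
  · rw [(hnear x hx).2, abs_zero]; positivity
  · refine (h2 x).trans ?_
    have : 1 / 16 ≤ ‖x‖ ^ 2 := by nlinarith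
    nlinarith

theorem exists_time_bump : ∃ (m : ℝ → ℝ) (C : ℝ), ContDiff ℝ 2 m ∧ 0 ≤ C ∧
    (∀ t, 0 ≤ m t ∧ m t ≤ 1) ∧ m 0 = 1 ∧ m (-1 / 2) = 0 ∧ (∀ t, |deriv m t| ≤ C) ∧
    (∀ t, |t| < 1 / 4 → deriv m t = 0) := by
  let b : ContDiffBump (0 : ℝ) := ⟨1 / 4, 1 / 2, by norm_num, by norm_num⟩
  have hb : ContDiff ℝ 2 b := b.contDiff
  have h0 : ∀ x ∉ Metric.closedBall (0 : ℝ) (1 / 2), b x = 0 := fun x hx =>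
    b.zero_of_le_dist (le_of_lt (not_le.1 hx))
  have hd : ∀ x ∉ Metric.closedBall (0 : ℝ) (1 / 2), deriv b x = 0 := fun x hx => by
    have : b =ᶠ[𝓝 x] fun _ => (0 : ℝ) := by
      filter_upwards [Metric.isClosed_closedBall.isOpen_compl.mem_nhds hx] with y hy using h0 y hy
    rw [this.deriv_eq, deriv_const]
  obtain ⟨C1, hC1, h1⟩ := exists_bound_of_compactSupport (isCompact_closedBall _ _)
    (hb.continuous_deriv (by norm_num)) hd
  refine ⟨b, C1, hb, hC1, fun x => ⟨b.nonneg, b.le_one⟩,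
    b.one_of_mem_closedBall (by simp [b]), b.zero_of_le_dist (by norm_num [b]), h1, fun x hx => ?_⟩
  have : Metric.ball (0 : ℝ) (1 / 4) ∈ 𝓝 x := Metric.isOpen_ball.mem_nhds (by simpa using hx)
  have h3 : b =ᶠ[𝓝 x] fun _ => (1 : ℝ) := by
    filter_upwards [this] with y hy
    exact b.one_of_mem_closedBall (Metric.ball_subset_closedBall hy)
  rw [h3.deriv_eq, deriv_const]

theorem measurable_cutErr {z : Plane → ℝ} {m : ℝ → ℝ} (hz : ContDiff ℝ 2 z) (hm : ContDiff ℝ 2 m)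
    (ε : ℝ) : Measurable fun P : Plane × ℝ => cutErr z m ε P.1 P.2 := by
  have h1 := (continuous_lap hz).measurable
  have h2 := (continuous_rad hz).measurable
  have h3 := (hm.continuous_deriv (by norm_num)).measurable
  have h4 := hz.continuous.measurable
  have h5 := hm.continuous.measurable
  unfold cutErr
  fun_prop

/-- Integrability of the integrand in the localized heat representation. -/
theorem heat_integrable {u g : Plane × ℝ → ℝ} (hu : Measurable u) (hg : Measurable g)
    {z : Plane → ℝ} {m : ℝ → ℝ} (hz : ContDiff ℝ 2 z)
    (hm : ContDiff ℝ 2 m) {K : Set Plane} (hK : IsCompact K)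
    (h0 : ∀ x ∉ K, z x = 0) {t₁ ε M : ℝ} (ht : t₁ ≤ 0) (hε : 0 < ε)
    (hM : ∀ x ∈ K, ∀ t ∈ Icc t₁ 0, |u (x, t)| ≤ M ∧ |g (x, t)| ≤ M) :
    IntervalIntegrable (fun t => ∫ x, HK x (ε - t) *
      (u (x, t) * cutErr z m ε x t + z x * m t * g (x, t))) volume t₁ 0 ∧
    ∀ t ∈ Icc t₁ 0, Integrable (fun x => HK x (ε - t) *
      (u (x, t) * cutErr z m ε x t + z x * m t * g (x, t))) := by
  have hKc := hK.isClosed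
  set F : Plane × ℝ → ℝ := fun P => HK P.1 (ε - P.2) *
      (u P * cutErr z m ε P.1 P.2 + z P.1 * m P.2 * g P) with hF
  have hFm : Measurable F := by
    have h1 := measurable_cutErr hz hm ε
    have h4 := hz.continuous.measurable
    have h5 := hm.continuous.measurable
    have h6 : Measurable fun P : Plane × ℝ => HK P.1 (ε - P.2) :=
      measurable_HK.comp (measurable_fst.prodMk (measurable_const.sub measurable_snd))
    fun_prop
  have hF0 : ∀ x ∉ K, ∀ t, F (x, t) = 0 := fun x hx t => by
    simp [hF, cutErr, h0 x hx, lap_eq_zero_of_notMem hKc h0 x hx, rad_eq_zero_of_notMem hKc h0 x hx]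
  obtain ⟨C, hC⟩ : ∃ C, ∀ x ∈ K, ∀ t ∈ Icc t₁ 0, |F (x, t)| ≤ C := by
    have hKI := hK.prod (isCompact_Icc (a := t₁) (b := 0))
    have hne : ∀ P ∈ K ×ˢ Icc t₁ 0, ε - P.2 ≠ 0 := fun P hP => by linarith [hP.2.2]
    have hne2 : ∀ P ∈ K ×ˢ Icc t₁ 0, 4 * Real.pi * (ε - P.2) ≠ 0 := fun P hP =>
      mul_ne_zero (by positivity) (hne P hP)
    have hne3 : ∀ P ∈ K ×ˢ Icc t₁ 0, 4 * (ε - P.2) ≠ 0 := fun P hP =>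
      mul_ne_zero (by positivity) (hne P hP)
    have h1 := continuous_lap hz
    have h2 := continuous_rad hz
    have h3 := hm.continuous_deriv (by norm_num)
    have h4 := hz.continuous
    have h5 := hm.continuous
    have c1 : ContinuousOn (fun P : Plane × ℝ => HK P.1 (ε - P.2)) (K ×ˢ Icc t₁ 0) := by
      unfold HK
      refine ContinuousOn.mul (ContinuousOn.inv₀ (by fun_prop) hne2) ?_
      refine ContinuousOn.rexp (ContinuousOn.neg (ContinuousOn.div (by fun_prop) (by fun_prop) hne3))
    have c2 : ContinuousOn (fun P : Plane × ℝ => cutErr z m ε P.1 P.2) (K ×ˢ Icc t₁ 0) := by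
      unfold cutErr
      refine ContinuousOn.sub (by fun_prop) (ContinuousOn.div (by fun_prop) (by fun_prop) hne)
    have c3 : ContinuousOn (fun P : Plane × ℝ => z P.1 * m P.2) (K ×ˢ Icc t₁ 0) := by fun_prop
    obtain ⟨C1, b1⟩ := hKI.exists_bound_of_continuousOn c1
    obtain ⟨C2, b2⟩ := hKI.exists_bound_of_continuousOn c2
    obtain ⟨C3, b3⟩ := hKI.exists_bound_of_continuousOn c3
    refine ⟨C1 * (M * C2 + C3 * M), fun x hx t ht' => ?_⟩
    have hP : (x, t) ∈ K ×ˢ Icc t₁ 0 := ⟨hx, ht'⟩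
    have a1 := b1 _ hP
    have a2 := b2 _ hP
    have a3 := b3 _ hP
    obtain ⟨a4, a5⟩ := hM x hx t ht'
    rw [Real.norm_eq_abs] at a1 a2 a3
    have hM0 := (abs_nonneg _).trans a4
    simp only [hF, abs_mul]
    have := abs_nonneg (HK x (ε - t))
    gcongr
    · linarith
    refine (abs_add_le _ _).trans ?_
    rw [abs_mul, abs_mul (z x * m t)]
    gcongr
    exact (abs_nonneg _).trans a3
  constructor
  · refine intervalIntegrable_slice hFm hK hF0 fun x hx t ht' => hC x hx t ?_
    rwa [uIcc_of_le ht] at ht'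
  · exact fun t ht' => integrable_slice hFm hK (fun x hx => hF0 x hx t) fun x hx => hC x hx t ht'

theorem SW.tendsto_heat {u g B I} (h : SW u g B I) (hu : Measurable u) {z : Plane → ℝ} {m : ℝ → ℝ}
    (hz : ContDiff ℝ 2 z) (hm : ContDiff ℝ 2 m) {K : Set Plane} (hK : IsCompact K) (hKB : K ⊆ B)
    (h0 : ∀ x ∉ K, z x = 0) {t₁ M : ℝ} (h₁ : t₁ ∈ I) (h₂ : (0 : ℝ) ∈ I) (ht : t₁ < 0)
    (hM : ∀ x ∈ K, ∀ t ∈ Icc t₁ 0, |u (x, t)| ≤ M)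
    (hc : ContinuousAt (fun x => u (x, 0)) 0) :
    Tendsto (fun ε => ∫ t in t₁..0, ∫ x, HK x (ε - t) *
      (u (x, t) * cutErr z m ε x t + z x * m t * g (x, t))) (𝓝[>] 0)
      (𝓝 (m 0 * (z 0 * u (0, 0)) - m t₁ * ∫ x, HK x (-t₁) * (z x * u (x, t₁)))) := by
  have hzm := hz.continuous.measurable
  obtain ⟨C, hC0, hC⟩ := exists_bound_of_compactSupport hK hz.continuous h0
  have hb : ∀ t ∈ Icc t₁ 0, ∀ x, |z x * u (x, t)| ≤ C * max M 0 := fun t ht' x => by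
    by_cases hx : x ∈ K
    · rw [abs_mul]
      gcongr
      · exact hC x
      · exact (hM x hx t ht').trans (le_max_left _ _)
    · simp [h0 x hx]; positivity
  have hi : Integrable fun x => z x * u (x, t₁) :=
    integrable_slice (F := fun P => z P.1 * u P) (by fun_prop) hK (fun x hx => by simp [h0 x hx])
      (fun x _ => hb t₁ ⟨le_rfl, ht.le⟩ x)
  have l1 := (tendsto_integral_HK_mul (h := fun x => z x * u (x, 0)) (by fun_prop)
    (hb 0 ⟨ht.le, le_rfl⟩) (hz.continuous.continuousAt.mul hc)).const_mul (m 0)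
  have l2 := (tendsto_integral_HK_add hi (neg_pos.2 ht)).const_mul (m t₁)
  refine (l1.sub l2).congr' ?_
  filter_upwards [self_mem_nhdsWithin] with ε (hε : 0 < ε)
  rw [← h.heat_repr hz hm hK hKB h0 h₁ h₂ ht.le hε]
  simp only [sub_zero, ← sub_eq_add_neg]

theorem integrableOn_slice {u : Plane × ℝ → ℝ} (hu : Measurable u) {K : Set Plane}
    (hK : IsCompact K) {t M : ℝ} (hM : ∀ x ∈ K, |u (x, t)| ≤ M) :
    IntegrableOn (fun x => u (x, t)) K :=
  Measure.integrableOn_of_bounded (M := M) hK.measure_lt_top.ne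
    (hu.comp measurable_prodMk_right).aestronglyMeasurable
    ((ae_restrict_mem hK.measurableSet).mono fun x hx => hM x hx)

theorem intervalIntegrable_setIntegral {u : Plane × ℝ → ℝ} (hu : Measurable u) {K : Set Plane}
    (hK : IsCompact K) {a b M : ℝ} (hM : ∀ x ∈ K, ∀ t ∈ uIcc a b, |u (x, t)| ≤ M) :
    IntervalIntegrable (fun t => ∫ x in K, u (x, t)) volume a b := by
  have := intervalIntegrable_slice (F := (K ×ˢ univ).indicator u)
    (hu.indicator (hK.measurableSet.prod MeasurableSet.univ)) hK (a := a) (b := b) (C := M)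
    (fun x hx t => indicator_of_notMem (fun h => hx h.1) _)
    (fun x hx t ht => by
      rw [indicator_of_mem (show (x, t) ∈ K ×ˢ univ from ⟨hx, trivial⟩)]; exact hM x hx t ht)
  refine this.congr (fun t _ => ?_)
  rw [← integral_indicator hK.measurableSet]
  refine integral_congr_ae (Eventually.of_forall fun x => ?_)
  simp [indicator]

/-- Local maximum principle at unit scale. -/
theorem exists_mean_value_bound {lam : ℝ} (hlam : 0 ≤ lam) : ∃ C, 0 < C ∧
    ∀ (u g : Plane × ℝ → ℝ) (C₀ M : ℝ), 0 ≤ C₀ → Measurable u → Measurable g →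
    SW u g (Metric.closedBall 0 (1 / 2)) (Icc (-1 / 2) 0) →
    (∀ x ∈ Metric.closedBall (0 : Plane) (1 / 2), ∀ t ∈ Icc (-1 / 2 : ℝ) 0,
      0 ≤ u (x, t) ∧ |u (x, t)| ≤ M ∧ |g (x, t)| ≤ M ∧ g (x, t) ≤ C₀ + lam * u (x, t)) →
    ContinuousAt (fun x => u (x, 0)) 0 →
    u (0, 0) ≤ C * (C₀ + ∫ t in (-1 / 2 : ℝ)..0, ∫ x in Metric.closedBall (0 : Plane) (1 / 2), u (x, t)) := by
  obtain ⟨z, Cz, hz, hCz, hz01, hz0, hzK, hlap, hrad, -, hnear⟩ := exists_plane_bump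
  obtain ⟨φ, Cφ, hφ, hCφ, hφ01, hφ0, hφe, hdφ, hφn⟩ := exists_time_bump
  set E := Real.exp (lam / 2) with hE
  have hEpos : 0 < E := Real.exp_pos _
  set A := E * (8192 * (2 * Cz + Cφ)) with hA
  have hApos : 0 ≤ A := by positivity
  refine ⟨A + E, by positivity, fun u g C₀ M hC₀ hu hg h hb hc => ?_⟩
  set K := Metric.closedBall (0 : Plane) (1 / 2) with hKdef
  have hK : IsCompact K := isCompact_closedBall _ _
  set m : ℝ → ℝ := fun t => Real.exp (-lam * t) * φ t with hm_def
  have hm : ContDiff ℝ 2 m := by fun_prop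
  have hdm : ∀ t, deriv m t = Real.exp (-lam * t) * (deriv φ t - lam * φ t) := fun t => by
    have h1 : HasDerivAt (fun t : ℝ => Real.exp (-lam * t)) (Real.exp (-lam * t) * (-lam * 1)) t :=
      ((hasDerivAt_id t).const_mul (-lam)).exp
    have h2 : HasDerivAt m _ t := h1.mul (hφ.differentiable (by simp) t).hasDerivAt
    rw [h2.deriv]
    ring
  have hlim := h.tendsto_heat hu hz hm hK le_rfl hzK (t₁ := -1 / 2) (M := M) (by norm_num)
    (by norm_num) (by norm_num) (fun x hx t ht => (hb x hx t ht).2.1) hc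
  have hm0 : m 0 = 1 := by simp [hm_def, hφ0]
  have hm1 : m (-1 / 2) = 0 := by simp [hm_def, hφe]
  rw [hm0, hm1, hz0, zero_mul, sub_zero, one_mul, one_mul] at hlim
  refine le_of_tendsto hlim ?_
  filter_upwards [self_mem_nhdsWithin] with ε (hε : 0 < ε)
  obtain ⟨i1, i2⟩ := heat_integrable hu hg hz hm hK hzK (t₁ := -1 / 2) (by norm_num) hε
    (fun x hx t ht => ⟨(hb x hx t ht).2.1, (hb x hx t ht).2.2.1⟩)
  have hpt : ∀ t ∈ Icc (-1 / 2 : ℝ) 0, ∀ x, HK x (ε - t) *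
      (u (x, t) * cutErr z m ε x t + z x * m t * g (x, t)) ≤
      K.indicator (fun x => A * u (x, t)) x + HK x (ε - t) * (E * C₀) := by
    intro t ht x
    have hτ : 0 < ε - t := by linarith [ht.2]
    have hHK := HK_nonneg x hτ
    by_cases hx : x ∈ K
    swap
    · have hKc := hK.isClosed
      rw [indicator_of_notMem hx]
      simp only [cutErr, hzK x hx, lap_eq_zero_of_notMem hKc hzK x hx,
        rad_eq_zero_of_notMem hKc hzK x hx]
      simp
      positivity
    rw [indicator_of_mem hx]
    obtain ⟨hu0, -, -, hgu⟩ := hb x hx t ht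
    have he : Real.exp (-lam * t) ≤ E := Real.exp_le_exp.2 (by nlinarith [ht.1])
    have he0 := Real.exp_pos (-lam * t)
    have hmE : m t ≤ E := (mul_le_of_le_one_right he0.le (hφ01 t).2).trans he
    have hm0 : 0 ≤ m t := mul_nonneg he0.le (hφ01 t).1
    have hzm : z x * m t ≤ E := (mul_le_of_le_one_left hm0 (hz01 x).2).trans hmE
    have hzm0 : 0 ≤ z x * m t := mul_nonneg (hz01 x).1 hm0
    have hX : HK x (ε - t) * (cutErr z m ε x t + lam * (z x * m t)) ≤ A := by
      have e : cutErr z m ε x t + lam * (z x * m t) = Real.exp (-lam * t) *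
          (φ t * lap z x + deriv φ t * z x - φ t * rad z x / (ε - t)) := by
        rw [cutErr, hdm]; simp only [hm_def]; ring
      rw [e]
      by_cases hoff : 1 / 4 ≤ ‖x‖ ∨ 1 / 4 ≤ ε - t
      · obtain ⟨k1, k2⟩ := HK_le_off (y := x) hτ hoff
        have b1 : φ t * lap z x ≤ Cz := by
          have := (abs_le.1 (hlap x)).2
          nlinarith [hφ01 t]
        have b2 : deriv φ t * z x ≤ Cφ := by
          have := (abs_le.1 (hdφ t)).2
          nlinarith [hz01 x]
        have b3 : -(φ t * rad z x) ≤ Cz := by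
          have := (abs_le.1 (hrad x)).1
          nlinarith [hφ01 t]
        calc HK x (ε - t) * (Real.exp (-lam * t) *
              (φ t * lap z x + deriv φ t * z x - φ t * rad z x / (ε - t)))
            = Real.exp (-lam * t) * (HK x (ε - t) * (φ t * lap z x + deriv φ t * z x) +
                HK x (ε - t) / (ε - t) * -(φ t * rad z x)) := by ring
          _ ≤ Real.exp (-lam * t) * (HK x (ε - t) * (Cz + Cφ) + HK x (ε - t) / (ε - t) * Cz) := by
              gcongr
          _ ≤ E * (8192 * (Cz + Cφ) + 8192 * Cz) := by gcongr
          _ = A := by rw [hA]; ring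
      · push Not at hoff
        obtain ⟨n1, n2⟩ := hnear x hoff.1
        rw [n1, n2, hφn t (by rw [abs_of_nonpos ht.2]; linarith)]
        simpa using hApos
    calc HK x (ε - t) * (u (x, t) * cutErr z m ε x t + z x * m t * g (x, t))
        ≤ HK x (ε - t) * (u (x, t) * cutErr z m ε x t + z x * m t * (C₀ + lam * u (x, t))) := by
          gcongr
      _ = HK x (ε - t) * (cutErr z m ε x t + lam * (z x * m t)) * u (x, t) +
          HK x (ε - t) * (z x * m t * C₀) := by ring
      _ ≤ A * u (x, t) + HK x (ε - t) * (E * C₀) := by gcongr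
  have hsl : ∀ t ∈ Icc (-1 / 2 : ℝ) 0, ∫ x, HK x (ε - t) *
      (u (x, t) * cutErr z m ε x t + z x * m t * g (x, t)) ≤ A * (∫ x in K, u (x, t)) + E * C₀ := by
    intro t ht
    have hτ : 0 < ε - t := by linarith [ht.2]
    have j1 : Integrable (K.indicator fun x => A * u (x, t)) :=
      IntegrableOn.integrable_indicator
        ((integrableOn_slice hu hK (M := M) fun x hx => (hb x hx t ht).2.1).const_mul A)
        hK.measurableSet
    have j2 := (integrable_HK hτ).mul_const (E * C₀)
    refine (integral_mono (i2 t ht) (j1.add j2) (hpt t ht)).trans_eq ?_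
    simp only [Pi.add_apply]
    rw [integral_add j1 j2, integral_indicator hK.measurableSet, integral_const_mul,
      integral_mul_const, integral_HK hτ, one_mul]
  have j3 : IntervalIntegrable (fun t => A * ∫ x in K, u (x, t)) volume (-1 / 2) 0 :=
    (intervalIntegrable_setIntegral hu hK (M := M) fun x hx t ht =>
      (hb x hx t (by rwa [uIcc_of_le (by norm_num)] at ht)).2.1).const_mul A
  have key := intervalIntegral.integral_mono_on (by norm_num) i1
    (j3.add (intervalIntegrable_const (c := E * C₀))) hsl
  refine key.trans ?_
  rw [intervalIntegral.integral_add j3 intervalIntegrable_const, intervalIntegral.integral_const_mul,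
    intervalIntegral.integral_const]
  have hI : 0 ≤ ∫ t in (-1 / 2 : ℝ)..0, ∫ x in K, u (x, t) := by
    refine intervalIntegral.integral_nonneg (by norm_num) fun t ht => ?_
    exact setIntegral_nonneg hK.measurableSet fun x hx => (hb x hx t ht).1
  rw [smul_eq_mul]
  have : 0 ≤ E * C₀ := by positivity
  nlinarith [mul_nonneg hApos hC₀, mul_nonneg hEpos.le hI]

theorem hasDerivAt_expNegInvGlue (w : ℝ) :
    HasDerivAt expNegInvGlue (w⁻¹ ^ 2 * expNegInvGlue w) w := by
  have := expNegInvGlue.hasDerivAt_polynomial_eval_inv_mul 1 w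
  simpa using this

theorem hasDerivAt_expNegInvGlue_two (w : ℝ) :
    HasDerivAt (fun w => w⁻¹ ^ 2 * expNegInvGlue w)
      ((w⁻¹ ^ 4 - 2 * w⁻¹ ^ 3) * expNegInvGlue w) w := by
  have := expNegInvGlue.hasDerivAt_polynomial_eval_inv_mul (Polynomial.X ^ 2) w
  refine (this.congr_deriv ?_).congr_of_eventuallyEq (Eventually.of_forall fun x => by simp)
  simp
  ring_nf
  simp

theorem lap_rad_comp_norm_sq {θ θ' θ'' : ℝ → ℝ} (h1 : ∀ q, HasDerivAt θ (θ' q) q)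
    (h2 : ∀ q, HasDerivAt θ' (θ'' q) q) (x : Plane) :
    lap (fun x => θ (‖x‖ ^ 2)) x = 4 * θ'' (‖x‖ ^ 2) * ‖x‖ ^ 2 + 4 * θ' (‖x‖ ^ 2) ∧
    rad (fun x => θ (‖x‖ ^ 2)) x = 2 * θ' (‖x‖ ^ 2) * ‖x‖ ^ 2 := by
  have hn : ∀ x : Plane, DifferentiableAt ℝ (fun x : Plane => ‖x‖ ^ 2) x := fun x =>
    (contDiff_norm_sq ℝ (n := 1)).contDiffAt.differentiableAt (by simp)
  have e0 : ∀ (i : Fin 2) (x : Plane),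
      dd (EuclideanSpace.single i 1) (fun x : Plane => ‖x‖ ^ 2) x = 2 * x i := by
    intro i x
    refine dd_eq_of_line (hn x) ?_
    have e : (fun s : ℝ => ‖x + s • EuclideanSpace.single i (1 : ℝ)‖ ^ 2) =
        fun s => ‖x‖ ^ 2 + 2 * (s * x i) + s ^ 2 := by
      funext s
      rw [norm_add_sq_real, norm_smul, inner_smul_right, EuclideanSpace.inner_single_right]
      simp
    rw [e]
    have h2 := (((hasDerivAt_id (0 : ℝ)).mul_const (x i)).const_mul 2).const_add (‖x‖ ^ 2)
    refine (h2.add ((hasDerivAt_id (0 : ℝ)).pow 2)).congr_deriv ?_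
    simp
  have e1 : ∀ i : Fin 2, dd (EuclideanSpace.single i 1) (fun x : Plane => θ (‖x‖ ^ 2)) =
      fun x => θ' (‖x‖ ^ 2) * (2 * x i) := fun i => by
    funext y
    rw [dd_comp (h1 _) (hn y), e0]
  have e2 : ∀ i : Fin 2, dd (EuclideanSpace.single i 1) (fun x : Plane => 2 * x i) x = 2 := fun i => by
    refine dd_eq_of_line (by fun_prop) ?_
    simpa using ((hasDerivAt_id (0 : ℝ)).const_add (x i)).const_mul 2
  have hθ : DifferentiableAt ℝ (fun x : Plane => θ' (‖x‖ ^ 2)) x :=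
    (h2 _).differentiableAt.comp x (hn x)
  have hx2 : ‖x‖ ^ 2 = x 0 ^ 2 + x 1 ^ 2 := by
    simp [EuclideanSpace.norm_sq_eq]
  constructor
  · change ∑ i, dd _ (dd _ _) x = _
    simp only [e1]
    have : ∀ i : Fin 2, dd (EuclideanSpace.single i 1) (fun x : Plane => θ' (‖x‖ ^ 2) * (2 * x i)) x =
        θ' (‖x‖ ^ 2) * 2 + θ'' (‖x‖ ^ 2) * (2 * x i) * (2 * x i) := fun i => by
      rw [dd_mul hθ (by fun_prop), e2, dd_comp (h2 _) (hn x), e0]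
    simp only [this, Fin.sum_univ_two]
    rw [hx2]
    ring
  · simp only [rad, e1, Fin.sum_univ_two]
    rw [hx2]
    ring

theorem exists_subharmonic_cutoff : ∃ (z : Plane → ℝ) (c : ℝ), ContDiff ℝ 2 z ∧ 0 < c ∧
    (∀ x, 0 ≤ z x ∧ z x ≤ 1) ∧ z 0 = 1 ∧ (∀ x ∉ Metric.closedBall (0 : Plane) 8, z x = 0) ∧
    (∀ x, rad z x ≤ 0) ∧ (∀ x, 0 ≤ lap z x + z x) ∧ (∀ x, ‖x‖ ≤ 6 → c ≤ z x) := by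
  set κ := (expNegInvGlue 1)⁻¹ with hκ
  have h1pos : 0 < expNegInvGlue 1 := expNegInvGlue.pos_of_pos one_pos
  have hκp : 0 < κ := inv_pos.2 h1pos
  set θ : ℝ → ℝ := fun q => κ * expNegInvGlue (1 - q / 64) with hθ
  have hw : ∀ q : ℝ, HasDerivAt (fun q : ℝ => 1 - q / 64) (-(1 / 64)) q := fun q =>
    ((hasDerivAt_id q).div_const 64).const_sub 1
  have d1 : ∀ q, HasDerivAt θ (-(κ / 64) * ((1 - q / 64)⁻¹ ^ 2 * expNegInvGlue (1 - q / 64))) q :=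
    fun q => (((hasDerivAt_expNegInvGlue _).comp q (hw q)).const_mul κ).congr_deriv (by ring)
  have d2 : ∀ q, HasDerivAt (fun q => -(κ / 64) * ((1 - q / 64)⁻¹ ^ 2 * expNegInvGlue (1 - q / 64)))
      (κ / 64 ^ 2 * (((1 - q / 64)⁻¹ ^ 4 - 2 * (1 - q / 64)⁻¹ ^ 3) * expNegInvGlue (1 - q / 64))) q :=
    fun q => (((hasDerivAt_expNegInvGlue_two _).comp q (hw q)).const_mul (-(κ / 64))).congr_deriv
      (by ring)
  have hmono : Monotone expNegInvGlue := by
    refine monotone_of_deriv_nonneg (fun w => (hasDerivAt_expNegInvGlue w).differentiableAt) fun w => ?_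
    rw [(hasDerivAt_expNegInvGlue w).deriv]
    have := expNegInvGlue.nonneg w
    positivity
  refine ⟨fun x => θ (‖x‖ ^ 2), κ * expNegInvGlue (28 / 64), ?_, ?_, fun x => ⟨?_, ?_⟩, ?_,
    fun x hx => ?_, fun x => ?_, fun x => ?_, fun x hx => ?_⟩
  · have : ContDiff ℝ 2 expNegInvGlue := expNegInvGlue.contDiff
    have h2 : ContDiff ℝ 2 (fun x : Plane => ‖x‖ ^ 2) := contDiff_norm_sq ℝ
    simp only [hθ]
    exact contDiff_const.mul (this.comp (contDiff_const.sub (h2.div_const 64)))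
  · have := expNegInvGlue.pos_of_pos (x := 28 / 64) (by norm_num)
    positivity
  · have := expNegInvGlue.nonneg (1 - ‖x‖ ^ 2 / 64)
    simp only [hθ]
    positivity
  · have := hmono (show 1 - ‖x‖ ^ 2 / 64 ≤ 1 by linarith [sq_nonneg ‖x‖])
    simp only [hθ, hκ]
    rw [inv_mul_le_iff₀ h1pos, mul_one]
    exact this
  · simp [hθ, hκ, h1pos.ne']
  · simp only [hθ]
    rw [expNegInvGlue.zero_of_nonpos, mul_zero]
    have : 8 < ‖x‖ := by simpa using hx
    nlinarith
  · rw [(lap_rad_comp_norm_sq d1 d2 x).2]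
    have := expNegInvGlue.nonneg (1 - ‖x‖ ^ 2 / 64)
    have h3 : 0 ≤ κ / 64 * ((1 - ‖x‖ ^ 2 / 64)⁻¹ ^ 2 * expNegInvGlue (1 - ‖x‖ ^ 2 / 64)) := by positivity
    nlinarith [mul_nonneg h3 (sq_nonneg ‖x‖)]
  · rw [(lap_rad_comp_norm_sq d1 d2 x).1]
    simp only [hθ]
    set w := 1 - ‖x‖ ^ 2 / 64 with hwdef
    have hq : ‖x‖ ^ 2 = 64 * (1 - w) := by rw [hwdef]; ring
    rw [hq]
    rcases le_or_gt w 0 with h | h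
    · rw [expNegInvGlue.zero_of_nonpos h]; simp
    · have hpos := expNegInvGlue.pos_of_pos h
      have e : 4 * (κ / 64 ^ 2 * ((w⁻¹ ^ 4 - 2 * w⁻¹ ^ 3) * expNegInvGlue w)) * (64 * (1 - w)) +
          4 * (-(κ / 64) * (w⁻¹ ^ 2 * expNegInvGlue w)) + κ * expNegInvGlue w =
          κ * expNegInvGlue w * (w⁻¹ ^ 4 / 16) * (1 - 3 * w + w ^ 2 + 16 * w ^ 4) := by
        field_simp
        ring
      rw [e]
      have : 0 ≤ 1 - 3 * w + w ^ 2 + 16 * w ^ 4 := by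
        nlinarith [sq_nonneg (w ^ 2 * 4 - 1 / 2), sq_nonneg (w - 3 / 10), sq_nonneg (w - 2 / 5)]
      positivity
  · simp only [hθ]
    have := hmono (show 28 / 64 ≤ 1 - ‖x‖ ^ 2 / 64 by nlinarith [norm_nonneg x])
    gcongr

theorem HK_ge_of_le {y : Plane} {τ T : ℝ} (hτ : 1 / 8 ≤ τ) (hτ' : τ ≤ T) (hy : ‖y‖ ≤ 6) :
    (4 * Real.pi * T)⁻¹ * Real.exp (-72) ≤ HK y τ := by
  unfold HK
  have hp := Real.pi_pos
  have : 0 < τ := by linarith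
  have : 0 < T := by linarith
  gcongr ?_ * Real.exp ?_
  · gcongr
  · rw [neg_le_neg_iff, div_le_iff₀ (by positivity)]
    nlinarith [norm_nonneg y]

/-- Lower bound (weak Harnack estimate) at unit scale. -/
theorem exists_mass_bound {N : ℝ} (hN : 1 ≤ N) : ∃ C, 0 < C ∧
    ∀ (u g : Plane × ℝ → ℝ) (C₀ M : ℝ), 0 ≤ C₀ → Measurable u → Measurable g →
    SW u g (Metric.closedBall 0 8) (Icc (-N) 0) →
    (∀ x ∈ Metric.closedBall (0 : Plane) 8, ∀ t ∈ Icc (-N) 0,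
      0 ≤ u (x, t) ∧ |u (x, t)| ≤ M ∧ |g (x, t)| ≤ M ∧ -C₀ ≤ g (x, t)) →
    ContinuousAt (fun x => u (x, 0)) 0 →
    ∫ t in (-N)..(-1 / 8), ∫ x in Metric.closedBall (0 : Plane) 6, u (x, t) ≤
      C * (u (0, 0) + C₀) := by
  obtain ⟨z, c, hz, hcp, hz01, hz0, hzK, hrad, hlap, hz6⟩ := exists_subharmonic_cutoff
  set k := (4 * Real.pi * (N + 1))⁻¹ * Real.exp (-72) with hk
  have hNp : 0 < N := by linarith
  have hkp : 0 < k := by have := Real.pi_pos; positivity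
  set A := k * (Real.exp (-N) / N * c) with hA
  have hApos : 0 < A := by positivity
  refine ⟨N / A, by positivity, fun u g C₀ M hC₀ hu hg h hb hc => ?_⟩
  rw [div_mul_eq_mul_div, le_div_iff₀ hApos, mul_comm]
  set K := Metric.closedBall (0 : Plane) 8 with hKdef
  have hK : IsCompact K := isCompact_closedBall _ _
  set B := Metric.closedBall (0 : Plane) 6 with hBdef
  have hB : IsCompact B := isCompact_closedBall _ _
  have hBK : B ⊆ K := Metric.closedBall_subset_closedBall (by norm_num)
  set m : ℝ → ℝ := fun t => Real.exp t * (1 + t / N) with hm_def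
  have hm : ContDiff ℝ 2 m := by fun_prop
  have hdm : ∀ t, deriv m t = m t + Real.exp t / N := fun t => by
    have h2 : HasDerivAt m _ t := (Real.hasDerivAt_exp t).mul (((hasDerivAt_id t).div_const N).const_add 1)
    rw [h2.deriv]
    simp [hm_def]
    ring
  have hlim := h.tendsto_heat hu hz hm hK le_rfl hzK (t₁ := -N) (M := M) ⟨le_rfl, by linarith⟩
    ⟨by linarith, le_rfl⟩ (by linarith) (fun x hx t ht => (hb x hx t ht).2.1) hc
  have hm0 : m 0 = 1 := by simp [hm_def]
  have hm1 : m (-N) = 0 := by simp [hm_def, hNp.ne']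
  rw [hm0, hm1, hz0, zero_mul, sub_zero, one_mul, one_mul] at hlim
  have hu00 := (hb 0 (by simp [hKdef]) 0 ⟨by linarith, le_rfl⟩).1
  suffices A * (∫ t in (-N)..(-1 / 8), ∫ x in B, u (x, t)) - N * C₀ ≤ u (0, 0) by nlinarith
  refine ge_of_tendsto hlim ?_
  filter_upwards [Ioo_mem_nhdsGT (one_pos)] with ε hε'
  have hε := hε'.1
  obtain ⟨i1, i2⟩ := heat_integrable hu hg hz hm hK hzK (t₁ := -N) (by linarith) hε
    (fun x hx t ht => ⟨(hb x hx t ht).2.1, (hb x hx t ht).2.2.1⟩)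
  have hpt : ∀ t ∈ Icc (-N) 0, ∀ x, HK x (ε - t) * (Real.exp (-N) / N * (z x * u (x, t))) -
      HK x (ε - t) * C₀ ≤ HK x (ε - t) *
      (u (x, t) * cutErr z m ε x t + z x * m t * g (x, t)) := by
    intro t ht x
    have hτ : 0 < ε - t := by linarith [ht.2]
    have hHK := HK_nonneg x hτ
    rw [← mul_sub]
    by_cases hx : x ∈ K
    swap
    · have hKc := hK.isClosed
      simp only [cutErr, hzK x hx, lap_eq_zero_of_notMem hKc hzK x hx,
        rad_eq_zero_of_notMem hKc hzK x hx]
      simp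
      positivity
    obtain ⟨hu0, -, -, hgu⟩ := hb x hx t ht
    have ht1 : 0 ≤ 1 + t / N := by
      have : -1 ≤ t / N := by rw [le_div_iff₀ hNp]; linarith [ht.1]
      linarith
    have ht2 : t / N ≤ 0 := div_nonpos_of_nonpos_of_nonneg ht.2 hNp.le
    have hm0 : 0 ≤ m t := mul_nonneg (Real.exp_pos t).le ht1
    have hm1 : m t ≤ 1 := by
      have : Real.exp t ≤ 1 := Real.exp_le_one_iff.2 ht.2
      simp only [hm_def]
      nlinarith [ht2, Real.exp_pos t]
    have he : Real.exp (-N) / N ≤ Real.exp t / N := by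
      gcongr; exact ht.1
    have hzm0 : 0 ≤ z x * m t := mul_nonneg (hz01 x).1 hm0
    have hzm1 : z x * m t ≤ 1 := mul_le_one₀ (hz01 x).2 hm0 hm1
    have hX : Real.exp (-N) / N * z x ≤ cutErr z m ε x t := by
      rw [cutErr, hdm]
      have a1 : 0 ≤ -(m t * rad z x / (ε - t)) := by
        rw [← neg_div, ← mul_neg]
        exact div_nonneg (mul_nonneg hm0 (by linarith [hrad x])) hτ.le
      have a2 := mul_nonneg hm0 (hlap x)
      have a3 := mul_le_mul_of_nonneg_right he (hz01 x).1
      linarith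
    refine mul_le_mul_of_nonneg_left ?_ hHK
    have b1 := mul_le_mul_of_nonneg_left hX hu0
    have b2 := mul_le_mul_of_nonneg_left hgu hzm0
    nlinarith
  have hnn : ∀ t ∈ Icc (-N) 0, ∀ x, 0 ≤ z x * u (x, t) := fun t ht x => by
    by_cases hx : x ∈ K
    · exact mul_nonneg (hz01 x).1 (hb x hx t ht).1
    · rw [hzK x hx, zero_mul]
  have s1 : ∀ t ∈ Icc (-N) 0, -C₀ ≤ ∫ x, HK x (ε - t) *
      (u (x, t) * cutErr z m ε x t + z x * m t * g (x, t)) := by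
    intro t ht
    have hτ : 0 < ε - t := by linarith [ht.2]
    have := integral_mono ((integrable_HK hτ).mul_const (-C₀)) (i2 t ht) fun x => by
      refine le_trans ?_ (hpt t ht x)
      have := mul_nonneg (HK_nonneg x hτ) (mul_nonneg (div_pos (Real.exp_pos (-N)) hNp).le (hnn t ht x))
      simp only
      linarith
    rwa [integral_mul_const, integral_HK hτ, one_mul] at this
  have s2 : ∀ t ∈ Icc (-N) (-1 / 8), A * (∫ x in B, u (x, t)) + -C₀ ≤ ∫ x, HK x (ε - t) *
      (u (x, t) * cutErr z m ε x t + z x * m t * g (x, t)) := by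
    intro t ht
    have ht0 : t ∈ Icc (-N) 0 := ⟨ht.1, by linarith [ht.2]⟩
    have hτ : 0 < ε - t := by linarith [ht0.2]
    have j1 : Integrable (B.indicator fun x => A * u (x, t)) :=
      IntegrableOn.integrable_indicator
        ((integrableOn_slice hu hB (M := M) fun x hx => (hb x (hBK hx) t ht0).2.1).const_mul A)
        hB.measurableSet
    have j2 := (integrable_HK hτ).mul_const (-C₀)
    refine le_trans (le_of_eq ?_) (integral_mono (j1.add j2) (i2 t ht0) fun x => ?_)
    · simp only [Pi.add_apply]
      rw [integral_add j1 j2, integral_indicator hB.measurableSet, integral_const_mul,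
        integral_mul_const, integral_HK hτ, one_mul]
    · refine le_trans ?_ (hpt t ht0 x)
      simp only [Pi.add_apply]
      rw [mul_neg, ← sub_eq_add_neg]
      gcongr
      by_cases hx : x ∈ B
      · rw [indicator_of_mem hx]
        have hx6 : ‖x‖ ≤ 6 := by simpa [hBdef] using hx
        have k1 := HK_ge_of_le (y := x) (τ := ε - t) (T := N + 1) (by linarith [ht.2]) (by linarith [ht.1, hε'.2]) hx6
        have k2 := hz6 x hx6
        have k3 := (hb x (hBK hx) t ht0).1
        have k4 := HK_nonneg x hτ
        calc A * u (x, t) = k * (Real.exp (-N) / N * (c * u (x, t))) := by rw [hA]; ring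
          _ ≤ _ := by gcongr
      · rw [indicator_of_notMem hx]
        exact mul_nonneg (HK_nonneg x hτ) (mul_nonneg (div_pos (Real.exp_pos (-N)) hNp).le (hnn t ht0 x))
  have j3 : IntervalIntegrable (fun t => A * ∫ x in B, u (x, t)) volume (-N) (-1 / 8) :=
    (intervalIntegrable_setIntegral hu hB (M := M) fun x hx t ht => by
      rw [uIcc_of_le (by linarith)] at ht
      exact (hb x (hBK hx) t ⟨ht.1, by linarith [ht.2]⟩).2.1).const_mul A
  have i1a := i1.mono_set (c := -N) (d := -1 / 8) (by
    rw [uIcc_of_le (by linarith), uIcc_of_le (by linarith)]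
    exact Icc_subset_Icc le_rfl (by norm_num))
  have i1b := i1.mono_set (c := -1 / 8) (d := 0) (by
    rw [uIcc_of_le (by linarith), uIcc_of_le (by linarith)]
    exact Icc_subset_Icc (by linarith) le_rfl)
  rw [← intervalIntegral.integral_add_adjacent_intervals i1a i1b]
  have k1 := intervalIntegral.integral_mono_on (by linarith)
    (j3.add (intervalIntegrable_const (c := -C₀))) i1a s2
  have k2 := intervalIntegral.integral_mono_on (by norm_num)
    (intervalIntegrable_const (c := -C₀)) i1b fun t ht => s1 t ⟨by linarith [ht.1], ht.2⟩
  rw [intervalIntegral.integral_add j3 intervalIntegrable_const, intervalIntegral.integral_const_mul,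
    intervalIntegral.integral_const] at k1
  rw [intervalIntegral.integral_const] at k2
  simp only [smul_eq_mul] at k1 k2
  linarith

/-- Short-time approximation of a bounded solution by the localized heat flow. -/
theorem exists_short_time_bound : ∃ (z : Plane → ℝ) (C : ℝ), 0 < C ∧ ContDiff ℝ 2 z ∧
    (∀ x, 0 ≤ z x ∧ z x ≤ 1) ∧ (∀ x ∉ Metric.closedBall (0 : Plane) (1 / 2), z x = 0) ∧
    ∀ (u g : Plane × ℝ → ℝ) (M δ : ℝ), 0 < δ → Measurable u → Measurable g →
    SW u g (Metric.closedBall 0 (1 / 2)) (Icc (-δ) 0) →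
    (∀ x ∈ Metric.closedBall (0 : Plane) (1 / 2), ∀ t ∈ Icc (-δ) 0,
      |u (x, t)| ≤ M ∧ |g (x, t)| ≤ M) →
    ContinuousAt (fun x => u (x, 0)) 0 →
    |u (0, 0) - ∫ x, HK x δ * (z x * u (x, -δ))| ≤ C * M * δ := by
  obtain ⟨z, Cz, hz, hCz, hz01, hz0, hzK, hlap, -, hrad, -⟩ := exists_plane_bump
  refine ⟨z, 17 * Cz + 1, by positivity, hz, hz01, hzK, fun u g M δ hδ hu hg h hb hc => ?_⟩
  set K := Metric.closedBall (0 : Plane) (1 / 2) with hKdef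
  have hK : IsCompact K := isCompact_closedBall _ _
  have hM0 : 0 ≤ M := (abs_nonneg _).trans (hb 0 (by simp [hKdef]) 0 ⟨by linarith, le_rfl⟩).1
  have hlim := h.tendsto_heat hu hz (m := fun _ => 1) contDiff_const hK le_rfl hzK (t₁ := -δ) (M := M)
    ⟨le_rfl, by linarith⟩ ⟨by linarith, le_rfl⟩ (by linarith) (fun x hx t ht => (hb x hx t ht).1) hc
  rw [hz0, one_mul, one_mul, one_mul, neg_neg] at hlim
  refine le_of_tendsto hlim.abs ?_
  filter_upwards [self_mem_nhdsWithin] with ε (hε : 0 < ε)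
  have hsl : ∀ t ∈ uIoc (-δ) 0, ‖∫ x, HK x (ε - t) *
      (u (x, t) * cutErr z (fun _ => 1) ε x t + z x * 1 * g (x, t))‖ ≤ (17 * Cz + 1) * M := by
    intro t ht
    rw [uIoc_of_le (by linarith)] at ht
    have ht' : t ∈ Icc (-δ) 0 := ⟨ht.1.le, ht.2⟩
    have hτ : 0 < ε - t := by linarith [ht.2]
    have h2τ : 0 < 2 * (ε - t) := by linarith
    have j1 := (integrable_HK hτ).mul_const (M * Cz + M)
    have j2 := (integrable_HK h2τ).mul_const (16 * Cz * M)
    refine (norm_integral_le_of_norm_le (j1.add j2) (Eventually.of_forall fun x => ?_)).trans_eq ?_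
    swap
    · simp only [Pi.add_apply]
      rw [integral_add j1 j2, integral_mul_const, integral_mul_const, integral_HK hτ,
        integral_HK h2τ]
      ring
    have hHK := HK_nonneg x hτ
    have hHK2 := HK_nonneg x h2τ
    by_cases hx : x ∈ K
    swap
    · have hKc := hK.isClosed
      simp only [cutErr, hzK x hx, lap_eq_zero_of_notMem hKc hzK x hx,
        rad_eq_zero_of_notMem hKc hzK x hx, Pi.add_apply]
      simp
      positivity
    obtain ⟨h1, h2⟩ := hb x hx t ht'
    have hsq := HK_mul_sq_le x hτ
    have e : HK x (ε - t) * (u (x, t) * cutErr z (fun _ => 1) ε x t + z x * 1 * g (x, t)) =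
        HK x (ε - t) * (u (x, t) * lap z x + z x * g (x, t)) +
          -(u (x, t) * (HK x (ε - t) * rad z x / (ε - t))) := by
      simp only [cutErr, deriv_const]
      ring
    rw [e]
    refine (norm_add_le _ _).trans ?_
    simp only [Pi.add_apply]
    gcongr
    · rw [norm_mul, Real.norm_of_nonneg hHK]
      gcongr
      refine (norm_add_le _ _).trans ?_
      rw [norm_mul, norm_mul, Real.norm_of_nonneg (hz01 x).1]
      gcongr
      · exact h1
      · exact hlap x
      · exact (mul_le_of_le_one_left (norm_nonneg _) (hz01 x).2).trans h2
    · rw [norm_neg, norm_mul, norm_div, norm_mul, Real.norm_of_nonneg hHK, Real.norm_of_nonneg hτ.le]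
      calc ‖u (x, t)‖ * (HK x (ε - t) * ‖rad z x‖ / (ε - t))
          ≤ M * (HK x (ε - t) * (Cz * ‖x‖ ^ 2) / (ε - t)) := by
            gcongr
            · exact h1
            · exact hrad x
        _ = M * Cz * (HK x (ε - t) * ‖x‖ ^ 2 / (ε - t)) := by ring
        _ ≤ M * Cz * (16 * HK x (2 * (ε - t))) := by gcongr
        _ = _ := by ring
  have := intervalIntegral.norm_integral_le_of_norm_le_const hsl
  simpa [abs_of_pos hδ] using this

theorem mem_closedBall_scale {x₀ y : Plane} {r R : ℝ} (hr : 0 < r) :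
    x₀ + r • y ∈ Metric.closedBall x₀ (r * R) ↔ y ∈ Metric.closedBall (0 : Plane) R := by
  rw [mem_closedBall_iff_norm, mem_closedBall_zero_iff, add_sub_cancel_left, norm_smul,
    Real.norm_of_nonneg hr.le, mul_le_mul_iff_right₀ hr]

/-- Change of variables for space-time integrals over parabolic cylinders. -/
theorem integral_pscale (u : Plane × ℝ → ℝ) (x₀ : Plane) (t₀ : ℝ) {r : ℝ} (hr : 0 < r) (a b R : ℝ) :
    ∫ t in (t₀ + r ^ 2 * a)..(t₀ + r ^ 2 * b), ∫ x in Metric.closedBall x₀ (r * R), u (x, t) =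
      r ^ 4 * ∫ s in a..b, ∫ y in Metric.closedBall (0 : Plane) R, u (pscale x₀ t₀ r (y, s)) := by
  have e1 := intervalIntegral.integral_comp_add_mul (a := a) (b := b)
      (fun t => ∫ x in Metric.closedBall x₀ (r * R), u (x, t)) (pow_ne_zero 2 hr.ne') t₀
  simp only [smul_eq_mul] at e1
  have e2 : ∀ s, ∫ x in Metric.closedBall x₀ (r * R), u (x, t₀ + r ^ 2 * s) =
      r ^ 2 * ∫ y in Metric.closedBall (0 : Plane) R, u (pscale x₀ t₀ r (y, s)) := by
    intro s
    rw [← integral_indicator Metric.isClosed_closedBall.measurableSet,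
      ← integral_indicator Metric.isClosed_closedBall.measurableSet, integral_scale x₀ hr]
    congr 1
    refine integral_congr_ae (Eventually.of_forall fun y => ?_)
    simp only [indicator, mem_closedBall_scale hr, pscale]
  simp only [e2] at e1
  rw [intervalIntegral.integral_const_mul] at e1
  have hr2 : (r ^ 2 : ℝ) ≠ 0 := pow_ne_zero 2 hr.ne'
  have e3 : ∀ X Y Z : ℝ, X = (r ^ 2)⁻¹ * Y → X = r ^ 2 * Z → Y = r ^ 4 * Z := by
    intro X Y Z h1 h2
    rw [h1] at h2
    field_simp at h2
    linarith
  exact e3 _ _ _ e1.symm.symm rfl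

theorem measurable_pscale (x₀ : Plane) (t₀ r : ℝ) : Measurable (pscale x₀ t₀ r) := by
  unfold pscale
  fun_prop

theorem mem_Icc_scale {t₀ r s a b : ℝ} (hr : 0 < r) (hs : s ∈ Icc a b) :
    t₀ + r ^ 2 * s ∈ Icc (t₀ + r ^ 2 * a) (t₀ + r ^ 2 * b) :=
  ⟨by have := hs.1; gcongr, by have := hs.2; gcongr⟩

theorem continuousAt_pscale {u : Plane × ℝ → ℝ} {x₀ : Plane} {t₀ : ℝ} (r : ℝ)
    (hc : ContinuousAt (fun x => u (x, t₀)) x₀) :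
    ContinuousAt (fun y => u (pscale x₀ t₀ r (y, 0))) 0 := by
  have e : (fun y => u (pscale x₀ t₀ r (y, 0))) = (fun x => u (x, t₀)) ∘ fun y => x₀ + r • y := by
    funext y; simp [pscale]
  rw [e]
  refine ContinuousAt.comp ?_ (by fun_prop)
  simpa using hc

theorem exists_mass_bound_scaled {N : ℝ} (hN : 1 ≤ N) : ∃ C, 0 < C ∧
    ∀ (u g : Plane × ℝ → ℝ) (C₀ M : ℝ) (x₀ : Plane) (t₀ r : ℝ), 0 < r → 0 ≤ C₀ → Measurable u →
    Measurable g → SW u g (Metric.closedBall x₀ (8 * r)) (Icc (t₀ - N * r ^ 2) t₀) →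
    (∀ x ∈ Metric.closedBall x₀ (8 * r), ∀ t ∈ Icc (t₀ - N * r ^ 2) t₀,
      0 ≤ u (x, t) ∧ |u (x, t)| ≤ M ∧ |g (x, t)| ≤ M ∧ -C₀ ≤ g (x, t)) →
    ContinuousAt (fun x => u (x, t₀)) x₀ →
    ∫ t in (t₀ - N * r ^ 2)..(t₀ - r ^ 2 / 8), ∫ x in Metric.closedBall x₀ (6 * r), u (x, t) ≤
      C * r ^ 4 * (u (x₀, t₀) + C₀ * r ^ 2) := by
  obtain ⟨C, hC, H⟩ := exists_mass_bound hN
  refine ⟨C, hC, fun u g C₀ M x₀ t₀ r hr hC₀ hu hg h hb hc => ?_⟩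
  have hB : ∀ y ∈ Metric.closedBall (0 : Plane) 8, x₀ + r • y ∈ Metric.closedBall x₀ (8 * r) :=
    fun y hy => by rw [mul_comm]; exact (mem_closedBall_scale hr).2 hy
  have hI : ∀ s ∈ Icc (-N) 0, t₀ + r ^ 2 * s ∈ Icc (t₀ - N * r ^ 2) t₀ := fun s hs => by
    have := mem_Icc_scale (t₀ := t₀) hr hs
    rwa [mul_zero, add_zero, mul_neg, ← sub_eq_add_neg, mul_comm (r ^ 2)] at this
  have key := H (fun P => u (pscale x₀ t₀ r P)) (fun P => r ^ 2 * g (pscale x₀ t₀ r P))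
    (C₀ * r ^ 2) (max M (r ^ 2 * M)) (by positivity) (hu.comp (measurable_pscale _ _ _))
    ((hg.comp (measurable_pscale _ _ _)).const_mul _) (h.scale x₀ t₀ hr hB hI)
    (fun y hy s hs => ?_) (continuousAt_pscale r hc)
  · have e := integral_pscale u x₀ t₀ hr (-N) (-1 / 8) 6
    rw [show t₀ + r ^ 2 * -N = t₀ - N * r ^ 2 by ring, show t₀ + r ^ 2 * (-1 / 8) = t₀ - r ^ 2 / 8 by ring,
      mul_comm r 6] at e
    rw [e]
    calc _ ≤ r ^ 4 * _ := mul_le_mul_of_nonneg_left key (by positivity)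
      _ = _ := by simp [pscale]; ring
  · obtain ⟨h1, h2, h3, h4⟩ := hb _ (hB y hy) _ (hI s hs)
    refine ⟨h1, h2.trans (le_max_left _ _), ?_, ?_⟩
    · rw [abs_mul, abs_of_nonneg (sq_nonneg r)]
      exact (mul_le_mul_of_nonneg_left h3 (sq_nonneg r)).trans (le_max_right _ _)
    · have := mul_le_mul_of_nonneg_left h4 (sq_nonneg r)
      simp only [pscale]
      linarith

theorem exists_mean_value_bound_scaled {lam : ℝ} (hlam : 0 ≤ lam) : ∃ C, 0 < C ∧
    ∀ (u g : Plane × ℝ → ℝ) (C₀ M : ℝ) (x₀ : Plane) (t₀ r : ℝ), 0 < r → 0 ≤ C₀ → Measurable u →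
    Measurable g → SW u g (Metric.closedBall x₀ (r / 2)) (Icc (t₀ - r ^ 2 / 2) t₀) →
    (∀ x ∈ Metric.closedBall x₀ (r / 2), ∀ t ∈ Icc (t₀ - r ^ 2 / 2) t₀,
      0 ≤ u (x, t) ∧ |u (x, t)| ≤ M ∧ |g (x, t)| ≤ M ∧ r ^ 2 * g (x, t) ≤ C₀ + lam * u (x, t)) →
    ContinuousAt (fun x => u (x, t₀)) x₀ →
    u (x₀, t₀) ≤ C * (C₀ +
      (r ^ 4)⁻¹ * ∫ t in (t₀ - r ^ 2 / 2)..t₀, ∫ x in Metric.closedBall x₀ (r / 2), u (x, t)) := by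
  obtain ⟨C, hC, H⟩ := exists_mean_value_bound hlam
  refine ⟨C, hC, fun u g C₀ M x₀ t₀ r hr hC₀ hu hg h hb hc => ?_⟩
  have hB : ∀ y ∈ Metric.closedBall (0 : Plane) (1 / 2), x₀ + r • y ∈ Metric.closedBall x₀ (r / 2) :=
    fun y hy => by
      have := (mem_closedBall_scale (x₀ := x₀) hr).2 hy
      rwa [mul_one_div] at this
  have hI : ∀ s ∈ Icc (-1 / 2 : ℝ) 0, t₀ + r ^ 2 * s ∈ Icc (t₀ - r ^ 2 / 2) t₀ := fun s hs => by
    have := mem_Icc_scale (t₀ := t₀) hr hs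
    rwa [mul_zero, add_zero, show t₀ + r ^ 2 * (-1 / 2) = t₀ - r ^ 2 / 2 by ring] at this
  have key := H (fun P => u (pscale x₀ t₀ r P)) (fun P => r ^ 2 * g (pscale x₀ t₀ r P))
    C₀ (max M (r ^ 2 * M)) (by positivity) (hu.comp (measurable_pscale _ _ _))
    ((hg.comp (measurable_pscale _ _ _)).const_mul _) (h.scale x₀ t₀ hr hB hI)
    (fun y hy s hs => ?_) (continuousAt_pscale r hc)
  · have e := integral_pscale u x₀ t₀ hr (-1 / 2) 0 (1 / 2)
    rw [mul_zero, add_zero, show t₀ + r ^ 2 * (-1 / 2) = t₀ - r ^ 2 / 2 by ring, mul_one_div] at e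
    rw [e, inv_mul_cancel_left₀ (by positivity)]
    simpa [pscale] using key
  · obtain ⟨h1, h2, h3, h4⟩ := hb _ (hB y hy) _ (hI s hs)
    refine ⟨h1, h2.trans (le_max_left _ _), ?_, h4⟩
    rw [abs_mul, abs_of_nonneg (sq_nonneg r)]
    exact (mul_le_mul_of_nonneg_left h3 (sq_nonneg r)).trans (le_max_right _ _)

theorem exists_short_time_bound_scaled : ∃ (z : Plane → ℝ) (C : ℝ), 0 < C ∧ ContDiff ℝ 2 z ∧
    (∀ x, 0 ≤ z x ∧ z x ≤ 1) ∧ (∀ x ∉ Metric.closedBall (0 : Plane) (1 / 2), z x = 0) ∧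
    ∀ (u g : Plane × ℝ → ℝ) (M δ : ℝ) (x₀ : Plane) (t₀ r : ℝ), 0 < r → r ≤ 1 → 0 < δ →
    Measurable u → Measurable g →
    SW u g (Metric.closedBall x₀ (r / 2)) (Icc (t₀ - r ^ 2 * δ) t₀) →
    (∀ x ∈ Metric.closedBall x₀ (r / 2), ∀ t ∈ Icc (t₀ - r ^ 2 * δ) t₀,
      |u (x, t)| ≤ M ∧ |g (x, t)| ≤ M) →
    ContinuousAt (fun x => u (x, t₀)) x₀ →
    |u (x₀, t₀) - ∫ y, HK y δ * (z y * u (x₀ + r • y, t₀ - r ^ 2 * δ))| ≤ C * M * δ := by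
  obtain ⟨z, C, hC, hz, hz01, hzK, H⟩ := exists_short_time_bound
  refine ⟨z, C, hC, hz, hz01, hzK, fun u g M δ x₀ t₀ r hr hr1 hδ hu hg h hb hc => ?_⟩
  have hB : ∀ y ∈ Metric.closedBall (0 : Plane) (1 / 2), x₀ + r • y ∈ Metric.closedBall x₀ (r / 2) :=
    fun y hy => by
      have := (mem_closedBall_scale (x₀ := x₀) hr).2 hy
      rwa [mul_one_div] at this
  have hI : ∀ s ∈ Icc (-δ) 0, t₀ + r ^ 2 * s ∈ Icc (t₀ - r ^ 2 * δ) t₀ := fun s hs => by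
    have := mem_Icc_scale (t₀ := t₀) hr hs
    rwa [mul_zero, add_zero, mul_neg, ← sub_eq_add_neg] at this
  have key := H (fun P => u (pscale x₀ t₀ r P)) (fun P => r ^ 2 * g (pscale x₀ t₀ r P))
    M δ hδ (hu.comp (measurable_pscale _ _ _))
    ((hg.comp (measurable_pscale _ _ _)).const_mul _) (h.scale x₀ t₀ hr hB hI)
    (fun y hy s hs => ?_) (continuousAt_pscale r hc)
  · simpa [pscale, ← sub_eq_add_neg] using key
  · obtain ⟨h1, h2⟩ := hb _ (hB y hy) _ (hI s hs)
    refine ⟨h1, ?_⟩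
    rw [abs_mul, abs_of_nonneg (sq_nonneg r)]
    exact (mul_le_of_le_one_left (abs_nonneg _) (by nlinarith)).trans h2

/-- Convolution of a kernel with a function on space-time. -/
noncomputable def mollify (η w : Plane × ℝ → ℝ) (P : Plane × ℝ) : ℝ := ∫ Q, η (P - Q) * w Q

theorem mollify_eq_convolution (η w : Plane × ℝ → ℝ) :
    mollify η w = convolution η w (ContinuousLinearMap.lsmul ℝ ℝ) volume := by
  funext P
  rw [convolution_lsmul_swap]
  rfl

theorem integrable_mollify {η w : Plane × ℝ → ℝ} (hη : Continuous η) (hc : HasCompactSupport η)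
    (hw : LocallyIntegrable w) (P : Plane × ℝ) : Integrable fun Q => η (P - Q) * w Q :=
  (hc.convolutionExists_left (ContinuousLinearMap.lsmul ℝ ℝ) hη hw P).integrable_swap

theorem contDiff_mollify {η w : Plane × ℝ → ℝ} (hη : ContDiff ℝ ∞ η) (hc : HasCompactSupport η)
    (hw : LocallyIntegrable w) : ContDiff ℝ ∞ (mollify η w) := by
  rw [mollify_eq_convolution]
  exact hc.contDiff_convolution_left _ hη hw

theorem hasCompactSupport_dd {v : Plane × ℝ} {η : Plane × ℝ → ℝ} (hc : HasCompactSupport η) :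
    HasCompactSupport (dd v η) :=
  (hc.fderiv ℝ).comp_left (g := fun A : Plane × ℝ →L[ℝ] ℝ => A v) (by simp)

theorem dd_mollify {v : Plane × ℝ} {η w : Plane × ℝ → ℝ} (hη : ContDiff ℝ ∞ η)
    (hc : HasCompactSupport η) (hw : LocallyIntegrable w) :
    dd v (mollify η w) = mollify (dd v η) w := by
  funext P
  have h1 : ContDiff ℝ 1 η := hη.of_le (by simp)
  have h := hc.hasFDerivAt_convolution_left (ContinuousLinearMap.lsmul ℝ ℝ) (μ := volume) h1 hw P
  have h2 : ConvolutionExistsAt (fderiv ℝ η) w P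
      ((ContinuousLinearMap.lsmul ℝ ℝ : ℝ →L[ℝ] ℝ →L[ℝ] ℝ).precompL (Plane × ℝ)) volume :=
    (hc.fderiv ℝ).convolutionExists_left _ (h1.continuous_fderiv one_ne_zero) hw P
  rw [dd, mollify_eq_convolution, h.fderiv, convolution_eq_swap,
    ContinuousLinearMap.integral_apply h2.integrable_swap]
  simp [mollify, dd]

theorem Lx_mollify {η w : Plane × ℝ → ℝ} (hη : ContDiff ℝ ∞ η)
    (hc : HasCompactSupport η) (hw : LocallyIntegrable w) :
    Lx (mollify η w) = mollify (Lx η) w := by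
  funext P
  simp only [Lx, dd_mollify hη hc hw, dd_mollify (smooth_dd hη) (hasCompactSupport_dd hc) hw]
  simp only [mollify]
  rw [← integral_finsetSum]
  · simp only [← Finset.sum_mul]
    rfl
  exact fun i _ => integrable_mollify (smooth_dd (smooth_dd hη)).continuous
    (hasCompactSupport_dd (hasCompactSupport_dd hc)) hw P

theorem dd_reflect {v : Plane × ℝ} {η : Plane × ℝ → ℝ} (hη : ContDiff ℝ ∞ η) (P : Plane × ℝ) :
    dd v (fun Q => η (P - Q)) = fun Q => -dd v η (P - Q) := by
  funext Q
  have h := dd_comp_affine (v := v) (F := η) (-ContinuousLinearMap.id ℝ (Plane × ℝ)) P (P := Q)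
    (hη.differentiable (by simp) _)
  simp only [neg_apply, ContinuousLinearMap.id_apply, ← sub_eq_add_neg] at h
  rw [h]
  simp [dd]

theorem Lx_reflect {η : Plane × ℝ → ℝ} (hη : ContDiff ℝ ∞ η) (P Q : Plane × ℝ) :
    Lx (fun Q => η (P - Q)) Q = Lx η (P - Q) := by
  simp only [Lx]
  refine Finset.sum_congr rfl fun i _ => ?_
  rw [dd_reflect hη]
  have : (fun Q => -dd (ex i) η (P - Q)) = fun Q => (-1) * (dd (ex i) η (P - Q)) := by
    funext Q; ring
  rw [this, dd_const_mul (-1), dd_reflect (smooth_dd hη)]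
  ring

/-- If `F` is `e`-close to `c` near `P`, so is its mollification at `P`. -/
theorem abs_mollify_sub_le {η F : Plane × ℝ → ℝ} (hη : Continuous η) (hc : HasCompactSupport η)
    (h0 : ∀ P, 0 ≤ η P) (h1 : ∫ P, η P = 1) (hF : LocallyIntegrable F) {P : Plane × ℝ} {c e : ℝ}
    (h : ∀ Q, η (P - Q) ≠ 0 → |F Q - c| ≤ e) : |mollify η F P - c| ≤ e := by
  have i1 : ∫ Q, η (P - Q) = 1 := by rw [integral_sub_left_eq_self, h1]
  have hi := integrable_mollify hη hc hF P
  have hj : Integrable fun Q => η (P - Q) := by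
    simpa using integrable_mollify hη hc (locallyIntegrable_const (1 : ℝ)) P
  have e1 : mollify η F P - c = ∫ Q, η (P - Q) * (F Q - c) := by
    simp only [mul_sub]
    rw [integral_sub hi (hj.mul_const c), integral_mul_const, i1, one_mul]
    rfl
  rw [e1]
  calc |∫ Q, η (P - Q) * (F Q - c)| ≤ ∫ Q, η (P - Q) * e := by
        refine norm_integral_le_of_norm_le (f := fun Q => η (P - Q) * (F Q - c)) (hj.mul_const e) ?_
        refine Eventually.of_forall fun Q => ?_
        rw [Real.norm_eq_abs, abs_mul, abs_of_nonneg (h0 _)]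
        by_cases hq : η (P - Q) = 0
        · simp [hq]
        · exact mul_le_mul_of_nonneg_left (h Q hq) (h0 _)
    _ = e := by rw [integral_mul_const, i1, one_mul]

theorem integral_prod_eq_interval {F : Plane × ℝ → ℝ} (hF : Integrable F) {a b : ℝ} (hab : a ≤ b)
    (h0 : ∀ x, ∀ t ∉ Icc a b, F (x, t) = 0) : ∫ Q, F Q = ∫ t in a..b, ∫ x, F (x, t) := by
  rw [Measure.volume_eq_prod, integral_prod_symm F (by rwa [← Measure.volume_eq_prod]),
    intervalIntegral.integral_of_le hab, ← integral_Icc_eq_integral_Ioc,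
    setIntegral_eq_integral_of_forall_compl_eq_zero]
  intro t ht
  simp [h0 _ t ht]

theorem locallyIntegrable_indicator {w : Plane × ℝ → ℝ} (hw : Measurable w) {K : Set (Plane × ℝ)}
    (hK : IsCompact K) {M : ℝ} (hM : ∀ Q ∈ K, |w Q| ≤ M) : LocallyIntegrable (K.indicator w) := by
  refine Integrable.locallyIntegrable ?_
  rw [integrable_indicator_iff hK.measurableSet]
  exact Measure.integrableOn_of_bounded hK.measure_lt_top.ne hw.aestronglyMeasurable
    ((ae_restrict_iff' hK.measurableSet).2 (Eventually.of_forall hM))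

/-- Mollification turns the slicewise weak equation into a pointwise one. -/
theorem SW.mollify_eq {v g η : Plane × ℝ → ℝ} {R M : ℝ} (hR : 0 ≤ R) (hv : Measurable v)
    (hg : Measurable g)
    (h : SW v g (Metric.closedBall 0 (R + 1)) (Icc (-(R + 1) ^ 2) ((R + 1) ^ 2)))
    (hvM : ∀ Q ∈ Metric.closedBall (0 : Plane) (R + 1) ×ˢ Icc (-(R + 1) ^ 2) ((R + 1) ^ 2), |v Q| ≤ M)
    (hgM : ∀ Q ∈ Metric.closedBall (0 : Plane) (R + 1) ×ˢ Icc (-(R + 1) ^ 2) ((R + 1) ^ 2), |g Q| ≤ M)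
    (hη : ContDiff ℝ ∞ η) (hc : HasCompactSupport η) (h0 : ∀ Q, 1 ≤ ‖Q‖ → η Q = 0)
    {P : Plane × ℝ} (hP : P ∈ Metric.closedBall (0 : Plane) R ×ˢ Icc (-R ^ 2) (R ^ 2)) :
    dd et (mollify η ((Metric.closedBall (0 : Plane) (R + 1) ×ˢ Icc (-(R + 1) ^ 2) ((R + 1) ^ 2)).indicator v)) P
      - Lx (mollify η ((Metric.closedBall (0 : Plane) (R + 1) ×ˢ Icc (-(R + 1) ^ 2) ((R + 1) ^ 2)).indicator v)) P
      = mollify η ((Metric.closedBall (0 : Plane) (R + 1) ×ˢ Icc (-(R + 1) ^ 2) ((R + 1) ^ 2)).indicator g) P := by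
  set K : Set (Plane × ℝ) := Metric.closedBall (0 : Plane) (R + 1) ×ˢ Icc (-(R + 1) ^ 2) ((R + 1) ^ 2)
    with hKdef
  have hK : IsCompact K := (isCompact_closedBall _ _).prod isCompact_Icc
  have lv := locallyIntegrable_indicator hv hK hvM
  have lg := locallyIntegrable_indicator hg hK hgM
  obtain ⟨hP1, hP2⟩ := hP
  rw [mem_closedBall_zero_iff] at hP1
  have hx : ∀ x : Plane, x ∉ Metric.closedBall (0 : Plane) (R + 1) → ∀ t, η (P - (x, t)) = 0 := by
    intro x hx t
    refine h0 _ (le_trans ?_ (norm_fst_le _))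
    rw [mem_closedBall_zero_iff, not_le] at hx
    have := norm_sub_norm_le x P.1
    rw [norm_sub_rev] at this
    change 1 ≤ ‖P.1 - x‖
    linarith
  have ht : ∀ x : Plane, ∀ t, R ^ 2 + 1 ≤ |t| → η (P - (x, t)) = 0 := by
    intro x t ht
    refine h0 _ (le_trans ?_ (norm_snd_le _))
    change 1 ≤ |P.2 - t|
    have h3 : |P.2| ≤ R ^ 2 := abs_le.2 ⟨hP2.1, hP2.2⟩
    have := abs_sub_abs_le_abs_sub t P.2
    rw [abs_sub_comm] at this
    linarith
  have hRR : R ^ 2 + 1 ≤ (R + 1) ^ 2 := by nlinarith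
  have hz : ∀ Q, Q ∉ K → η (P - Q) = 0 := by
    rintro ⟨x, t⟩ hQ
    by_cases h1 : x ∈ Metric.closedBall (0 : Plane) (R + 1)
    · refine ht x t ?_
      by_contra h4
      rw [not_le, abs_lt] at h4
      exact hQ ⟨h1, by simp only; linarith [h4.1], by simp only; linarith [h4.2]⟩
    · exact hx x h1 t
  have hz' : ∀ Q, Q ∉ K → ∀ᶠ Q' in 𝓝 Q, η (P - Q') = 0 := fun Q hQ => by
    filter_upwards [hK.isClosed.isOpen_compl.mem_nhds hQ] with Q' hQ' using hz Q' hQ'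
  have hψ : ContDiff ℝ ∞ fun Q => η (P - Q) := hη.comp (contDiff_const.sub contDiff_id)
  have key := h (fun Q => η (P - Q)) (Metric.closedBall 0 (R + 1)) (isCompact_closedBall _ _)
    Subset.rfl hx (-(R + 1) ^ 2) (left_mem_Icc.2 (by nlinarith)) ((R + 1) ^ 2)
    (right_mem_Icc.2 (by nlinarith)) (by nlinarith)
    (fun x t _ => (hψ.of_le two_le_infty).contDiffAt)
  have b1 : ∀ x : Plane, η (P - (x, (R + 1) ^ 2)) = 0 := fun x => ht x _ (by rw [abs_of_nonneg (by positivity)]; exact hRR)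
  have b2 : ∀ x : Plane, η (P - (x, -(R + 1) ^ 2)) = 0 := fun x => ht x _ (by rw [abs_neg, abs_of_nonneg (by positivity)]; exact hRR)
  simp only [b1, b2, mul_zero, integral_zero, sub_zero] at key
  have i1 := integrable_mollify (smooth_dd (v := et) hη).continuous (hasCompactSupport_dd hc) lv P
  have hcL : HasCompactSupport (Lx η) := by
    refine HasCompactSupport.intro (K := tsupport η) hc fun Q hQ => ?_
    exact Lx_eq_zero_of_notMem hc.isCompact.isClosed (fun Q' hQ' => image_eq_zero_of_notMem_tsupport hQ') Q hQ
  have i2 := integrable_mollify (smooth_Lx hη).continuous hcL lv P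
  have i3 := integrable_mollify hη.continuous hc lg P
  rw [dd_mollify hη hc lv, Lx_mollify hη hc lv]
  have hpt : ∀ Q, v Q * (dd et (fun Q => η (P - Q)) Q + Lx (fun Q => η (P - Q)) Q) + g Q * η (P - Q) =
      -(dd et η (P - Q) * K.indicator v Q) + Lx η (P - Q) * K.indicator v Q
        + η (P - Q) * K.indicator g Q := by
    intro Q
    rw [dd_reflect hη, Lx_reflect hη]
    by_cases hQ : Q ∈ K
    · simp only [indicator_of_mem hQ]; ring
    · have e1 : dd et (fun Q => η (P - Q)) Q = 0 := dd_eq_zero_of_eventuallyEq_zero (hz' Q hQ)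
      have e2 : Lx (fun Q => η (P - Q)) Q = 0 :=
        Lx_eq_zero_of_notMem hK.isClosed hz Q hQ
      rw [dd_reflect hη] at e1
      rw [Lx_reflect hη] at e2
      simp only [indicator_of_notMem hQ, hz Q hQ, e1, e2]; ring
  have i4 : Integrable fun Q => -(dd et η (P - Q) * K.indicator v Q) + Lx η (P - Q) * K.indicator v Q
        + η (P - Q) * K.indicator g Q := (i1.fun_neg.fun_add i2).fun_add i3
  have e := integral_prod_eq_interval i4 (a := -(R + 1) ^ 2) (b := (R + 1) ^ 2) (by nlinarith) (by
    intro x t h5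
    have : (x, t) ∉ K := fun h6 => h5 h6.2
    simp only [indicator_of_notMem this, mul_zero]; ring)
  simp only [hpt] at key
  rw [← e, integral_add (i1.fun_neg.fun_add i2) i3, integral_add i1.fun_neg i2, integral_neg] at key
  simp only [mollify]
  linarith

/-- Continuous slicewise weak solutions can be approximated by smooth approximate solutions. -/
theorem SW.exists_smooth_approx {v g : Plane × ℝ → ℝ} {R p ℓ ε ε' : ℝ} (hR : 0 ≤ R) (hp : 1 < p)
    (hℓ : 0 < ℓ) (hε' : 0 < ε') (hv : Measurable v) (hg : Measurable g)
    (h : SW v g (Metric.closedBall 0 (R + 1)) (Icc (-(R + 1) ^ 2) ((R + 1) ^ 2)))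
    (hc : ContinuousOn v (Metric.closedBall (0 : Plane) (R + 1) ×ˢ Icc (-(R + 1) ^ 2) ((R + 1) ^ 2)))
    (hb : ∀ Q ∈ Metric.closedBall (0 : Plane) (R + 1) ×ˢ Icc (-(R + 1) ^ 2) ((R + 1) ^ 2),
      0 ≤ v Q ∧ v Q ≤ 3 / 2 ∧ |g Q - ℓ * v Q ^ p| ≤ ε) :
    ∃ V : Plane × ℝ → ℝ, ContDiff ℝ ∞ V ∧ (∀ P, 0 ≤ V P) ∧
      ∀ P ∈ Metric.closedBall (0 : Plane) R ×ˢ Icc (-R ^ 2) (R ^ 2), |V P - v P| ≤ ε' ∧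
        |dd et V P - Lx V P - ℓ * V P ^ p| ≤ ε + ε' := by
  set K : Set (Plane × ℝ) := Metric.closedBall (0 : Plane) (R + 1) ×ˢ Icc (-(R + 1) ^ 2) ((R + 1) ^ 2)
    with hKdef
  have hK : IsCompact K := (isCompact_closedBall _ _).prod isCompact_Icc
  have hp0 : 0 ≤ p := by linarith
  have hpow : ContinuousOn (fun s : ℝ => ℓ * s ^ p) (Icc 0 (3 / 2)) :=
    (continuous_const.mul (Real.continuous_rpow_const hp0)).continuousOn
  obtain ⟨a, ha, hpa⟩ := Metric.uniformContinuousOn_iff.1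
    (isCompact_Icc.uniformContinuousOn_of_continuous hpow) (ε' / 2) (by positivity)
  have he0 : 0 < min ε' (a / 2) := by positivity
  obtain ⟨d, hd, hvd⟩ := Metric.uniformContinuousOn_iff.1 (hK.uniformContinuousOn_of_continuous hc)
    (min ε' (a / 2)) he0
  set φ : ContDiffBump (0 : Plane × ℝ) := ⟨min d 1 / 2, min d 1, by positivity, by
    have : 0 < min d 1 := by positivity
    linarith⟩ with hφ
  have ro : φ.rOut = min d 1 := rfl
  set η := φ.normed volume with hηdef
  have hη : ContDiff ℝ ∞ η := φ.contDiff_normed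
  have hηc : HasCompactSupport η := φ.hasCompactSupport_normed
  have hη0 : ∀ Q, min d 1 ≤ ‖Q‖ → η Q = 0 := by
    intro Q hQ
    by_contra hne
    have : Q ∈ Function.support (φ.normed volume) := hne
    rw [φ.support_normed_eq, mem_ball_zero_iff, ro] at this
    linarith
  set M := 3 / 2 + ℓ * (3 / 2) ^ p + ε with hM
  have hε0 : 0 ≤ ε := (abs_nonneg _).trans (hb (0, 0) ⟨by
    simp; linarith, by simp only; constructor <;> nlinarith⟩).2.2
  have hvM : ∀ Q ∈ K, |v Q| ≤ M := fun Q hQ => by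
    rw [abs_of_nonneg (hb Q hQ).1]
    have := (hb Q hQ).2.1
    have : 0 ≤ ℓ * (3 / 2 : ℝ) ^ p := by positivity
    linarith
  have hgM : ∀ Q ∈ K, |g Q| ≤ M := fun Q hQ => by
    obtain ⟨h1, h2, h3⟩ := hb Q hQ
    have h4 : v Q ^ p ≤ (3 / 2 : ℝ) ^ p := Real.rpow_le_rpow h1 h2 hp0
    have h5 : 0 ≤ v Q ^ p := Real.rpow_nonneg h1 p
    have h6 := abs_le.1 h3
    have h7 : ℓ * v Q ^ p ≤ ℓ * (3 / 2 : ℝ) ^ p := by gcongr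
    have h8 : 0 ≤ ℓ * v Q ^ p := by positivity
    rw [abs_le]
    constructor <;> linarith
  have lv := locallyIntegrable_indicator hv hK hvM
  have lg := locallyIntegrable_indicator hg hK hgM
  refine ⟨mollify η (K.indicator v), contDiff_mollify hη hηc lv, fun P => ?_, fun P hP => ?_⟩
  · refine integral_nonneg fun Q => mul_nonneg (φ.nonneg_normed _) ?_
    exact indicator_nonneg (fun Q hQ => (hb Q hQ).1) Q
  have hnear : ∀ Q, η (P - Q) ≠ 0 → Q ∈ K ∧ dist Q P < d := by
    intro Q hQ
    have h1 : ‖P - Q‖ < min d 1 := by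
      by_contra h2
      exact hQ (hη0 _ (not_lt.1 h2))
    have h2 : ‖P - Q‖ < 1 := h1.trans_le (min_le_right _ _)
    refine ⟨⟨?_, ?_⟩, ?_⟩
    · have h3 := (norm_fst_le (P - Q)).trans_lt h2
      have h4 := mem_closedBall_zero_iff.1 hP.1
      have h5 := norm_sub_norm_le Q.1 P.1
      rw [norm_sub_rev] at h5
      rw [mem_closedBall_zero_iff]
      simp only [Prod.fst_sub] at h3
      linarith
    · have h3 := (norm_snd_le (P - Q)).trans_lt h2
      rw [Real.norm_eq_abs, abs_lt] at h3
      simp only [Prod.snd_sub] at h3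
      have h4 := hP.2
      constructor <;> nlinarith [h4.1, h4.2]
    · rw [dist_comm, dist_eq_norm]
      exact h1.trans_le (min_le_left _ _)
  have hPK : P ∈ K := by
    refine ⟨Metric.closedBall_subset_closedBall (by linarith) hP.1, ?_⟩
    have h4 := hP.2
    constructor <;> nlinarith [h4.1, h4.2]
  have hVv : |mollify η (K.indicator v) P - v P| ≤ min ε' (a / 2) := by
    refine abs_mollify_sub_le hη.continuous hηc φ.nonneg_normed φ.integral_normed lv fun Q hQ => ?_
    obtain ⟨hQ1, hQ2⟩ := hnear Q hQ
    rw [indicator_of_mem hQ1]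
    exact (hvd Q hQ1 P hPK hQ2).le
  have hV0 : mollify η (K.indicator v) P ∈ Icc (0 : ℝ) (3 / 2) := by
    have := abs_mollify_sub_le (c := 3 / 4) (e := 3 / 4) (P := P) hη.continuous hηc φ.nonneg_normed
      φ.integral_normed lv fun Q hQ => by
        obtain ⟨hQ1, hQ2⟩ := hnear Q hQ
        rw [indicator_of_mem hQ1, abs_le]
        have := hb Q hQ1
        constructor <;> linarith [this.1, this.2.1]
    rw [abs_le] at this
    constructor <;> linarith [this.1, this.2]
  refine ⟨hVv.trans (min_le_left _ _), ?_⟩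
  rw [h.mollify_eq hR hv hg hvM hgM hη hηc (fun Q hQ => hη0 Q ((min_le_right _ _).trans hQ)) hP]
  refine abs_mollify_sub_le hη.continuous hηc φ.nonneg_normed φ.integral_normed lg fun Q hQ => ?_
  obtain ⟨hQ1, hQ2⟩ := hnear Q hQ
  rw [indicator_of_mem hQ1]
  have e1 : dist (v Q) (mollify η (K.indicator v) P) < a := by
    have h1 := (hvd Q hQ1 P hPK hQ2).trans_le (min_le_right _ _)
    have h2 := hVv.trans (min_le_right _ _)
    have := dist_triangle_right (v Q) (mollify η (K.indicator v) P) (v P)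
    rw [Real.dist_eq (mollify η (K.indicator v) P)] at this
    linarith
  have e2 := hpa _ ⟨(hb Q hQ1).1, (hb Q hQ1).2.1⟩ _ hV0 e1
  rw [Real.dist_eq] at e2
  have e3 := (hb Q hQ1).2.2
  have := abs_sub_le (g Q) (ℓ * v Q ^ p) (ℓ * mollify η (K.indicator v) P ^ p)
  linarith

/-- Quantitative Liouville property: an approximate solution on a large cylinder with values in
`[0, 3/2]` is smaller than `1` at the centre. -/
theorem exists_lt_one_of_approx {p ℓ : ℝ} (hp : 1 < p) (hℓ : 0 < ℓ) : ∃ R ε, 1 ≤ R ∧ 0 < ε ∧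
    ∀ v g : Plane × ℝ → ℝ, Measurable v → Measurable g →
    SW v g (Metric.closedBall 0 (R + 1)) (Icc (-(R + 1) ^ 2) ((R + 1) ^ 2)) →
    ContinuousOn v (Metric.closedBall (0 : Plane) (R + 1) ×ˢ Icc (-(R + 1) ^ 2) ((R + 1) ^ 2)) →
    (∀ Q ∈ Metric.closedBall (0 : Plane) (R + 1) ×ˢ Icc (-(R + 1) ^ 2) ((R + 1) ^ 2),
      0 ≤ v Q ∧ v Q ≤ 3 / 2 ∧ |g Q - ℓ * v Q ^ p| ≤ ε) → v (0, 0) < 1 := by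
  have hp0 : 0 ≤ p := by linarith
  obtain ⟨C, hC, hmean⟩ := exists_mean_value_bound_scaled
    (lam := ℓ * (3 / 2) ^ (p - 1)) (by positivity)
  set Q1 : Set (Plane × ℝ) := Metric.closedBall 0 1 ×ˢ Icc (-1 : ℝ) 1 with hQ1
  have hQ1c : IsCompact Q1 := (isCompact_closedBall _ _).prod isCompact_Icc
  set m := volume.real Q1 with hm
  have hm0 : 0 ≤ m := measureReal_nonneg
  set δ := 1 / (8 * C * (m + 1)) with hδ
  have hδ0 : 0 < δ := by positivity
  set δ2 := δ ^ (p - 1) / (8 * C) with hδ2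
  have hδ20 : 0 < δ2 := by positivity
  obtain ⟨R, εA, hR, hεA, HA⟩ := exists_small_integral_rpow hp hℓ hδ20
  refine ⟨R, min (εA / 2) (1 / (8 * C)), hR, by positivity, fun v g hv hg h hc hb => ?_⟩
  set ε := min (εA / 2) (1 / (8 * C)) with hε
  obtain ⟨V, hVs, hV0, hV⟩ := h.exists_smooth_approx (ε' := min (εA / 2) (min (1 / 2) δ)) (by linarith) hp hℓ
    (by positivity) hv hg hc hb
  have hsub : Metric.closedBall (0 : Plane) R ×ˢ Icc (-R ^ 2) (R ^ 2) ⊆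
      Metric.closedBall (0 : Plane) (R + 1) ×ˢ Icc (-(R + 1) ^ 2) ((R + 1) ^ 2) := by
    refine prod_mono (Metric.closedBall_subset_closedBall (by linarith)) (Icc_subset_Icc ?_ ?_) <;>
      nlinarith
  have hsub1 : Q1 ⊆ Metric.closedBall (0 : Plane) R ×ˢ Icc (-R ^ 2) (R ^ 2) := by
    refine prod_mono (Metric.closedBall_subset_closedBall hR) (Icc_subset_Icc ?_ ?_) <;> nlinarith
  have hA := HA V hVs hV0 fun P hP => by
    have h1 := hV P hP
    have h2 := hb P (hsub hP)
    have h3 := abs_le.1 (h1.1.trans ((min_le_right _ _).trans (min_le_left _ _)))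
    refine ⟨by linarith [h3.2], h1.2.trans ?_⟩
    have := min_le_left (εA / 2) (1 / (8 * C))
    have := min_le_left (εA / 2) (min (1 / 2) δ)
    linarith
  -- pointwise bound for `v`
  have hvb : ∀ Q ∈ Q1, v Q ≤ 2 * δ + δ ^ (1 - p) * V Q ^ p := by
    intro Q hQ
    have h1 := abs_le.1 ((hV Q (hsub1 hQ)).1.trans ((min_le_right _ _).trans (min_le_right _ _)))
    have h2 : V Q ≤ δ + δ ^ (1 - p) * V Q ^ p := by
      have h3 : 0 ≤ V Q ^ p := Real.rpow_nonneg (hV0 Q) p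
      have h4 : 0 ≤ δ ^ (1 - p) := by positivity
      rcases le_or_gt (V Q) δ with h5 | h5
      · nlinarith
      · have h6 : 0 < V Q := hδ0.trans h5
        have h7 : V Q ^ p = V Q ^ (p - 1) * V Q := by
          rw [← Real.rpow_add_one h6.ne']; ring_nf
        have h8 : δ ^ (p - 1) ≤ V Q ^ (p - 1) := Real.rpow_le_rpow hδ0.le h5.le (by linarith)
        have h9 : δ ^ (1 - p) * δ ^ (p - 1) = 1 := by
          rw [← Real.rpow_add hδ0]; norm_num
        have h10 : 1 ≤ δ ^ (1 - p) * V Q ^ (p - 1) := by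
          calc (1:ℝ) = δ ^ (1 - p) * δ ^ (p - 1) := h9.symm
            _ ≤ _ := by gcongr
        rw [h7]
        nlinarith
    linarith [h1.1]
  have hgb : ∀ Q ∈ Q1, g Q ≤ ε + ℓ * (3 / 2) ^ (p - 1) * v Q := by
    intro Q hQ
    obtain ⟨h1, h2, h3⟩ := hb Q (hsub (hsub1 hQ))
    have h4 := (abs_le.1 h3).2
    have h5 : v Q ^ p ≤ (3 / 2 : ℝ) ^ (p - 1) * v Q := by
      rcases h1.eq_or_lt with h6 | h6
      · rw [← h6, Real.zero_rpow (by linarith)]; simp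
      · have h7 : v Q ^ p = v Q ^ (p - 1) * v Q := by
          rw [← Real.rpow_add_one h6.ne']; ring_nf
        rw [h7]
        have := Real.rpow_le_rpow h1 h2 (by linarith : 0 ≤ p - 1)
        gcongr
    have h8 : ℓ * v Q ^ p ≤ ℓ * ((3 / 2 : ℝ) ^ (p - 1) * v Q) := by gcongr
    linarith
  have hin : ∀ x ∈ Metric.closedBall (0 : Plane) (1 / 2), ∀ t ∈ Icc (-(1 / 2) : ℝ) 0, (x, t) ∈ Q1 :=
    fun x hx t ht => ⟨Metric.closedBall_subset_closedBall (by norm_num) hx,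
      by simp only; constructor <;> linarith [ht.1, ht.2]⟩
  set M := 3 / 2 + ℓ * (3 / 2) ^ p + ε with hM
  have hε0 : 0 < ε := by positivity
  have hab : ∀ Q ∈ Q1, |v Q| ≤ M ∧ |g Q| ≤ M := fun Q hQ => by
    obtain ⟨h1, h2, h3⟩ := hb Q (hsub (hsub1 hQ))
    have h4 : v Q ^ p ≤ (3 / 2 : ℝ) ^ p := Real.rpow_le_rpow h1 h2 hp0
    have h5 : 0 ≤ v Q ^ p := Real.rpow_nonneg h1 p
    have h6 := abs_le.1 h3
    have h7 : ℓ * v Q ^ p ≤ ℓ * (3 / 2 : ℝ) ^ p := by gcongr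
    have h8 : 0 ≤ ℓ * v Q ^ p := by positivity
    rw [abs_le, abs_le]
    refine ⟨⟨?_, ?_⟩, ?_, ?_⟩ <;> linarith
  have hc0 : ContinuousAt (fun x : Plane => v (x, 0)) 0 := by
    have h1 : ContinuousAt v (0, 0) := hc.continuousAt (prod_mem_nhds
      (Metric.closedBall_mem_nhds _ (by linarith)) (Icc_mem_nhds (by nlinarith) (by nlinarith)))
    exact h1.comp (f := fun x : Plane => ((x, 0) : Plane × ℝ)) (by fun_prop)
  have key := hmean v g ε M 0 0 1 one_pos hε0.le hv hg
    (h.mono ?_ ?_) (fun x hx t ht => ?_) hc0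
  rotate_left
  · exact Metric.closedBall_subset_closedBall (by linarith)
  · refine Icc_subset_Icc ?_ ?_ <;> nlinarith
  · have hQ := hin x hx t (by norm_num at ht ⊢; exact ht)
    refine ⟨(hb _ (hsub (hsub1 hQ))).1, (hab _ hQ).1, (hab _ hQ).2, ?_⟩
    have := hgb _ hQ
    linarith
  norm_num at key
  have hint : ∫ t in (-(1 / 2) : ℝ)..0, ∫ x in Metric.closedBall (0 : Plane) (1 / 2), v (x, t) ≤
      2 * δ * m + δ ^ (1 - p) * δ2 := by
    set K : Set (Plane × ℝ) := Metric.closedBall (0 : Plane) (1 / 2) ×ˢ Icc (-(1 / 2) : ℝ) 0 with hK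
    have hKc : IsCompact K := (isCompact_closedBall _ _).prod isCompact_Icc
    have hKQ : K ⊆ Q1 := fun Q hQ => hin Q.1 hQ.1 Q.2 hQ.2
    have iv : IntegrableOn v K := Measure.integrableOn_of_bounded hKc.measure_lt_top.ne
      hv.aestronglyMeasurable ((ae_restrict_iff' hKc.measurableSet).2
        (Eventually.of_forall fun Q hQ => (hab Q (hKQ hQ)).1))
    have e1 : ∫ t in (-(1 / 2) : ℝ)..0, ∫ x in Metric.closedBall (0 : Plane) (1 / 2), v (x, t) =
        ∫ Q in K, v Q := by
      rw [← integral_indicator hKc.measurableSet, integral_prod_eq_interval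
        ((integrable_indicator_iff hKc.measurableSet).2 iv) (a := -(1 / 2)) (b := 0) (by norm_num)]
      · refine intervalIntegral.integral_congr fun t ht => ?_
        rw [uIcc_of_le (by norm_num)] at ht
        rw [← integral_indicator Metric.isClosed_closedBall.measurableSet]
        refine integral_congr_ae (Eventually.of_forall fun x => ?_)
        beta_reduce
        by_cases hx : x ∈ Metric.closedBall (0 : Plane) (1 / 2)
        · rw [indicator_of_mem hx, indicator_of_mem (show (x, t) ∈ K from ⟨hx, ht⟩)]
        · rw [indicator_of_notMem hx, indicator_of_notMem (show (x, t) ∉ K from fun h => hx h.1)]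
      · intro x t ht
        exact indicator_of_notMem (fun h => ht h.2) _
    have iV : IntegrableOn (fun Q => V Q ^ p) Q1 :=
      (hVs.continuous.rpow_const fun _ => Or.inr hp0).continuousOn.integrableOn_compact hQ1c
    have ic : IntegrableOn (fun _ : Plane × ℝ => 2 * δ) Q1 :=
      continuousOn_const.integrableOn_compact hQ1c
    rw [e1]
    calc ∫ Q in K, v Q ≤ ∫ Q in K, (2 * δ + δ ^ (1 - p) * V Q ^ p) :=
          setIntegral_mono_on iv ((ic.add (iV.const_mul _)).mono_set hKQ) hKc.measurableSet
            fun Q hQ => hvb Q (hKQ hQ)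
      _ ≤ ∫ Q in Q1, (2 * δ + δ ^ (1 - p) * V Q ^ p) := by
          refine setIntegral_mono_set (ic.add (iV.const_mul _)) ?_ (hKQ.eventuallyLE)
          refine Eventually.of_forall fun Q => ?_
          have := Real.rpow_nonneg (hV0 Q) p
          simp only [Pi.zero_apply]
          positivity
      _ = 2 * δ * m + δ ^ (1 - p) * ∫ Q in Q1, V Q ^ p := by
          rw [integral_add ic (iV.const_mul _), setIntegral_const, integral_const_mul, smul_eq_mul]
          ring
      _ ≤ _ := by gcongr
  have e2 : δ ^ (1 - p) * δ2 = 1 / (8 * C) := by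
    rw [hδ2, mul_div_assoc', ← Real.rpow_add hδ0]; norm_num
  have e3 : 2 * δ * m ≤ 2 / (8 * C) := by
    rw [hδ, show 2 * (1 / (8 * C * (m + 1))) * m = (2 / (8 * C)) * (m / (m + 1)) by field_simp]
    exact mul_le_of_le_one_right (by positivity) ((div_le_one (by positivity)).2 (by linarith))
  have e4 : ε ≤ 1 / (8 * C) := min_le_right _ _
  calc v (0, 0) ≤ C * (1 / (8 * C) + (2 / (8 * C) + 1 / (8 * C))) := by
        refine key.trans ?_
        gcongr
        norm_num at hint e2 e3 ⊢
        linarith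
    _ < 1 := by
        have : C * (1 / (8 * C) + (2 / (8 * C) + 1 / (8 * C))) = 1 / 2 := by field_simp; norm_num
        rw [this]; norm_num

theorem SW.const_mul {u g : Plane × ℝ → ℝ} {B : Set Plane} {I : Set ℝ} (h : SW u g B I) (c : ℝ) :
    SW (fun P => c * u P) (fun P => c * g P) B I := by
  intro ψ K hK hKB h0 t₁ h₁ t₂ h₂ h12 hψ
  have := h ψ K hK hKB h0 t₁ h₁ t₂ h₂ h12 hψ
  simp only [mul_assoc, ← mul_add, integral_const_mul, intervalIntegral.integral_const_mul, ← this]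
  ring

/-- A function asymptotic to `ℓ s ^ p` at infinity is close to it up to a bounded error. -/
theorem exists_growth_bound {p ℓ ε : ℝ} {f : ℝ → ℝ} (hp : 0 ≤ p) (hf : Continuous f)
    (hlim : Tendsto (fun s => s ^ (-p) * f s) atTop (𝓝 ℓ)) (hε : 0 < ε) :
    ∃ K, 0 ≤ K ∧ ∀ s, 0 ≤ s → |f s - ℓ * s ^ p| ≤ ε * s ^ p + K := by
  obtain ⟨S, hS⟩ := eventually_atTop.1 (Metric.tendsto_nhds.1 hlim ε hε)
  have hc : ContinuousOn (fun s => f s - ℓ * s ^ p) (Icc 0 (max S 1)) :=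
    (hf.sub (continuous_const.mul (Real.continuous_rpow_const hp))).continuousOn
  obtain ⟨K, hK⟩ := isCompact_Icc.exists_bound_of_continuousOn hc
  refine ⟨max K 0, le_max_right _ _, fun s hs => ?_⟩
  have h0 : 0 ≤ s ^ p := Real.rpow_nonneg hs p
  rcases le_or_gt s (max S 1) with h | h
  · have := hK s ⟨hs, h⟩
    rw [Real.norm_eq_abs] at this
    have := le_max_left K 0
    nlinarith
  · have h1 : 0 < s := lt_of_lt_of_le one_pos ((le_max_right S 1).trans h.le)
    have h2 := hS s ((le_max_left S 1).trans h.le)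
    rw [Real.dist_eq] at h2
    have h3 : s ^ p * s ^ (-p) = 1 := by rw [← Real.rpow_add h1]; simp
    have h4 : f s - ℓ * s ^ p = s ^ p * (s ^ (-p) * f s - ℓ) := by
      linear_combination (-f s) * h3
    rw [h4, abs_mul, abs_of_nonneg h0]
    have := le_max_right K 0
    nlinarith

theorem sqrt_add_le {a b : ℝ} (ha : 0 ≤ a) (hb : 0 ≤ b) : √(a + b) ≤ √a + √b := by
  rw [Real.sqrt_le_left (by positivity)]
  nlinarith [Real.sq_sqrt ha, Real.sq_sqrt hb, mul_nonneg (Real.sqrt_nonneg a) (Real.sqrt_nonneg b)]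

set_option maxHeartbeats 1000000 in
/-- Interior bound for continuous nonnegative slicewise weak solutions. -/
theorem exists_interior_bound {p ℓ : ℝ} {f : ℝ → ℝ} (hp : 1 < p) (hℓ : 0 < ℓ) (hf : Continuous f)
    (hlim : Tendsto (fun s => s ^ (-p) * f s) atTop (𝓝 ℓ)) : ∃ C, 0 < C ∧
    ∀ (u : Plane × ℝ → ℝ) (x₀ : Plane) (t₀ r : ℝ), 0 < r → r ≤ 1 → Measurable u →
    SW u (fun P => f (u P)) (Metric.ball x₀ r) (Ioo (t₀ - r ^ 2) (t₀ + r ^ 2)) →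
    ContinuousOn u (Metric.ball x₀ r ×ˢ Ioo (t₀ - r ^ 2) (t₀ + r ^ 2)) →
    (∀ P ∈ Metric.ball x₀ r ×ˢ Ioo (t₀ - r ^ 2) (t₀ + r ^ 2), 0 ≤ u P) →
    u (x₀, t₀) ≤ C * r ^ (-(2 / (p - 1))) := by
  obtain ⟨R, ε, hR, hε, H⟩ := exists_lt_one_of_approx hp hℓ
  have hp0 : 0 ≤ p := by linarith
  set ρ := R + 1 with hρ
  have hρ0 : 0 < ρ := by linarith
  set k := 2 / (p - 1) with hk
  have hpm : 0 < p - 1 := by linarith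
  have hk0 : 0 < k := by positivity
  set q := (p - 1) / 2 with hq
  have hq0 : 0 < q := by positivity
  have hkq : k * q = 1 := by rw [hk, hq]; field_simp
  set θ : ℝ := (2 / 3) ^ q with hθ
  have hθ0 : 0 < θ := by positivity
  have hθ1 : θ < 1 := Real.rpow_lt_one (by norm_num) (by norm_num) hq0
  have hθk : θ ^ k = 2 / 3 := by
    rw [hθ, ← Real.rpow_mul (by norm_num), mul_comm, hkq, Real.rpow_one]
  obtain ⟨K, hK, hfK⟩ := exists_growth_bound hp0 hf hlim (ε := ε / (2 * (3 / 2) ^ p)) (by positivity)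
  set C₁ := max 1 (max (2 * K / ε) ((ρ / (1 - θ)) ^ k)) with hC₁
  have hC1 : 1 ≤ C₁ := le_max_left _ _
  have hC2 : 2 * K / ε ≤ C₁ := (le_max_left _ _).trans (le_max_right _ _)
  have hC3 : (ρ / (1 - θ)) ^ k ≤ C₁ := (le_max_right _ _).trans (le_max_right _ _)
  have h1θ : 0 < 1 - θ := by linarith
  refine ⟨C₁ * 2 ^ k, by positivity, fun u x₀ t₀ r hr hr1 hu h hc h0 => ?_⟩
  set d : Plane × ℝ → ℝ := fun P => r / 2 - max ‖P.1 - x₀‖ √|P.2 - t₀| with hd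
  have hdc : Continuous d := by fun_prop
  set Z : Set (Plane × ℝ) := {P | 0 ≤ d P} with hZ
  have hZsub : Z ⊆ Metric.ball x₀ r ×ˢ Ioo (t₀ - r ^ 2) (t₀ + r ^ 2) := by
    intro P hP
    have h1 : max ‖P.1 - x₀‖ √|P.2 - t₀| ≤ r / 2 := by
      have : 0 ≤ r / 2 - max ‖P.1 - x₀‖ √|P.2 - t₀| := hP
      linarith
    have h2 := (le_max_left _ _).trans h1
    have h3 := (le_max_right _ _).trans h1
    rw [Real.sqrt_le_left (by positivity), abs_le] at h3
    refine ⟨by rw [mem_ball_iff_norm]; linarith, ?_, ?_⟩ <;> nlinarith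
  have hZc : IsCompact Z := by
    refine IsCompact.of_isClosed_subset ((isCompact_closedBall x₀ r).prod
      (isCompact_Icc (a := t₀ - r ^ 2) (b := t₀ + r ^ 2)))
      (isClosed_le continuous_const hdc) (hZsub.trans ?_)
    exact prod_mono Metric.ball_subset_closedBall Ioo_subset_Icc_self
  have hd0 : d (x₀, t₀) = r / 2 := by simp [hd]
  have hZ0 : (x₀, t₀) ∈ Z := by
    change 0 ≤ d (x₀, t₀)
    rw [hd0]; positivity
  obtain ⟨P, hPZ, hPmax⟩ := hZc.exists_isMaxOn (f := fun P => u P * d P ^ k) ⟨_, hZ0⟩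
    ((hc.mono hZsub).mul (hdc.rpow_const fun _ => Or.inr hk0.le).continuousOn)
  have hP0 : u (x₀, t₀) * (r / 2) ^ k ≤ u P * d P ^ k := by
    have := hPmax hZ0
    simpa only [mem_ofPred_eq, hd0] using this
  by_cases hcase : u P * d P ^ k ≤ C₁
  · have h1 : (r / 2) ^ k * (2 ^ k * r ^ (-k)) = 1 := by
      rw [Real.div_rpow hr.le (by norm_num), Real.rpow_neg hr.le]
      have : (2 : ℝ) ^ k ≠ 0 := by positivity
      have : r ^ k ≠ 0 := by positivity
      field_simp
    calc u (x₀, t₀) = u (x₀, t₀) * (r / 2) ^ k * (2 ^ k * r ^ (-k)) := by rw [mul_assoc, h1, mul_one]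
      _ ≤ C₁ * (2 ^ k * r ^ (-k)) := by gcongr; exact hP0.trans hcase
      _ = _ := by ring
  exfalso
  rw [not_le] at hcase
  have hdP : 0 ≤ d P := hPZ
  have hdr : d P ≤ r / 2 := by
    have : 0 ≤ max ‖P.1 - x₀‖ √|P.2 - t₀| := (norm_nonneg _).trans (le_max_left _ _)
    simp only [hd]; linarith
  set M := u P with hM
  have hM0 : 0 ≤ M := h0 P (hZsub hPZ)
  have hMC : C₁ < M := by
    have : d P ^ k ≤ 1 := Real.rpow_le_one hdP (by linarith) hk0.le
    nlinarith
  have hMp : 0 < M := by linarith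
  set lam := M ^ (-q) with hlam
  have hl0 : 0 < lam := by positivity
  have hlk : lam ^ k = M⁻¹ := by
    rw [hlam, ← Real.rpow_mul hMp.le, show -q * k = -1 by linarith, Real.rpow_neg_one]
  have hld : lam * ρ ≤ (1 - θ) * d P := by
    have h1 : (lam * (ρ / (1 - θ))) ^ k ≤ d P ^ k := by
      rw [Real.mul_rpow hl0.le (by positivity), hlk, inv_mul_le_iff₀ hMp]
      linarith
    have h2 := (Real.rpow_le_rpow_iff (by positivity) hdP hk0).1 h1
    rw [← mul_div_assoc, div_le_iff₀ h1θ] at h2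
    linarith
  -- the rescaled function
  have hmap : ∀ Q ∈ Metric.closedBall (0 : Plane) ρ ×ˢ Icc (-ρ ^ 2) (ρ ^ 2),
      θ * d P ≤ d (pscale P.1 P.2 lam Q) := by
    intro Q hQ
    have h1 := mem_closedBall_zero_iff.1 hQ.1
    have h2 : √|Q.2| ≤ ρ := by
      rw [Real.sqrt_le_left hρ0.le, abs_le]
      exact hQ.2
    have h3 : ‖P.1 + lam • Q.1 - x₀‖ ≤ ‖P.1 - x₀‖ + lam * ρ := by
      calc ‖P.1 + lam • Q.1 - x₀‖ = ‖(P.1 - x₀) + lam • Q.1‖ := by congr 1; abel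
        _ ≤ ‖P.1 - x₀‖ + ‖lam • Q.1‖ := norm_add_le _ _
        _ ≤ _ := by rw [norm_smul, Real.norm_of_nonneg hl0.le]; gcongr
    have h4 : √|P.2 + lam ^ 2 * Q.2 - t₀| ≤ √|P.2 - t₀| + lam * ρ := by
      calc √|P.2 + lam ^ 2 * Q.2 - t₀| ≤ √(|P.2 - t₀| + lam ^ 2 * |Q.2|) := by
            apply Real.sqrt_le_sqrt
            calc |P.2 + lam ^ 2 * Q.2 - t₀| = |(P.2 - t₀) + lam ^ 2 * Q.2| := by congr 1; ring
              _ ≤ |P.2 - t₀| + |lam ^ 2 * Q.2| := abs_add_le _ _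
              _ = _ := by rw [abs_mul, abs_of_pos (by positivity : 0 < lam ^ 2)]
        _ ≤ √|P.2 - t₀| + √(lam ^ 2 * |Q.2|) := sqrt_add_le (abs_nonneg _) (by positivity)
        _ ≤ _ := by
            rw [Real.sqrt_mul (by positivity), Real.sqrt_sq hl0.le]
            gcongr
    have h5 : max ‖P.1 + lam • Q.1 - x₀‖ √|P.2 + lam ^ 2 * Q.2 - t₀| ≤
        max ‖P.1 - x₀‖ √|P.2 - t₀| + lam * ρ :=
      max_le (h3.trans (by gcongr; exact le_max_left _ _)) (h4.trans (by gcongr; exact le_max_right _ _))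
    simp only [hd, pscale] at hld ⊢
    linarith
  have hmapZ : ∀ Q ∈ Metric.closedBall (0 : Plane) ρ ×ˢ Icc (-ρ ^ 2) (ρ ^ 2),
      pscale P.1 P.2 lam Q ∈ Z := fun Q hQ => le_trans (by positivity) (hmap Q hQ)
  have hdP' : 0 < d P := by
    have : 0 < lam * ρ := by positivity
    by_contra hneg
    nlinarith
  have hbound : ∀ Q ∈ Metric.closedBall (0 : Plane) ρ ×ˢ Icc (-ρ ^ 2) (ρ ^ 2),
      u (pscale P.1 P.2 lam Q) ≤ 3 / 2 * M := by
    intro Q hQ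
    have h1 : u (pscale P.1 P.2 lam Q) * d (pscale P.1 P.2 lam Q) ^ k ≤ M * d P ^ k :=
      hPmax (hmapZ Q hQ)
    have h2 : (θ * d P) ^ k ≤ d (pscale P.1 P.2 lam Q) ^ k :=
      Real.rpow_le_rpow (by positivity) (hmap Q hQ) hk0.le
    rw [Real.mul_rpow hθ0.le hdP, hθk] at h2
    have h3 : 0 < d P ^ k := by positivity
    have h4 := h0 _ (hZsub (hmapZ Q hQ))
    have h5 : u (pscale P.1 P.2 lam Q) * (2 / 3 * d P ^ k) ≤ M * d P ^ k :=
      (mul_le_mul_of_nonneg_left h2 h4).trans h1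
    have h6 : (u (pscale P.1 P.2 lam Q) * (2 / 3)) * d P ^ k ≤ M * d P ^ k := by linarith
    linarith [le_of_mul_le_mul_right h6 h3]
  have hlM : M⁻¹ * lam ^ 2 = M ^ (-p) := by
    rw [hlam, ← Real.rpow_natCast, ← Real.rpow_mul hMp.le, ← Real.rpow_neg_one,
      ← Real.rpow_add hMp]
    congr 1
    rw [hq]; push_cast; ring
  have hSW : SW (fun Q => M⁻¹ * u (pscale P.1 P.2 lam Q))
      (fun Q => M⁻¹ * (lam ^ 2 * f (u (pscale P.1 P.2 lam Q)))) (Metric.closedBall 0 ρ)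
      (Icc (-ρ ^ 2) (ρ ^ 2)) := by
    refine (h.scale P.1 P.2 hl0 (fun y hy => ?_) (fun s hs => ?_)).const_mul M⁻¹
    · exact (hZsub (hmapZ (y, 0) ⟨hy, neg_nonpos.2 (sq_nonneg ρ), sq_nonneg ρ⟩)).1
    · exact (hZsub (hmapZ (0, s) ⟨by simp [hρ0.le], hs⟩)).2
  have hlt := H (fun Q => M⁻¹ * u (pscale P.1 P.2 lam Q))
    (fun Q => M⁻¹ * (lam ^ 2 * f (u (pscale P.1 P.2 lam Q)))) ((hu.comp (measurable_pscale P.1 P.2 lam)).const_mul M⁻¹)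
    (((hf.measurable.comp (hu.comp (measurable_pscale P.1 P.2 lam))).const_mul (lam ^ 2)).const_mul M⁻¹)
    hSW ?_ ?_
  · simp only [pscale, smul_zero, mul_zero, add_zero, Prod.mk.eta] at hlt
    rw [← hM, inv_mul_cancel₀ hMp.ne'] at hlt
    exact lt_irrefl _ hlt
  · refine continuousOn_const.mul (hc.comp (f := pscale P.1 P.2 lam) ?_ fun Q hQ => hZsub (hmapZ Q hQ))
    unfold pscale
    fun_prop
  · intro Q hQ
    have h1 := h0 _ (hZsub (hmapZ Q hQ))
    have h2 := hbound Q hQ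
    set w := u (pscale P.1 P.2 lam Q) with hw
    have h3 : M⁻¹ * w ≤ 3 / 2 := by rw [inv_mul_le_iff₀ hMp]; linarith
    have h3' : 0 ≤ M⁻¹ * w := by positivity
    refine ⟨h3', h3, ?_⟩
    have h4 : (M⁻¹ * w) ^ p = M ^ (-p) * w ^ p := by
      rw [Real.mul_rpow (by positivity) h1, Real.inv_rpow hMp.le, Real.rpow_neg hMp.le]
    have h5 : M⁻¹ * (lam ^ 2 * f w) - ℓ * (M⁻¹ * w) ^ p = M ^ (-p) * (f w - ℓ * w ^ p) := by
      rw [h4, ← mul_assoc, hlM]; ring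
    have hMn : 0 < M ^ (-p) := by positivity
    have h6 : (M⁻¹ * w) ^ p ≤ (3 / 2 : ℝ) ^ p := Real.rpow_le_rpow h3' h3 hp0
    have h7 : M ^ (-p) * K ≤ ε / 2 := by
      have h8 : M ^ (-p) ≤ M⁻¹ := by
        rw [← Real.rpow_neg_one]
        exact Real.rpow_le_rpow_of_exponent_le (by linarith) (by linarith)
      have h9 : K ≤ ε / 2 * M := by
        rw [div_le_iff₀ hε] at hC2
        nlinarith
      calc M ^ (-p) * K ≤ M⁻¹ * (ε / 2 * M) := by gcongr
        _ = ε / 2 := by field_simp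
    rw [h5, abs_mul, abs_of_pos hMn]
    calc M ^ (-p) * |f w - ℓ * w ^ p| ≤ M ^ (-p) * (ε / (2 * (3 / 2) ^ p) * w ^ p + K) := by
          gcongr; exact hfK w h1
      _ = ε / (2 * (3 / 2) ^ p) * (M⁻¹ * w) ^ p + M ^ (-p) * K := by rw [h4]; ring
      _ ≤ ε / (2 * (3 / 2) ^ p) * (3 / 2) ^ p + ε / 2 := by gcongr
      _ = ε := by
          have : (3 / 2 : ℝ) ^ p ≠ 0 := by positivity
          field_simp; norm_num

/-- `u` is continuous on `B × I` and solves the equation there in the slice-weak sense. -/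
def Reg (f : ℝ → ℝ) (u : Plane × ℝ → ℝ) (B : Set Plane) (I : Set ℝ) : Prop :=
  ContinuousOn u (B ×ˢ I) ∧ SW u (fun P => f (u P)) B I

theorem Reg.mono {f u B I B' I'} (h : Reg f u B I) (hB : B' ⊆ B) (hI : I' ⊆ I) : Reg f u B' I' :=
  ⟨h.1.mono (prod_mono hB hI), h.2.mono hB hI⟩

theorem Reg.exists_bound {f : ℝ → ℝ} {u : Plane × ℝ → ℝ} {B : Set Plane} {I : Set ℝ}
    (hf : Continuous f) (h : Reg f u B I) {K : Set Plane} {J : Set ℝ} (hK : IsCompact K)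
    (hJ : IsCompact J) (hKB : K ⊆ B) (hJI : J ⊆ I) :
    ∃ M, ∀ x ∈ K, ∀ t ∈ J, |u (x, t)| ≤ M ∧ |f (u (x, t))| ≤ M := by
  have hc := h.1.mono (prod_mono hKB hJI)
  obtain ⟨M₁, h₁⟩ := (hK.prod hJ).exists_bound_of_continuousOn hc
  obtain ⟨M₂, h₂⟩ := (hK.prod hJ).exists_bound_of_continuousOn (hf.comp_continuousOn hc)
  exact ⟨max M₁ M₂, fun x hx t ht => ⟨(h₁ (x, t) ⟨hx, ht⟩).trans (le_max_left _ _),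
    (h₂ (x, t) ⟨hx, ht⟩).trans (le_max_right _ _)⟩⟩

theorem Reg.continuousAt {f : ℝ → ℝ} {u : Plane × ℝ → ℝ} {B : Set Plane} {I : Set ℝ}
    (h : Reg f u B I) (hB : IsOpen B) {x : Plane} {t : ℝ} (hx : x ∈ B) (ht : t ∈ I) :
    ContinuousAt (fun y => u (y, t)) x := by
  have : ContinuousOn (fun y => u (y, t)) B :=
    h.1.comp (by fun_prop) fun y hy => ⟨hy, ht⟩
  exact this.continuousAt (hB.mem_nhds hx)

/-- Spatial and temporal monotonicity of the mass of a nonnegative function. -/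
theorem mass_mono {u : Plane × ℝ → ℝ} (hu : Measurable u) (hu0 : ∀ P, 0 ≤ u P) {K K' : Set Plane}
    (hK : IsCompact K) (hK' : IsCompact K') (hKK : K ⊆ K') {a b a' b' M : ℝ} (ha : a' ≤ a)
    (hab : a ≤ b) (hb : b ≤ b') (hM : ∀ x ∈ K', ∀ t ∈ Icc a' b', |u (x, t)| ≤ M) :
    ∫ t in a..b, ∫ x in K, u (x, t) ≤ ∫ t in a'..b', ∫ x in K', u (x, t) := by
  have e' : uIcc a' b' = Icc a' b' := uIcc_of_le (by linarith)
  have hi' := intervalIntegrable_setIntegral hu hK' (a := a') (b := b') (M := M) (by rwa [e'])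
  have hsub : uIcc a b ⊆ uIcc a' b' := by
    rw [e', uIcc_of_le hab]; exact Icc_subset_Icc ha hb
  have i := intervalIntegrable_setIntegral hu hK (a := a) (b := b) (M := M)
    fun x hx t ht => hM x (hKK hx) t (e' ▸ hsub ht)
  calc _ ≤ ∫ t in a..b, ∫ x in K', u (x, t) := by
        refine intervalIntegral.integral_mono_on hab i (hi'.mono_set hsub) fun t ht => ?_
        refine setIntegral_mono_set (integrableOn_slice hu hK' (M := M) fun x hx => hM x hx t
          ⟨ha.trans ht.1, ht.2.trans hb⟩) (ae_of_all _ fun x => hu0 _) hKK.eventuallyLE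
    _ ≤ _ := intervalIntegral.integral_mono_interval ha hab hb
        (ae_of_all _ fun t => integral_nonneg fun x => hu0 _) hi'

/-- A Harnack-type inequality inside the regular region. -/
theorem exists_harnack {p ℓ : ℝ} {f : ℝ → ℝ} (hp : 1 < p) (hℓ : 0 < ℓ) (hf : Continuous f)
    (hlim : Tendsto (fun s => s ^ (-p) * f s) atTop (𝓝 ℓ)) : ∃ C, 0 < C ∧
    ∀ (u : Plane × ℝ → ℝ) (x y : Plane) (s r : ℝ), 0 < r → r ≤ 1 → Measurable u → (∀ P, 0 ≤ u P) →
    Reg f u (Metric.ball y (10 * r)) (Ioo (s - (10 * r) ^ 2) (s + (10 * r) ^ 2)) →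
    dist x y ≤ r → u (y, s) ≤ C * (1 + u (x, s + 4 * r ^ 2)) := by
  obtain ⟨CB, hCB, HB⟩ := exists_interior_bound hp hℓ hf hlim
  obtain ⟨K, hK, hgr⟩ := exists_growth_bound (by linarith) hf hlim hℓ
  have hlow : ∀ v, 0 ≤ v → -K ≤ f v := fun v hv => by
    have := neg_le_of_abs_le (hgr v hv)
    linarith
  set lam := 2 * ℓ * CB ^ (p - 1) with hlam
  have hlam0 : 0 ≤ lam := by positivity
  obtain ⟨CM, hCM, HM⟩ := exists_mean_value_bound_scaled hlam0
  obtain ⟨CL, hCL, HL⟩ := exists_mass_bound_scaled (N := 8) (by norm_num)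
  refine ⟨CM * (K + CL * (1 + K)), by positivity, fun u x y s r hr hr1 hu hu0 h hxy => ?_⟩
  have hr2 : 0 < r ^ 2 := by positivity
  obtain ⟨M, hM⟩ := h.exists_bound hf (isCompact_closedBall y (9 * r))
    (isCompact_Icc (a := s - 4 * r ^ 2) (b := s + 4 * r ^ 2))
    (Metric.closedBall_subset_ball (by linarith)) (Icc_subset_Ioo (by linarith) (by linarith))
  have hfu : Measurable fun P => f (u P) := hf.measurable.comp hu
  have hxy8 : Metric.closedBall x (8 * r) ⊆ Metric.closedBall y (9 * r) :=
    Metric.closedBall_subset_closedBall' (by linarith)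
  have hy9 : Metric.closedBall y (9 * r) ⊆ Metric.ball y (10 * r) :=
    Metric.closedBall_subset_ball (by linarith)
  have e8 : s + 4 * r ^ 2 - 8 * r ^ 2 = s - 4 * r ^ 2 := by ring
  have L := HL u (fun P => f (u P)) K M x (s + 4 * r ^ 2) r hr hK hu hfu
    (h.2.mono (hxy8.trans hy9) (Icc_subset_Ioo (by linarith) (by linarith)))
    (fun z hz t ht => by
      rw [e8] at ht
      obtain ⟨m1, m2⟩ := hM z (hxy8 hz) t ht
      exact ⟨hu0 _, m1, m2, hlow _ (hu0 _)⟩)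
    (h.continuousAt Metric.isOpen_ball (Metric.mem_ball.2 (by linarith)) ⟨by linarith, by linarith⟩)
  rw [e8] at L
  have hhalf : Metric.closedBall y (r / 2) ⊆ Metric.closedBall y (9 * r) :=
    Metric.closedBall_subset_closedBall (by linarith)
  have N := HM u (fun P => f (u P)) K M y s r hr hK hu hfu
    (h.2.mono (hhalf.trans hy9) (Icc_subset_Ioo (by linarith) (by linarith)))
    (fun z hz t ht => by
      obtain ⟨m1, m2⟩ := hM z (hhalf hz) t ⟨by linarith [ht.1], by linarith [ht.2]⟩
      refine ⟨hu0 _, m1, m2, ?_⟩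
      have hreg : Reg f u (Metric.ball z r) (Ioo (t - r ^ 2) (t + r ^ 2)) := by
        refine h.mono (Metric.ball_subset_ball' ?_) (Ioo_subset_Ioo ?_ ?_)
        · rw [Metric.mem_closedBall] at hz; linarith
        · linarith [ht.1]
        · linarith [ht.2]
      have hub := HB u z t r hr hr1 hu hreg.2 hreg.1 fun P _ => hu0 P
      set v := u (z, t) with hv
      have hv0 : 0 ≤ v := hu0 _
      have h1 : v ^ (p - 1) ≤ CB ^ (p - 1) * (r ^ 2)⁻¹ := by
        calc v ^ (p - 1) ≤ (CB * r ^ (-(2 / (p - 1)))) ^ (p - 1) :=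
              Real.rpow_le_rpow hv0 hub (by linarith)
          _ = _ := by
              rw [Real.mul_rpow hCB.le (Real.rpow_nonneg hr.le _), ← Real.rpow_mul hr.le,
                neg_mul, div_mul_cancel₀ _ (by linarith), Real.rpow_neg hr.le, Real.rpow_two]
      have h2 : v ^ p = v * v ^ (p - 1) := by
        rcases hv0.eq_or_lt with h | h
        · rw [← h, zero_mul, Real.zero_rpow (by linarith)]
        · rw [← Real.rpow_one_add' hv0 (by linarith)]; ring_nf
      have h3 : f v ≤ 2 * ℓ * v ^ p + K := by
        have := le_of_abs_le (hgr v hv0); linarith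
      have h4 : r ^ 2 * v ^ p ≤ CB ^ (p - 1) * v := by
        calc r ^ 2 * v ^ p ≤ r ^ 2 * (v * (CB ^ (p - 1) * (r ^ 2)⁻¹)) := by rw [h2]; gcongr
          _ = _ := by field_simp
      have h5 : r ^ 2 ≤ 1 := by nlinarith
      calc r ^ 2 * f v ≤ r ^ 2 * (2 * ℓ * v ^ p + K) := by gcongr
        _ = 2 * ℓ * (r ^ 2 * v ^ p) + r ^ 2 * K := by ring
        _ ≤ 2 * ℓ * (CB ^ (p - 1) * v) + 1 * K := by gcongr
        _ = K + lam * v := by rw [hlam]; ring)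
    (h.continuousAt Metric.isOpen_ball (Metric.mem_ball_self (by linarith))
      ⟨by linarith, by linarith⟩)
  have mm := mass_mono hu hu0 (isCompact_closedBall y (r / 2)) (isCompact_closedBall x (6 * r))
    (Metric.closedBall_subset_closedBall' (by rw [dist_comm]; linarith)) (a := s - r ^ 2 / 2) (b := s)
    (a' := s - 4 * r ^ 2) (b' := s + 4 * r ^ 2 - r ^ 2 / 8) (by linarith) (by linarith) (by linarith)
    (M := M) fun z hz t ht => (hM z (Metric.closedBall_subset_closedBall' (by linarith) hz) t
      ⟨ht.1, by linarith [ht.2]⟩).1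
  set w := u (x, s + 4 * r ^ 2) with hw
  have hw0 : 0 ≤ w := hu0 _
  have hr21 : r ^ 2 ≤ 1 := by nlinarith
  refine N.trans ?_
  calc _ ≤ CM * (K + (r ^ 4)⁻¹ * (CL * r ^ 4 * (w + K * r ^ 2))) := by
        gcongr; exact mm.trans L
    _ = CM * (K + CL * (w + K * r ^ 2)) := by field_simp
    _ ≤ CM * (K + CL * (w + K * 1)) := by gcongr
    _ ≤ _ := by
        rw [mul_assoc]
        gcongr
        nlinarith [mul_nonneg hK hw0, mul_nonneg (mul_nonneg hK hw0) hCL.le, mul_nonneg hCL.le hw0]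

/-- A mass bound forces a small value somewhere. -/
theorem exists_le_of_mass_le {u : Plane × ℝ → ℝ} (hu : Measurable u) {y : Plane} {R a b lam M : ℝ}
    (hab : a ≤ b) (hR : 0 < R) (hM : ∀ x ∈ Metric.closedBall y R, ∀ t ∈ Icc a b, |u (x, t)| ≤ M)
    (h : ∫ t in a..b, ∫ x in Metric.closedBall y R, u (x, t) < lam * (Real.pi * R ^ 2) * (b - a)) :
    ∃ x ∈ Metric.closedBall y R, ∃ t ∈ Icc a b, u (x, t) ≤ lam := by
  by_contra! hcon
  refine absurd h (not_lt.2 ?_)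
  have hK := isCompact_closedBall y R
  have hvol : volume.real (Metric.closedBall y R) = Real.pi * R ^ 2 := by
    rw [Measure.real, EuclideanSpace.volume_closedBall_fin_two, ENNReal.toReal_mul,
      ENNReal.toReal_pow, ENNReal.toReal_ofReal hR.le]
    simp [mul_comm, Real.pi_pos.le]
  have i := intervalIntegrable_setIntegral hu hK (a := a) (b := b) (M := M) (by rwa [uIcc_of_le hab])
  calc lam * (Real.pi * R ^ 2) * (b - a) = ∫ t in a..b, lam * (Real.pi * R ^ 2) := by
        rw [intervalIntegral.integral_const, smul_eq_mul, mul_comm]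
    _ ≤ _ := by
        refine intervalIntegral.integral_mono_on hab intervalIntegrable_const i fun t ht => ?_
        have : ∫ x in Metric.closedBall y R, lam = lam * (Real.pi * R ^ 2) := by
          rw [setIntegral_const, hvol, smul_eq_mul, mul_comm]
        rw [← this]
        refine setIntegral_mono_on ?_ (integrableOn_slice hu hK (M := M) fun x hx => hM x hx t ht)
          hK.measurableSet fun x hx => (hcon x hx t ht).le
        exact integrableOn_const hK.measure_lt_top.ne

set_option maxHeartbeats 1000000 in
/-- Local boundedness near a portion `S` of the irregular set on which horizontal and vertical
bounds are available. -/
theorem exists_local_bound {p ℓ : ℝ} {f : ℝ → ℝ} (hp : 1 < p) (hℓ : 0 < ℓ) (hf : Continuous f)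
    (hlim : Tendsto (fun s => s ^ (-p) * f s) atTop (𝓝 ℓ)) {u : Plane × ℝ → ℝ} (hu : Measurable u)
    (hu0 : ∀ P, 0 ≤ u P) {S : Set (Plane × ℝ)} (hS : IsCompact S) {x₀ : Plane} {t₀ ρ m : ℝ}
    (hρ : 0 < ρ) (hρ1 : ρ ≤ 1) (h0 : (x₀, t₀) ∈ S) (hm : 0 ≤ m)
    (hreg : ∀ x r a b, Metric.ball x r ⊆ Metric.ball x₀ ρ → Ioo a b ⊆ Ioo (t₀ - ρ ^ 2) (t₀ + ρ ^ 2) →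
      Disjoint (Metric.ball x r ×ˢ Ioo a b) S → Reg f u (Metric.ball x r) (Ioo a b))
    (hhor : ∀ P ∈ S, ∀ y ∈ Metric.ball x₀ ρ, u (y, P.2) ≤ m)
    (hver : ∀ P ∈ S, ∀ t ∈ Ioo (t₀ - ρ ^ 2) (t₀ + ρ ^ 2), u (P.1, t) ≤ m) :
    ∃ M, ∀ y ∈ Metric.closedBall x₀ (ρ / 8), ∀ s ∈ Icc (t₀ - (ρ / 8) ^ 2) (t₀ + (ρ / 8) ^ 2),
      u (y, s) ≤ M := by
  obtain ⟨CH, hCH, HH⟩ := exists_harnack hp hℓ hf hlim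
  obtain ⟨K, hK, hgr⟩ := exists_growth_bound (by linarith) hf hlim hℓ
  have hlow : ∀ v, 0 ≤ v → -K ≤ f v := fun v hv => by
    have := neg_le_of_abs_le (hgr v hv)
    have : 0 ≤ ℓ * v ^ p := by positivity
    linarith
  obtain ⟨CL, hCL, HL⟩ := exists_mass_bound_scaled (N := 1) le_rfl
  set lam := 10000 * (CL * (m + K)) + 1 with hlamdef
  have hlam : 0 ≤ lam := by positivity
  refine ⟨max m (max (CH * (1 + m)) (CH * (1 + lam))), fun y hy s hs => ?_⟩
  have hyρ : dist y x₀ ≤ ρ / 8 := hy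
  by_cases hsT : ∃ P ∈ S, P.2 = s
  · obtain ⟨P, hP, rfl⟩ := hsT
    exact (hhor P hP y (Metric.mem_ball.2 (by linarith))).trans (le_max_left _ _)
  push Not at hsT
  obtain ⟨⟨z, τ⟩, hzS, hmin⟩ := hS.exists_isMinOn ⟨_, h0⟩
    (f := fun P : Plane × ℝ => max (dist P.1 y) (√|P.2 - s|)) (by fun_prop)
  replace hmin : ∀ P ∈ S, max (dist z y) (√|τ - s|) ≤ max (dist P.1 y) (√|P.2 - s|) :=
    fun P hP => isMinOn_iff.1 hmin P hP
  set d := max (dist z y) (√|τ - s|) with hd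
  have hd0 : 0 < d := lt_max_of_lt_right (Real.sqrt_pos.2 (abs_pos.2 (sub_ne_zero.2 (hsT _ hzS))))
  have hdρ : d ≤ ρ / 8 := by
    refine (hmin _ h0).trans (max_le (by rwa [dist_comm]) ?_)
    rw [Real.sqrt_le_left (by positivity), abs_le]
    constructor <;> linarith [hs.1, hs.2]
  have hd2 : d ^ 2 ≤ (ρ / 8) ^ 2 := by gcongr
  have hd2p : 0 < d ^ 2 := by positivity
  have hQ : Reg f u (Metric.ball y d) (Ioo (s - d ^ 2) (s + d ^ 2)) := by
    refine hreg y d _ _ (Metric.ball_subset_ball' (by linarith)) (Ioo_subset_Ioo ?_ ?_) ?_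
    · nlinarith [hs.1]
    · nlinarith [hs.2]
    · rw [Set.disjoint_left]
      rintro ⟨x, t⟩ ⟨hx, ht⟩ hxS
      have hle := hmin (x, t) hxS
      refine absurd hle (not_le.2 ?_)
      refine max_lt (Metric.mem_ball.1 hx) ?_
      replace ht : t ∈ Ioo (s - d ^ 2) (s + d ^ 2) := ht
      rw [Real.sqrt_lt' hd0, abs_lt]
      constructor <;> linarith [ht.1, ht.2]
  have hQr : ∀ r, 0 < r → 10 * r ≤ d →
      Reg f u (Metric.ball y (10 * r)) (Ioo (s - (10 * r) ^ 2) (s + (10 * r) ^ 2)) := fun r hr h => by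
    have : (10 * r) ^ 2 ≤ d ^ 2 := by gcongr
    exact hQ.mono (Metric.ball_subset_ball h) (Ioo_subset_Ioo (by linarith) (by linarith))
  by_cases hb : ∃ P ∈ S, P.2 ∈ Ioo s (s + d ^ 2 / 25)
  · obtain ⟨P, hP, hb1, hb2⟩ := hb
    set r := √(P.2 - s) / 2 with hr
    have hsq : √(P.2 - s) ^ 2 = P.2 - s := Real.sq_sqrt (by linarith)
    have hrp : 0 < r := by have := Real.sqrt_pos.2 (sub_pos.2 hb1); positivity
    have hrd : 10 * r ≤ d := by
      have : √(P.2 - s) ≤ d / 5 := by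
        rw [Real.sqrt_le_left (by positivity)]
        nlinarith
      linarith
    have := HH u y y s r hrp (by linarith) hu hu0 (hQr r hrp hrd) (by simp [hrp.le])
    rw [show s + 4 * r ^ 2 = P.2 by rw [hr, div_pow, hsq]; ring] at this
    refine this.trans (le_trans ?_ ((le_max_left _ _).trans (le_max_right _ _)))
    gcongr
    exact hhor P hP y (Metric.mem_ball.2 (by linarith))
  push Not at hb
  have hzy : dist z y ≤ d := le_max_left _ _
  have hzx : dist z x₀ ≤ 2 * (ρ / 8) := (dist_triangle z y x₀).trans (by linarith)
  set a := s + 29 / 10000 * d ^ 2 with ha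
  set e := s + 39 / 1000 * d ^ 2 with he
  have hR : Reg f u (Metric.ball z (16 / 10 * d)) (Ioo s (s + d ^ 2 / 25)) := by
    refine hreg _ _ _ _ (Metric.ball_subset_ball' (by linarith)) (Ioo_subset_Ioo ?_ ?_) ?_
    · nlinarith [hs.1]
    · nlinarith [hs.2]
    · rw [Set.disjoint_left]
      exact fun P hP hPS => hb P hPS hP.2
  set r := 19 / 100 * d with hr
  have hrp : 0 < r := by positivity
  have hae : e - 1 * r ^ 2 = a := by rw [he, ha, hr]; ring
  have hball : Metric.closedBall z (8 * r) ⊆ Metric.ball z (16 / 10 * d) :=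
    Metric.closedBall_subset_ball (by linarith)
  have hIcc : Icc a e ⊆ Ioo s (s + d ^ 2 / 25) := Icc_subset_Ioo (by linarith) (by linarith)
  obtain ⟨M, hM⟩ := hR.exists_bound hf (isCompact_closedBall z (8 * r)) (isCompact_Icc (a := a) (b := e))
    hball hIcc
  have L := HL u (fun P => f (u P)) K M z e r hrp hK hu (hf.measurable.comp hu)
    (hR.2.mono hball (hae ▸ hIcc))
    (fun x hx t ht => by
      rw [hae] at ht
      exact ⟨hu0 _, (hM x hx t ht).1, (hM x hx t ht).2, hlow _ (hu0 _)⟩)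
    (hR.continuousAt Metric.isOpen_ball (Metric.mem_ball_self (by linarith)) (hIcc ⟨by linarith, le_rfl⟩))
  rw [hae] at L
  have hue : u (z, e) ≤ m := hver _ hzS e ⟨by nlinarith [hs.1], by nlinarith [hs.2]⟩
  have hr1 : r ^ 2 ≤ 1 := by nlinarith
  have mm := mass_mono hu hu0 (isCompact_closedBall y (d / 20)) (isCompact_closedBall z (6 * r))
    (Metric.closedBall_subset_closedBall' (by rw [dist_comm]; linarith))
    (a := s + d ^ 2 / 100) (b := s + 3 * d ^ 2 / 100)
    (a' := a) (b' := e - r ^ 2 / 8) (by linarith) (by linarith) (by rw [he, hr]; nlinarith)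
    (M := M) fun x hx t ht => (hM x (Metric.closedBall_subset_closedBall (by linarith) hx) t
      ⟨ht.1, by linarith [ht.2, sq_nonneg r]⟩).1
  obtain ⟨x, hx, t, ht, hux⟩ := exists_le_of_mass_le hu (y := y) (R := d / 20)
    (a := s + d ^ 2 / 100) (b := s + 3 * d ^ 2 / 100) (lam := lam) (M := M) (by linarith) (by positivity)
    (fun x hx t ht => by
      refine (hM x (Metric.closedBall_subset_closedBall' ?_ hx) t ⟨?_, ?_⟩).1
      · rw [dist_comm]; linarith
      · linarith [ht.1]
      · linarith [ht.2])
    (by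
      refine (mm.trans L).trans_lt ?_
      calc CL * r ^ 4 * (u (z, e) + K * r ^ 2) ≤ CL * r ^ 4 * (m + K * 1) := by gcongr
        _ = (CL * (m + K)) * ((19 / 100) ^ 4 * d ^ 4) := by rw [hr]; ring
        _ ≤ (CL * (m + K)) * (1 / 2 * d ^ 4) := by gcongr; norm_num
        _ = 10000 * (CL * (m + K)) * (d ^ 4 / 20000) := by ring
        _ < lam * (d ^ 4 / 20000) := by gcongr; linarith
        _ ≤ lam * (Real.pi * (d ^ 4 / 20000)) := by
            gcongr
            exact le_mul_of_one_le_left (by positivity) (by linarith [Real.pi_gt_three])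
        _ = _ := by ring)
  set r' := √(t - s) / 2 with hr'
  have hts : d ^ 2 / 100 ≤ t - s := by linarith [ht.1]
  have hsq : √(t - s) ^ 2 = t - s := Real.sq_sqrt (by linarith)
  have h1 : d / 10 ≤ √(t - s) := Real.le_sqrt_of_sq_le (by linarith)
  have h2 : √(t - s) ≤ d / 5 := by
    rw [Real.sqrt_le_left (by positivity)]
    linarith [ht.2]
  have hfin := HH u x y s r' (by linarith) (by linarith) hu hu0 (hQr r' (by linarith) (by linarith))
    (by rw [Metric.mem_closedBall] at hx; linarith)
  rw [show s + 4 * r' ^ 2 = t by rw [hr', div_pow, hsq]; ring] at hfin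
  refine hfin.trans (le_trans ?_ ((le_max_right _ _).trans (le_max_right _ _)))
  gcongr

/-- Admissible test functions for `SW` on the time interval `[t₁, t₂]`. -/
structure IsTest (ψ : Plane × ℝ → ℝ) (K : Set Plane) (t₁ t₂ : ℝ) : Prop where
  isCompact : IsCompact K
  eq_zero : ∀ x ∉ K, ∀ t, ψ (x, t) = 0
  smooth : ∀ x, ∀ t ∈ Icc t₁ t₂, ContDiffAt ℝ 2 ψ (x, t)

namespace IsTest

variable {ψ : Plane × ℝ → ℝ} {K : Set Plane} {t₁ t₂ : ℝ}

theorem eq_zero' (h : IsTest ψ K t₁ t₂) : ∀ P ∉ K ×ˢ (univ : Set ℝ), ψ P = 0 :=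
  fun P hP => h.eq_zero P.1 (fun hx => hP ⟨hx, trivial⟩) P.2

theorem isClosed_prod (h : IsTest ψ K t₁ t₂) : IsClosed (K ×ˢ (univ : Set ℝ)) :=
  h.isCompact.isClosed.prod isClosed_univ

theorem op_eq_zero (h : IsTest ψ K t₁ t₂) (x : Plane) (hx : x ∉ K) (t : ℝ) :
    dd et ψ (x, t) + Lx ψ (x, t) = 0 := by
  rw [dd_eq_zero_of_notMem h.isClosed_prod h.eq_zero' _ fun h => hx h.1,
    Lx_eq_zero_of_notMem h.isClosed_prod h.eq_zero' _ fun h => hx h.1, add_zero]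

theorem continuousOn (h : IsTest ψ K t₁ t₂) : ContinuousOn ψ (univ ×ˢ Icc t₁ t₂) :=
  fun P hP => (h.smooth P.1 P.2 hP.2).continuousAt.continuousWithinAt

theorem continuousOn_op (h : IsTest ψ K t₁ t₂) :
    ContinuousOn (fun P => dd et ψ P + Lx ψ P) (univ ×ˢ Icc t₁ t₂) := fun P hP =>
  ((contDiffAt_dd (m := 1) (h.smooth P.1 P.2 hP.2) (by norm_num)).continuousAt.add
    (contDiffAt_Lx (h.smooth P.1 P.2 hP.2))).continuousWithinAt

theorem mono (h : IsTest ψ K t₁ t₂) {s₁ s₂ : ℝ} (hs : Icc s₁ s₂ ⊆ Icc t₁ t₂) : IsTest ψ K s₁ s₂ :=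
  ⟨h.isCompact, h.eq_zero, fun x t ht => h.smooth x t (hs ht)⟩

end IsTest

section Strip

variable {u w : Plane × ℝ → ℝ} {K : Set Plane} {t₁ t₂ M : ℝ}

theorem strip_exists (hu : Measurable u) (hK : IsCompact K)
    (hM : ∀ x ∈ K, ∀ t ∈ Icc t₁ t₂, |u (x, t)| ≤ M) (hw : ContinuousOn w (univ ×ˢ Icc t₁ t₂))
    (h0 : ∀ x ∉ K, ∀ t, w (x, t) = 0) :
    ∃ (F : Plane × ℝ → ℝ) (C : ℝ), Measurable F ∧ (∀ x ∉ K, ∀ t, F (x, t) = 0) ∧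
      (∀ x, ∀ t ∈ Icc t₁ t₂, |F (x, t)| ≤ C) ∧
      ∀ t ∈ Icc t₁ t₂, ∀ x, F (x, t) = u (x, t) * w (x, t) := by
  obtain ⟨Cw, hCw⟩ := (hK.prod (isCompact_Icc (a := t₁) (b := t₂))).exists_bound_of_continuousOn
    (hw.mono (prod_mono (subset_univ _) le_rfl))
  have hms : MeasurableSet ((univ : Set Plane) ×ˢ Icc t₁ t₂) := MeasurableSet.univ.prod measurableSet_Icc
  have hmw : Measurable (((univ : Set Plane) ×ˢ Icc t₁ t₂).piecewise w fun _ => 0) :=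
    hw.measurable_piecewise continuousOn_const hms
  refine ⟨fun P => u P * ((univ : Set Plane) ×ˢ Icc t₁ t₂).piecewise w (fun _ => 0) P, |M| * |Cw|,
    hu.mul hmw, fun x hx t => ?_, fun x t ht => ?_, fun t ht x => ?_⟩
  · by_cases h : (x, t) ∈ (univ : Set Plane) ×ˢ Icc t₁ t₂
    · simp only [piecewise_eq_of_mem _ _ _ h, h0 x hx t, mul_zero]
    · simp only [piecewise_eq_of_notMem _ _ _ h, mul_zero]
  · have h : (x, t) ∈ (univ : Set Plane) ×ˢ Icc t₁ t₂ := ⟨trivial, ht⟩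
    simp only [piecewise_eq_of_mem _ _ _ h, abs_mul]
    by_cases hx : x ∈ K
    · have h1 := (hM x hx t ht).trans (le_abs_self _)
      have h2 : |w (x, t)| ≤ |Cw| := (hCw (x, t) ⟨hx, ht⟩).trans (le_abs_self _)
      gcongr
    · rw [h0 x hx t, abs_zero, mul_zero]; positivity
  · have h : (x, t) ∈ (univ : Set Plane) ×ˢ Icc t₁ t₂ := ⟨trivial, ht⟩
    simp only [piecewise_eq_of_mem _ _ _ h]

theorem strip_integrable (hu : Measurable u) (hK : IsCompact K)
    (hM : ∀ x ∈ K, ∀ t ∈ Icc t₁ t₂, |u (x, t)| ≤ M) (hw : ContinuousOn w (univ ×ˢ Icc t₁ t₂))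
    (h0 : ∀ x ∉ K, ∀ t, w (x, t) = 0) {t : ℝ} (ht : t ∈ Icc t₁ t₂) :
    Integrable fun x => u (x, t) * w (x, t) := by
  obtain ⟨F, C, hF, hF0, hFC, hFe⟩ := strip_exists hu hK hM hw h0
  simp_rw [← hFe t ht]
  exact integrable_slice hF hK (fun x hx => hF0 x hx t) fun x _ => hFC x t ht

theorem strip_intervalIntegrable (hu : Measurable u) (hK : IsCompact K) (h12 : t₁ ≤ t₂)
    (hM : ∀ x ∈ K, ∀ t ∈ Icc t₁ t₂, |u (x, t)| ≤ M) (hw : ContinuousOn w (univ ×ˢ Icc t₁ t₂))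
    (h0 : ∀ x ∉ K, ∀ t, w (x, t) = 0) :
    IntervalIntegrable (fun t => ∫ x, u (x, t) * w (x, t)) volume t₁ t₂ := by
  obtain ⟨F, C, hF, hF0, hFC, hFe⟩ := strip_exists hu hK hM hw h0
  have := intervalIntegrable_slice hF hK (a := t₁) (b := t₂) (C := C) hF0 fun x _ t ht =>
    hFC x t (by rwa [uIcc_of_le h12] at ht)
  refine this.congr fun t ht => ?_
  rw [uIoc_of_le h12] at ht
  exact integral_congr_ae (ae_of_all _ fun x => hFe t ⟨ht.1.le, ht.2⟩ x)

theorem strip_continuousOn (hu : Measurable u) (hK : IsCompact K)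
    (hM : ∀ x ∈ K, ∀ t ∈ Icc t₁ t₂, |u (x, t)| ≤ M)
    (hc : ∀ x ∈ K, ContinuousOn (fun t => u (x, t)) (Icc t₁ t₂))
    (hw : ContinuousOn w (univ ×ˢ Icc t₁ t₂)) (h0 : ∀ x ∉ K, ∀ t, w (x, t) = 0) :
    ContinuousOn (fun t => ∫ x, u (x, t) * w (x, t)) (Icc t₁ t₂) := by
  obtain ⟨F, C, hF, hF0, hFC, hFe⟩ := strip_exists hu hK hM hw h0
  refine continuousOn_of_dominated (bound := K.indicator fun _ => C)
    (fun t ht => (strip_integrable hu hK hM hw h0 ht).aestronglyMeasurable)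
    (fun t ht => ae_of_all _ fun x => ?_) ?_ (ae_of_all _ fun x => ?_)
  · rw [← hFe t ht]
    by_cases hx : x ∈ K
    · rw [indicator_of_mem hx]; exact hFC x t ht
    · rw [indicator_of_notMem hx, hF0 x hx, norm_zero]
  · exact (integrableOn_const hK.measure_lt_top.ne).integrable_indicator hK.measurableSet
  · by_cases hx : x ∈ K
    · exact (hc x hx).mul (hw.comp (by fun_prop) fun t ht => ⟨trivial, ht⟩)
    · simp only [h0 x hx, mul_zero]
      exact continuousOn_const

end Strip

section Tested

variable {u g ψ : Plane × ℝ → ℝ} {K : Set Plane} {t₁ t₂ M : ℝ}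

/-- The density in time of the tested equation. -/
noncomputable def tdens (u g ψ : Plane × ℝ → ℝ) (t : ℝ) : ℝ :=
  ∫ x, (u (x, t) * (dd et ψ (x, t) + Lx ψ (x, t)) + g (x, t) * ψ (x, t))

theorem IsTest.integrable_tdens (h : IsTest ψ K t₁ t₂) (hu : Measurable u) (hg : Measurable g)
    (hM : ∀ x ∈ K, ∀ t ∈ Icc t₁ t₂, |u (x, t)| ≤ M ∧ |g (x, t)| ≤ M) {t : ℝ} (ht : t ∈ Icc t₁ t₂) :
    Integrable fun x => u (x, t) * (dd et ψ (x, t) + Lx ψ (x, t)) + g (x, t) * ψ (x, t) :=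
  (strip_integrable hu h.isCompact (fun x hx t ht => (hM x hx t ht).1) h.continuousOn_op
    h.op_eq_zero ht).add (strip_integrable hg h.isCompact (fun x hx t ht => (hM x hx t ht).2)
    h.continuousOn h.eq_zero ht)

theorem IsTest.tdens_eq (h : IsTest ψ K t₁ t₂) (hu : Measurable u) (hg : Measurable g)
    (hM : ∀ x ∈ K, ∀ t ∈ Icc t₁ t₂, |u (x, t)| ≤ M ∧ |g (x, t)| ≤ M) {t : ℝ} (ht : t ∈ Icc t₁ t₂) :
    tdens u g ψ t = (∫ x, u (x, t) * (dd et ψ (x, t) + Lx ψ (x, t))) + ∫ x, g (x, t) * ψ (x, t) :=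
  integral_add (strip_integrable hu h.isCompact (fun x hx t ht => (hM x hx t ht).1)
    h.continuousOn_op h.op_eq_zero ht) (strip_integrable hg h.isCompact
    (fun x hx t ht => (hM x hx t ht).2) h.continuousOn h.eq_zero ht)

theorem IsTest.intervalIntegrable_tdens (h : IsTest ψ K t₁ t₂) (h12 : t₁ ≤ t₂) (hu : Measurable u)
    (hg : Measurable g) (hM : ∀ x ∈ K, ∀ t ∈ Icc t₁ t₂, |u (x, t)| ≤ M ∧ |g (x, t)| ≤ M) :
    IntervalIntegrable (tdens u g ψ) volume t₁ t₂ := by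
  refine ((strip_intervalIntegrable hu h.isCompact h12 (fun x hx t ht => (hM x hx t ht).1)
    h.continuousOn_op h.op_eq_zero).add (strip_intervalIntegrable hg h.isCompact h12
    (fun x hx t ht => (hM x hx t ht).2) h.continuousOn h.eq_zero)).congr fun t ht => ?_
  rw [uIoc_of_le h12] at ht
  exact (h.tdens_eq hu hg hM ⟨ht.1.le, ht.2⟩).symm

theorem IsTest.continuousOn_tdens (h : IsTest ψ K t₁ t₂) (hu : Measurable u)
    (hg : Measurable g) (hM : ∀ x ∈ K, ∀ t ∈ Icc t₁ t₂, |u (x, t)| ≤ M ∧ |g (x, t)| ≤ M)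
    (hc : ∀ x ∈ K, ContinuousOn (fun t => u (x, t)) (Icc t₁ t₂) ∧
      ContinuousOn (fun t => g (x, t)) (Icc t₁ t₂)) :
    ContinuousOn (tdens u g ψ) (Icc t₁ t₂) :=
  ((strip_continuousOn hu h.isCompact (fun x hx t ht => (hM x hx t ht).1) (fun x hx => (hc x hx).1)
    h.continuousOn_op h.op_eq_zero).add (strip_continuousOn hg h.isCompact
    (fun x hx t ht => (hM x hx t ht).2) (fun x hx => (hc x hx).2) h.continuousOn h.eq_zero)).congr
    fun _ ht => h.tdens_eq hu hg hM ht

end Tested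

theorem SW.apply {u g ψ : Plane × ℝ → ℝ} {B K : Set Plane} {I : Set ℝ} {t₁ t₂ : ℝ} (h : SW u g B I)
    (hψ : IsTest ψ K t₁ t₂) (hK : K ⊆ B) (h₁ : t₁ ∈ I) (h₂ : t₂ ∈ I) (h12 : t₁ ≤ t₂) :
    (∫ x, u (x, t₂) * ψ (x, t₂)) - (∫ x, u (x, t₁) * ψ (x, t₁)) = ∫ t in t₁..t₂, tdens u g ψ t :=
  h ψ K hψ.isCompact hK hψ.eq_zero t₁ h₁ t₂ h₂ h12 hψ.smooth

/-- Smooth cutoff between two open sets covering a compact set. -/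
theorem exists_cutoff_pair {K U₁ U₂ : Set Plane} (hK : IsCompact K) (h₁ : IsOpen U₁) (h₂ : IsOpen U₂)
    (hKU : K ⊆ U₁ ∪ U₂) : ∃ (χ : Plane → ℝ) (K₁ K₂ : Set Plane), ContDiff ℝ 2 χ ∧
      IsCompact K₁ ∧ IsCompact K₂ ∧ K₁ ⊆ U₁ ∧ K₂ ⊆ U₂ ∧ K₁ ⊆ K ∧ K₂ ⊆ K ∧
      (∀ x ∈ K, x ∉ K₁ → χ x = 0) ∧ ∀ x ∈ K, x ∉ K₂ → χ x = 1 := by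
  have hc : IsCompact (K \ U₂) := hK.diff h₂
  have hs : K \ U₂ ⊆ U₁ := fun x hx => (hKU hx.1).resolve_right hx.2
  obtain ⟨V, hV, hKV, hVU, hVc⟩ := exists_open_between_and_isCompact_closure hc h₁ hs
  obtain ⟨W, hW, hKW, hWV, -⟩ := exists_open_between_and_isCompact_closure hc hV hKV
  obtain ⟨χ, h0, h1, -⟩ := exists_contMDiffMap_zero_one_of_isClosed (n := 2)
    (modelWithCornersSelf ℝ Plane) hV.isClosed_compl isClosed_closure
    (disjoint_compl_left_iff_subset.2 hWV)
  refine ⟨χ, K ∩ closure V, K \ W, χ.contMDiff.contDiff, hK.inter hVc, hK.diff hW,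
    inter_subset_right.trans hVU, fun x hx => ?_, inter_subset_left, sdiff_subset,
    fun x hx hn => ?_, fun x hx hn => ?_⟩
  · by_contra h
    exact hx.2 (hKW ⟨hx.1, h⟩)
  · exact h0 fun hxV => hn ⟨hx, subset_closure hxV⟩
  · refine h1 (subset_closure ?_)
    by_contra h
    exact hn ⟨hx, h⟩

theorem SW.union {u g : Plane × ℝ → ℝ} {U₁ U₂ : Set Plane} {I : Set ℝ} (h₁ : SW u g U₁ I)
    (h₂ : SW u g U₂ I) (hU₁ : IsOpen U₁) (hU₂ : IsOpen U₂) (hu : Measurable u) (hg : Measurable g)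
    (hb : ∀ K, IsCompact K → K ⊆ U₁ ∪ U₂ → ∀ t₁ ∈ I, ∀ t₂ ∈ I,
      ∃ M, ∀ x ∈ K, ∀ t ∈ Icc t₁ t₂, |u (x, t)| ≤ M ∧ |g (x, t)| ≤ M) :
    SW u g (U₁ ∪ U₂) I := by
  intro ψ K hK hKU h0 t₁ ht₁ t₂ ht₂ h12 hψ
  have hT : IsTest ψ K t₁ t₂ := ⟨hK, h0, hψ⟩
  obtain ⟨M, hM⟩ := hb K hK hKU t₁ ht₁ t₂ ht₂
  obtain ⟨χ, K₁, K₂, hχ, hK₁, hK₂, hKU₁, hKU₂, hK₁K, hK₂K, e₁, e₂⟩ :=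
    exists_cutoff_pair hK hU₁ hU₂ hKU
  have hχ' : ∀ P : Plane × ℝ, ContDiffAt ℝ 2 (fun P : Plane × ℝ => χ P.1) P := fun P =>
    (hχ.comp contDiff_fst).contDiffAt
  have T₁ : IsTest (fun P => χ P.1 * ψ P) K₁ t₁ t₂ := ⟨hK₁, fun x hx t => by
    by_cases h : x ∈ K
    · simp only [e₁ x h hx, zero_mul]
    · simp only [h0 x h, mul_zero], fun x t ht => (hχ' _).mul (hψ x t ht)⟩
  have T₂ : IsTest (fun P => (1 - χ P.1) * ψ P) K₂ t₁ t₂ := ⟨hK₂, fun x hx t => by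
    by_cases h : x ∈ K
    · simp only [e₂ x h hx, sub_self, zero_mul]
    · simp only [h0 x h, mul_zero], fun x t ht => (contDiffAt_const.sub (hχ' _)).mul (hψ x t ht)⟩
  have M₁ := fun x (hx : x ∈ K₁) => hM x (hK₁K hx)
  have M₂ := fun x (hx : x ∈ K₂) => hM x (hK₂K hx)
  have a₁ := h₁.apply T₁ hKU₁ ht₁ ht₂ h12
  have a₂ := h₂.apply T₂ hKU₂ ht₁ ht₂ h12
  have hsum : ∀ t ∈ Icc t₁ t₂, ∫ x, u (x, t) * ψ (x, t) =
      (∫ x, u (x, t) * (χ x * ψ (x, t))) + ∫ x, u (x, t) * ((1 - χ x) * ψ (x, t)) := fun t ht => by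
    rw [← integral_add (strip_integrable hu hK₁ (fun x hx t ht => (M₁ x hx t ht).1) T₁.continuousOn
      T₁.eq_zero ht) (strip_integrable hu hK₂ (fun x hx t ht => (M₂ x hx t ht).1) T₂.continuousOn
      T₂.eq_zero ht)]
    exact integral_congr_ae (ae_of_all _ fun x => by ring)
  have hden : ∀ t ∈ Icc t₁ t₂, tdens u g ψ t =
      tdens u g (fun P => χ P.1 * ψ P) t + tdens u g (fun P => (1 - χ P.1) * ψ P) t := fun t ht => by
    unfold tdens
    rw [← integral_add (T₁.integrable_tdens hu hg M₁ ht) (T₂.integrable_tdens hu hg M₂ ht)]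
    refine integral_congr_ae (ae_of_all _ fun x => ?_)
    have c₁ := T₁.smooth x t ht
    have c₂ := T₂.smooth x t ht
    have e : ψ = fun P => χ P.1 * ψ P + (1 - χ P.1) * ψ P := by ext P; ring
    have l := Lx_add c₁ c₂
    have d := dd_add (v := et) (c₁.differentiableAt (by simp)) (c₂.differentiableAt (by simp))
    rw [← e] at l d
    simp only [l, d]
    ring
  rw [hsum t₁ ⟨le_rfl, h12⟩, hsum t₂ ⟨h12, le_rfl⟩]
  change _ = ∫ t in t₁..t₂, tdens u g ψ t
  rw [intervalIntegral.integral_congr (g := fun t => tdens u g (fun P => χ P.1 * ψ P) t +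
    tdens u g (fun P => (1 - χ P.1) * ψ P) t) fun t ht => hden t (by rwa [uIcc_of_le h12] at ht),
    intervalIntegral.integral_add (T₁.intervalIntegrable_tdens h12 hu hg M₁)
      (T₂.intervalIntegrable_tdens h12 hu hg M₂), ← a₁, ← a₂]
  ring

theorem integrable_mul_of_continuousOn {F h : Plane → ℝ} {K : Set Plane} (hK : IsCompact K)
    (hF : ContinuousOn F K) (hh : Continuous h) (h0 : ∀ x ∉ K, h x = 0) :
    Integrable fun x => F x * h x := by
  have h1 : IntegrableOn (fun x => F x * h x) K := (hF.mul hh.continuousOn).integrableOn_compact hK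
  rwa [integrableOn_iff_integrable_of_support_subset] at h1
  intro x hx
  by_contra h
  exact hx (by simp [h0 x h])

theorem integral_mul_dd {F h : Plane → ℝ} {Ω K : Set Plane} {v : Plane} (hΩ : IsOpen Ω)
    (hF : ContDiffOn ℝ 1 F Ω) (hh : ContDiff ℝ 1 h) (hK : IsCompact K) (hKΩ : K ⊆ Ω)
    (h0 : ∀ x ∉ K, h x = 0) : ∫ x, F x * dd v h x = -∫ x, dd v F x * h x := by
  have hd0 : ∀ x ∉ K, dd v h x = 0 := dd_eq_zero_of_notMem hK.isClosed h0
  have hFc : ContinuousOn F K := hF.continuousOn.mono hKΩ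
  have hdF : ContinuousOn (dd v F) K := fun x hx =>
    (contDiffAt_dd (m := 0) (hF.contDiffAt (hΩ.mem_nhds (hKΩ hx)))
      (by norm_num)).continuousAt.continuousWithinAt
  refine integral_mul_fderiv_eq_neg_fderiv_mul_of_integrable
    (integrable_mul_of_continuousOn hK hdF hh.continuous h0)
    (integrable_mul_of_continuousOn hK hFc (contDiff_dd (m := 0) hh (by norm_num)).continuous hd0)
    (integrable_mul_of_continuousOn hK hFc hh.continuous h0)
    (fun x hx => (hF.contDiffAt (hΩ.mem_nhds (hKΩ ?_))).differentiableAt (by simp))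
    fun x _ => (hh.differentiable (by simp)) x
  refine closure_minimal (fun y hy => ?_) hK.isClosed hx
  by_contra h
  exact hy (h0 y h)

theorem continuousAt_lap {F : Plane → ℝ} {x : Plane} (hF : ContDiffAt ℝ 2 F x) :
    ContinuousAt (lap F) x := by
  have e : lap F = fun x => ∑ i : Fin 2,
      dd (EuclideanSpace.single i 1) (dd (EuclideanSpace.single i 1) F) x := rfl
  rw [e]
  exact (ContDiffAt.sum fun i _ => contDiffAt_dd (m := 0) (contDiffAt_dd (m := 1) hF (by norm_num))
    (by norm_num)).continuousAt

theorem integral_lap_mul {F h : Plane → ℝ} {Ω K : Set Plane} (hΩ : IsOpen Ω)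
    (hF : ContDiffOn ℝ 2 F Ω) (hh : ContDiff ℝ 2 h) (hK : IsCompact K) (hKΩ : K ⊆ Ω)
    (h0 : ∀ x ∉ K, h x = 0) : ∫ x, lap F x * h x = ∫ x, F x * lap h x := by
  have hFd : ∀ v, ContDiffOn ℝ 1 (dd v F) Ω := fun v x hx =>
    (contDiffAt_dd (hF.contDiffAt (hΩ.mem_nhds hx)) (by norm_num)).contDiffWithinAt
  have hFdd : ∀ v, ContinuousOn (dd v (dd v F)) K := fun v x hx =>
    (contDiffAt_dd (m := 0) ((hFd v).contDiffAt (hΩ.mem_nhds (hKΩ hx)))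
      (by norm_num)).continuousAt.continuousWithinAt
  have hhd : ∀ v, ContDiff ℝ 1 (dd v h) := fun v => contDiff_dd hh (by norm_num)
  have hd0 : ∀ v, ∀ x ∉ K, dd v h x = 0 := fun v => dd_eq_zero_of_notMem hK.isClosed h0
  have key : ∀ v, ∫ x, dd v (dd v F) x * h x = ∫ x, F x * dd v (dd v h) x := fun v => by
    have e₁ := integral_mul_dd (v := v) hΩ (hFd v) (hh.of_le (by norm_num)) hK hKΩ h0
    have e₂ := integral_mul_dd (v := v) hΩ (hF.of_le (by norm_num)) (hhd v) hK hKΩ (hd0 v)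
    rw [e₂, e₁, neg_neg]
  calc ∫ x, lap F x * h x
      = ∫ x, ∑ i : Fin 2, dd (EuclideanSpace.single i 1) (dd (EuclideanSpace.single i 1) F) x * h x :=
        integral_congr_ae (ae_of_all _ fun x => Finset.sum_mul _ _ _)
    _ = ∑ i : Fin 2, ∫ x, dd (EuclideanSpace.single i 1) (dd (EuclideanSpace.single i 1) F) x * h x :=
        integral_finsetSum _ fun i _ =>
          integrable_mul_of_continuousOn hK (hFdd _) hh.continuous h0
    _ = ∑ i : Fin 2, ∫ x, F x * dd (EuclideanSpace.single i 1) (dd (EuclideanSpace.single i 1) h) x := by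
        simp only [key]
    _ = ∫ x, ∑ i : Fin 2, F x * dd (EuclideanSpace.single i 1) (dd (EuclideanSpace.single i 1) h) x :=
        (integral_finsetSum _ fun i _ => integrable_mul_of_continuousOn hK
          (hF.continuousOn.mono hKΩ) (contDiff_dd (m := 0) (hhd _) (by norm_num)).continuous
          (dd_eq_zero_of_notMem hK.isClosed (hd0 _))).symm
    _ = _ := integral_congr_ae (ae_of_all _ fun x => (Finset.mul_sum _ _ _).symm)

/-- The slice-weak equation follows from a right-derivative condition on tested integrals. -/
theorem SW.of_right_deriv {u g : Plane × ℝ → ℝ} {B : Set Plane} {I : Set ℝ} (hI : OrdConnected I)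
    (hu : Measurable u) (hg : Measurable g)
    (hb : ∀ K, IsCompact K → K ⊆ B → ∀ t₁ ∈ I, ∀ t₂ ∈ I,
      ∃ M, ∀ x ∈ K, ∀ t ∈ Icc t₁ t₂, |u (x, t)| ≤ M ∧ |g (x, t)| ≤ M)
    (hc : ∀ x ∈ B, ContinuousOn (fun t => u (x, t)) I ∧ ContinuousOn (fun t => g (x, t)) I)
    (hd : ∀ ψ K t₁ t₂, IsTest ψ K t₁ t₂ → K ⊆ B → Icc t₁ t₂ ⊆ I → ∀ t ∈ Ioo t₁ t₂,
      HasDerivWithinAt (fun t => ∫ x, u (x, t) * ψ (x, t)) (tdens u g ψ t) (Ioi t) t) :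
    SW u g B I := by
  intro ψ K hK hKB h0 t₁ ht₁ t₂ ht₂ h12 hψ
  have hT : IsTest ψ K t₁ t₂ := ⟨hK, h0, hψ⟩
  obtain ⟨M, hM⟩ := hb K hK hKB t₁ ht₁ t₂ ht₂
  have hsub : Icc t₁ t₂ ⊆ I := hI.out ht₁ ht₂
  refine (intervalIntegral.integral_eq_sub_of_hasDeriv_right
    (f := fun t => ∫ x, u (x, t) * ψ (x, t)) (f' := tdens u g ψ) ?_ ?_
    (hT.intervalIntegrable_tdens h12 hu hg hM)).symm
  · rw [uIcc_of_le h12]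
    exact strip_continuousOn hu hK (fun x hx t ht => (hM x hx t ht).1)
      (fun x hx => (hc x (hKB hx)).1.mono hsub) hT.continuousOn h0
  · rw [min_eq_left h12, max_eq_right h12]
    exact hd ψ K t₁ t₂ hT hKB hsub

/-- Where the slice-weak equation holds, tested integrals have the expected right derivative. -/
theorem SW.hasDerivWithinAt {u g ψ : Plane × ℝ → ℝ} {U K : Set Plane} {t₁ t₂ a b t M : ℝ}
    (h : SW u g U (Ioo a b)) (hψ : IsTest ψ K t₁ t₂) (hKU : K ⊆ U) (hu : Measurable u)
    (hg : Measurable g) (hM : ∀ x ∈ K, ∀ t ∈ Icc t₁ t₂, |u (x, t)| ≤ M ∧ |g (x, t)| ≤ M)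
    (hc : ∀ x ∈ K, ContinuousOn (fun t => u (x, t)) (Icc t₁ t₂) ∧
      ContinuousOn (fun t => g (x, t)) (Icc t₁ t₂))
    (ht : t ∈ Ioo t₁ t₂) (ht' : t ∈ Ioo a b) :
    HasDerivWithinAt (fun t => ∫ x, u (x, t) * ψ (x, t)) (tdens u g ψ t) (Ioi t) t := by
  have hq := hψ.continuousOn_tdens hu hg hM hc
  have hqt : ContinuousAt (tdens u g ψ) t := hq.continuousAt (Icc_mem_nhds ht.1 ht.2)
  have hqm : StronglyMeasurableAtFilter (tdens u g ψ) (𝓝 t) :=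
    ContinuousOn.stronglyMeasurableAtFilter isOpen_Ioo (hq.mono Ioo_subset_Icc_self) t ht
  have hF := (intervalIntegral.integral_hasDerivAt_right (a := t) (b := t) (f := tdens u g ψ)
    IntervalIntegrable.refl hqm hqt).const_add (∫ x, u (x, t) * ψ (x, t))
  refine hF.hasDerivWithinAt.congr_of_eventuallyEq ?_ (by simp)
  filter_upwards [Ioo_mem_nhdsGT (lt_min ht.2 ht'.2)] with s hs
  have hs1 := hs.2.trans_le (min_le_left _ _)
  have hs2 := hs.2.trans_le (min_le_right _ _)
  have := h.apply (hψ.mono (Icc_subset_Icc ht.1.le hs1.le)) hKU ht' ⟨ht'.1.trans hs.1, hs2⟩ hs.1.le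
  linarith

/-- Tested integrals have the expected right derivative at times of classical regularity. -/
theorem hasDerivWithinAt_of_lipschitz {u g ψ : Plane × ℝ → ℝ} {Ω K : Set Plane} {t₁ t₂ t M C δ : ℝ}
    (hψ : IsTest ψ K t₁ t₂) (hΩ : IsOpen Ω) (hKΩ : K ⊆ Ω) (hu : Measurable u)
    (hg : Measurable g) (hM : ∀ x ∈ K, ∀ t ∈ Icc t₁ t₂, |u (x, t)| ≤ M ∧ |g (x, t)| ≤ M)
    (ht : t ∈ Ioo t₁ t₂) (hδ : 0 < δ) (h2 : ContDiffOn ℝ 2 (fun x => u (x, t)) Ω)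
    (hd : ∀ x ∈ K, HasDerivWithinAt (fun t => u (x, t)) (lap (fun x => u (x, t)) x + g (x, t))
      (Ioi t) t)
    (hL : ∀ x ∈ K, ∀ s ∈ Ioo t (t + δ), |u (x, s) - u (x, t)| ≤ C * (s - t)) :
    HasDerivWithinAt (fun t => ∫ x, u (x, t) * ψ (x, t)) (tdens u g ψ t) (Ioi t) t := by
  have htI := Ioo_subset_Icc_self ht
  have hK := hψ.isCompact
  have hdψ : ∀ x, ∀ s ∈ Icc t₁ t₂, HasDerivAt (fun s => ψ (x, s)) (dd et ψ (x, s)) s :=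
    fun x s hs => dd_et_eq_deriv ((hψ.smooth x s hs).differentiableAt (by simp))
  have hψs : ContDiff ℝ 2 fun x => ψ (x, t) := contDiff_iff_contDiffAt.2 fun x =>
    (hψ.smooth x t htI).comp x (by fun_prop)
  have hdet : ContinuousOn (dd et ψ) (univ ×ˢ Icc t₁ t₂) := fun P hP =>
    (contDiffAt_dd (m := 1) (hψ.smooth P.1 P.2 hP.2) (by norm_num)).continuousAt.continuousWithinAt
  have hLx : ContinuousOn (Lx ψ) (univ ×ˢ Icc t₁ t₂) := fun P hP =>
    (contDiffAt_Lx (hψ.smooth P.1 P.2 hP.2)).continuousWithinAt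
  obtain ⟨A, hA⟩ := (hK.prod (isCompact_Icc (a := t₁) (b := t₂))).exists_bound_of_continuousOn
    (hψ.continuousOn.mono (prod_mono (subset_univ _) le_rfl))
  obtain ⟨A', hA'⟩ := (hK.prod (isCompact_Icc (a := t₁) (b := t₂))).exists_bound_of_continuousOn
    (hdet.mono (prod_mono (subset_univ _) le_rfl))
  have e : tdens u g ψ t = ∫ x, ((lap (fun x => u (x, t)) x + g (x, t)) * ψ (x, t) +
      u (x, t) * dd et ψ (x, t)) := by
    have d0 : ∀ x ∉ K, ∀ t, dd et ψ (x, t) = 0 := fun x hx t =>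
      dd_eq_zero_of_notMem hψ.isClosed_prod hψ.eq_zero' _ fun h => hx h.1
    have l0 : ∀ x ∉ K, ∀ t, Lx ψ (x, t) = 0 := fun x hx t =>
      Lx_eq_zero_of_notMem hψ.isClosed_prod hψ.eq_zero' _ fun h => hx h.1
    have i₁ := strip_integrable hu hK (fun x hx t ht => (hM x hx t ht).1) hdet d0 htI
    have i₂ := strip_integrable hu hK (fun x hx t ht => (hM x hx t ht).1) hLx l0 htI
    have i₃ := strip_integrable hg hK (fun x hx t ht => (hM x hx t ht).2) hψ.continuousOn hψ.eq_zero htI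
    have i₄ := integrable_mul_of_continuousOn hK (F := lap fun x => u (x, t)) (fun x hx =>
      (continuousAt_lap (h2.contDiffAt (hΩ.mem_nhds (hKΩ hx)))).continuousWithinAt) hψs.continuous
      fun x hx => hψ.eq_zero x hx t
    have ibp := integral_lap_mul hΩ h2 hψs hK hKΩ fun x hx => hψ.eq_zero x hx t
    have hlap : ∀ x, lap (fun y => ψ (y, t)) x = Lx ψ (x, t) := fun x =>
      lap_slice (hψ.smooth x t htI)
    simp only [hlap] at ibp
    have s₁ : tdens u g ψ t = (∫ x, u (x, t) * dd et ψ (x, t)) + (∫ x, u (x, t) * Lx ψ (x, t)) +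
        ∫ x, g (x, t) * ψ (x, t) := by
      rw [hψ.tdens_eq hu hg hM htI, ← integral_add i₁ i₂]
      simp only [mul_add]
    rw [s₁, ← ibp, add_assoc, ← integral_add i₄ i₃]
    refine (integral_add i₁ (i₄.add i₃)).symm.trans ?_
    exact integral_congr_ae (ae_of_all _ fun x => by simp only [Pi.add_apply]; ring)
  rw [hasDerivWithinAt_iff_tendsto_slope' self_notMem_Ioi, e]
  have hev : ∀ᶠ s in 𝓝[>] t, s ∈ Ioo t (min t₂ (t + δ)) :=
    Ioo_mem_nhdsGT (lt_min ht.2 (by linarith))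
  have hsI : ∀ s ∈ Ioo t (min t₂ (t + δ)), s ∈ Icc t₁ t₂ := fun s hs =>
    ⟨(ht.1.trans hs.1).le, (hs.2.trans_le (min_le_left _ _)).le⟩
  have hint : ∀ s ∈ Icc t₁ t₂, Integrable fun x => u (x, s) * ψ (x, s) := fun s hs =>
    strip_integrable hu hK (fun x hx t ht => (hM x hx t ht).1) hψ.continuousOn hψ.eq_zero hs
  have hslope : ∀ᶠ s in 𝓝[>] t, ∫ x, slope (fun s => u (x, s) * ψ (x, s)) t s =
      slope (fun t => ∫ x, u (x, t) * ψ (x, t)) t s := by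
    filter_upwards [hev] with s hs
    simp only [slope_def_field]
    rw [integral_div, integral_sub (hint s (hsI s hs)) (hint t htI)]
  refine Tendsto.congr' hslope ?_
  refine tendsto_integral_filter_of_dominated_convergence (K.indicator fun _ => |C| * |A| + |M| * |A'|)
    ?_ ?_ ((integrableOn_const hK.measure_lt_top.ne).integrable_indicator hK.measurableSet)
    (ae_of_all _ fun x => ?_)
  · filter_upwards [hev] with s hs
    simp only [slope_def_field]
    exact (((hint s (hsI s hs)).sub (hint t htI)).div_const _).aestronglyMeasurable
  · filter_upwards [hev] with s hs
    refine ae_of_all _ fun x => ?_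
    have hst : 0 < s - t := sub_pos.2 hs.1
    by_cases hx : x ∈ K
    swap
    · simp [slope_def_field, hψ.eq_zero x hx, hx]
    rw [indicator_of_mem hx, slope_def_field, norm_div, Real.norm_of_nonneg hst.le,
      div_le_iff₀ hst]
    have e₁ : |u (x, s) - u (x, t)| ≤ |C| * (s - t) :=
      (hL x hx s ⟨hs.1, hs.2.trans_le (min_le_right _ _)⟩).trans (by gcongr; exact le_abs_self C)
    have e₂ : |ψ (x, s)| ≤ |A| := (hA (x, s) ⟨hx, hsI s hs⟩).trans (le_abs_self _)
    have e₃ : |u (x, t)| ≤ |M| := (hM x hx t htI).1.trans (le_abs_self _)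
    have e₄ : |ψ (x, s) - ψ (x, t)| ≤ |A'| * (s - t) := by
      have := (convex_Icc t₁ t₂).norm_image_sub_le_of_norm_hasDerivWithin_le
        (fun r hr => (hdψ x r hr).hasDerivWithinAt)
        (fun r hr => (hA' (x, r) ⟨hx, hr⟩).trans (le_abs_self _)) htI (hsI s hs)
      rwa [Real.norm_eq_abs, Real.norm_eq_abs, abs_of_pos hst] at this
    calc ‖u (x, s) * ψ (x, s) - u (x, t) * ψ (x, t)‖
        = |(u (x, s) - u (x, t)) * ψ (x, s) + u (x, t) * (ψ (x, s) - ψ (x, t))| := by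
          rw [Real.norm_eq_abs]; ring_nf
      _ ≤ |u (x, s) - u (x, t)| * |ψ (x, s)| + |u (x, t)| * |ψ (x, s) - ψ (x, t)| := by
          rw [← abs_mul, ← abs_mul]; exact abs_add_le _ _
      _ ≤ |C| * (s - t) * |A| + |M| * (|A'| * (s - t)) := by gcongr
      _ = _ := by ring
  · by_cases hx : x ∈ K
    · rw [← hasDerivWithinAt_iff_tendsto_slope' self_notMem_Ioi]
      exact (hd x hx).mul (hdψ x t htI).hasDerivWithinAt
    · have d0 : dd et ψ (x, t) = 0 :=
        dd_eq_zero_of_notMem hψ.isClosed_prod hψ.eq_zero' _ fun h => hx h.1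
      simp [slope_def_field, hψ.eq_zero x hx, d0]

/-- The open set of points near which `u` is continuous and solves the equation slice-weakly. -/
def regularSet (f : ℝ → ℝ) (u : Plane × ℝ → ℝ) : Set (Plane × ℝ) :=
  {P | ∃ U, IsOpen U ∧ P.1 ∈ U ∧ ∃ δ, 0 < δ ∧ Reg f u U (Ioo (P.2 - δ) (P.2 + δ))}

section Regular

variable {f : ℝ → ℝ} {u : Plane × ℝ → ℝ}

theorem isOpen_regularSet : IsOpen (regularSet f u) := by
  rw [isOpen_iff_mem_nhds]
  rintro P ⟨U, hU, hPU, δ, hδ, h⟩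
  have hP : U ×ˢ Ioo (P.2 - δ) (P.2 + δ) ∈ 𝓝 P :=
    (hU.prod isOpen_Ioo).mem_nhds ⟨hPU, by constructor <;> linarith⟩
  filter_upwards [hP] with Q hQ
  refine ⟨U, hU, hQ.1, min (Q.2 - (P.2 - δ)) (P.2 + δ - Q.2),
    lt_min (by linarith [hQ.2.1]) (by linarith [hQ.2.2]), h.mono le_rfl (Ioo_subset_Ioo ?_ ?_)⟩
  · linarith [min_le_left (Q.2 - (P.2 - δ)) (P.2 + δ - Q.2)]
  · linarith [min_le_right (Q.2 - (P.2 - δ)) (P.2 + δ - Q.2)]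

theorem continuousAt_of_mem_regularSet {P : Plane × ℝ} (hP : P ∈ regularSet f u) :
    ContinuousAt u P := by
  obtain ⟨U, hU, hPU, δ, hδ, h⟩ := hP
  exact h.1.continuousAt ((hU.prod isOpen_Ioo).mem_nhds ⟨hPU, by constructor <;> linarith⟩)

theorem SW.empty (u g : Plane × ℝ → ℝ) (I : Set ℝ) : SW u g ∅ I := by
  intro ψ K hK hKB h0 t₁ _ t₂ _ _ _
  obtain rfl : K = ∅ := subset_empty_iff.1 hKB
  obtain rfl : ψ = fun _ => 0 := funext fun P => h0 P.1 (notMem_empty _) P.2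
  have hL : ∀ P, Lx (fun _ : Plane × ℝ => (0 : ℝ)) P = 0 := fun P =>
    Lx_eq_zero_of_notMem isClosed_empty (fun _ _ => rfl) P (notMem_empty _)
  simp [hL, dd]

theorem exists_reg_of_compact (hf : Continuous f) (hu : Measurable u) {K : Set Plane} {t : ℝ}
    (hK : IsCompact K) (hD : ∀ x ∈ K, (x, t) ∈ regularSet f u) :
    ∃ U, IsOpen U ∧ K ⊆ U ∧ ∃ δ, 0 < δ ∧ Reg f u U (Ioo (t - δ) (t + δ)) := by
  refine hK.induction_on (p := fun K => ∃ U, IsOpen U ∧ K ⊆ U ∧ ∃ δ, 0 < δ ∧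
    Reg f u U (Ioo (t - δ) (t + δ))) ?_ ?_ ?_ ?_
  · exact ⟨∅, isOpen_empty, le_rfl, 1, one_pos, by simp, SW.empty _ _ _⟩
  · rintro s s' hs ⟨U, hU, hsU, h⟩
    exact ⟨U, hU, hs.trans hsU, h⟩
  · rintro s s' ⟨U, hU, hsU, δ, hδ, h⟩ ⟨U', hU', hsU', δ', hδ', h'⟩
    have hi : Ioo (t - min δ δ') (t + min δ δ') ⊆ Ioo (t - δ) (t + δ) :=
      Ioo_subset_Ioo (by linarith [min_le_left δ δ']) (by linarith [min_le_left δ δ'])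
    have hi' : Ioo (t - min δ δ') (t + min δ δ') ⊆ Ioo (t - δ') (t + δ') :=
      Ioo_subset_Ioo (by linarith [min_le_right δ δ']) (by linarith [min_le_right δ δ'])
    have r := h.mono le_rfl hi
    have r' := h'.mono le_rfl hi'
    have hc : ContinuousOn u ((U ∪ U') ×ˢ Ioo (t - min δ δ') (t + min δ δ')) := by
      rw [union_prod]
      exact r.1.union_of_isOpen r'.1 (hU.prod isOpen_Ioo) (hU'.prod isOpen_Ioo)
    refine ⟨U ∪ U', hU.union hU', union_subset_union hsU hsU', min δ δ', lt_min hδ hδ', hc, ?_⟩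
    refine r.2.union r'.2 hU hU' hu (hf.measurable.comp hu) fun K hK hKU t₁ h₁ t₂ h₂ => ?_
    have hc' := hc.mono (prod_mono hKU (ordConnected_Ioo.out h₁ h₂))
    obtain ⟨M₁, h₁⟩ := (hK.prod isCompact_Icc).exists_bound_of_continuousOn hc'
    obtain ⟨M₂, h₂⟩ := (hK.prod isCompact_Icc).exists_bound_of_continuousOn
      (hf.comp_continuousOn hc')
    exact ⟨max M₁ M₂, fun x hx t ht => ⟨(h₁ (x, t) ⟨hx, ht⟩).trans (le_max_left _ _),
      (h₂ (x, t) ⟨hx, ht⟩).trans (le_max_right _ _)⟩⟩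
  · intro x hx
    obtain ⟨U, hU, hxU, δ, hδ, h⟩ := hD x hx
    exact ⟨U, mem_nhdsWithin_of_mem_nhds (hU.mem_nhds hxU), U, hU, le_rfl, δ, hδ, h⟩

theorem reg_of_subset_regularSet (hf : Continuous f) (hu : Measurable u) {B : Set Plane} {a b : ℝ}
    (h : B ×ˢ Ioo a b ⊆ regularSet f u) : Reg f u B (Ioo a b) := by
  have hc : ContinuousOn u (B ×ˢ Ioo a b) := fun P hP =>
    (continuousAt_of_mem_regularSet (h hP)).continuousWithinAt
  have hct : ∀ x ∈ B, ContinuousOn (fun t => u (x, t)) (Ioo a b) := fun x hx =>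
    hc.comp (by fun_prop) fun t ht => ⟨hx, ht⟩
  have hb : ∀ K, IsCompact K → K ⊆ B → ∀ t₁ ∈ Ioo a b, ∀ t₂ ∈ Ioo a b,
      ∃ M, ∀ x ∈ K, ∀ t ∈ Icc t₁ t₂, |u (x, t)| ≤ M ∧ |f (u (x, t))| ≤ M := by
    intro K hK hKB t₁ h₁ t₂ h₂
    have hc' := hc.mono (prod_mono hKB (ordConnected_Ioo.out h₁ h₂))
    obtain ⟨M₁, h₁⟩ := (hK.prod isCompact_Icc).exists_bound_of_continuousOn hc'
    obtain ⟨M₂, h₂⟩ := (hK.prod isCompact_Icc).exists_bound_of_continuousOn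
      (hf.comp_continuousOn hc')
    exact ⟨max M₁ M₂, fun x hx t ht => ⟨(h₁ (x, t) ⟨hx, ht⟩).trans (le_max_left _ _),
      (h₂ (x, t) ⟨hx, ht⟩).trans (le_max_right _ _)⟩⟩
  have hg := hf.measurable.comp hu
  refine ⟨hc, SW.of_right_deriv ordConnected_Ioo hu hg hb
    (fun x hx => ⟨hct x hx, hf.comp_continuousOn (hct x hx)⟩) ?_⟩
  intro ψ K t₁ t₂ hψ hKB hI t ht
  have h12 := ht.1.trans ht.2
  obtain ⟨M, hM⟩ := hb K hψ.isCompact hKB t₁ (hI (left_mem_Icc.2 h12.le)) t₂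
    (hI (right_mem_Icc.2 h12.le))
  obtain ⟨U, hU, hKU, δ, hδ, hr⟩ := exists_reg_of_compact hf hu hψ.isCompact
    fun x hx => h ⟨hKB hx, hI (Ioo_subset_Icc_self ht)⟩
  exact hr.2.hasDerivWithinAt hψ hKU hu hg hM (fun x hx => ⟨(hct x (hKB hx)).mono hI,
    hf.comp_continuousOn ((hct x (hKB hx)).mono hI)⟩) ht (by constructor <;> linarith)

end Regular

/-- A Baire category argument: a separately continuous function is bounded, uniformly on the
horizontal and vertical slices through the points of a relatively open part of `Y`. -/
theorem exists_slice_bound {X Z E : Type*} [TopologicalSpace X] [TopologicalSpace Z]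
    [NormedAddCommGroup E] [T2Space X] [T2Space Z] [LocallyCompactSpace X] [LocallyCompactSpace Z]
    {φ : X × Z → E} {B : Set X} {J : Set Z}
    {Y : Set (X × Z)} (hB : IsCompact B) (hJ : IsCompact J) (hY : IsLocallyClosed Y)
    (hYne : Y.Nonempty) (hYs : Y ⊆ B ×ˢ J) (hx : ∀ s ∈ J, ContinuousOn (fun x => φ (x, s)) B)
    (ht : ∀ x ∈ B, ContinuousOn (fun s => φ (x, s)) J) :
    ∃ P₀ ∈ Y, ∃ m : ℝ, 0 ≤ m ∧ ∃ V, IsOpen V ∧ P₀ ∈ V ∧ ∀ P ∈ Y ∩ V,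
      (∀ s ∈ J, ‖φ (P.1, s)‖ ≤ m) ∧ ∀ y ∈ B, ‖φ (y, P.2)‖ ≤ m := by
  have := hY.locallyCompactSpace
  have : Nonempty Y := hYne.to_subtype
  let A : ℕ → Set Y := fun m =>
    (⋂ s ∈ J, {P : Y | ‖φ (P.1.1, s)‖ ≤ m}) ∩ ⋂ y ∈ B, {P : Y | ‖φ (y, P.1.2)‖ ≤ m}
  have hA : ∀ m, IsClosed (A m) := fun m => by
    refine (isClosed_biInter fun s hs => isClosed_le ?_ continuous_const).inter
      (isClosed_biInter fun y hy => isClosed_le ?_ continuous_const)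
    · exact ((hx s hs).comp_continuous (f := fun P : Y => P.1.1) (by fun_prop)
        fun P => (hYs P.2).1).norm
    · exact ((ht y hy).comp_continuous (f := fun P : Y => P.1.2) (by fun_prop)
        fun P => (hYs P.2).2).norm
  have hU : ⋃ m, A m = univ := by
    refine eq_univ_of_forall fun P => mem_iUnion.2 ?_
    obtain ⟨M₁, h₁⟩ := hJ.exists_bound_of_continuousOn (ht P.1.1 (hYs P.2).1)
    obtain ⟨M₂, h₂⟩ := hB.exists_bound_of_continuousOn (hx P.1.2 (hYs P.2).2)
    obtain ⟨m, hm⟩ := exists_nat_ge (max M₁ M₂)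
    refine ⟨m, mem_iInter₂.2 fun s hs => ?_, mem_iInter₂.2 fun y hy => ?_⟩
    · exact (h₁ s hs).trans ((le_max_left _ _).trans hm)
    · exact (h₂ y hy).trans ((le_max_right _ _).trans hm)
  obtain ⟨m, P₀, hP₀⟩ := nonempty_interior_of_iUnion_of_closed hA hU
  obtain ⟨V, hV, hVe⟩ := isOpen_induced_iff.1 (isOpen_interior (s := A m))
  refine ⟨P₀, P₀.2, m, m.cast_nonneg, V, hV, ?_, fun P hP => ?_⟩
  · rw [← hVe] at hP₀; exact hP₀
  · have : (⟨P, hP.1⟩ : Y) ∈ interior (A m) := by rw [← hVe]; exact hP.2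
    have := interior_subset this
    exact ⟨fun s hs => mem_iInter₂.1 this.1 s hs, fun y hy => mem_iInter₂.1 this.2 y hy⟩

/-- A Lipschitz bound based at the points of a compact set `T`, from bounds on the gaps of `T` and
one-sided bounds at the points of `T`. -/
theorem abs_sub_le_of_gaps {F : ℝ → ℝ} {T : Set ℝ} {b C : ℝ} (hT : IsClosed T)
    (hF : ∀ a ∈ T, ContinuousOn F (Icc a b))
    (hgap : ∀ a ∈ T, ∀ s, a < s → s ≤ b → Disjoint (Ioo a s) T → |F s - F a| ≤ C * (s - a))
    (hder : ∀ a ∈ T, a < b → ∀ᶠ r in 𝓝[>] a, |F r - F a| ≤ C * (r - a)) {t s : ℝ} (ht : t ∈ T)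
    (hts : t ≤ s) (hsb : s ≤ b) : |F s - F t| ≤ C * (s - t) := by
  have tri : ∀ x y, |F x - F t| ≤ C * (x - t) → |F y - F x| ≤ C * (y - x) →
      |F y - F t| ≤ C * (y - t) := fun x y h₁ h₂ => by
    have := abs_add_le (F y - F x) (F x - F t)
    rw [sub_add_sub_cancel] at this
    linarith
  have hZ : IsClosed (Icc t s ∩ {x | |F x - F t| ≤ C * (x - t)}) := by
    have hc : ContinuousOn (fun x => |F x - F t| - C * (x - t)) (Icc t s) :=
      ((((hF t ht).mono (Icc_subset_Icc_right hsb)).sub continuousOn_const).abs).sub (by fun_prop)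
    convert hc.preimage_isClosed_of_isClosed isClosed_Icc (isClosed_Iic (a := 0)) using 1
    ext x; simp
  have hcomp : IsCompact (T ∩ (Icc t s ∩ {x | |F x - F t| ≤ C * (x - t)})) :=
    isCompact_Icc.of_isClosed_subset (hT.inter hZ) fun x hx => hx.2.1
  obtain ⟨σ, ⟨hσT, ⟨hσt, hσs⟩, hσ⟩, hmax⟩ :=
    hcomp.exists_isGreatest ⟨t, ht, ⟨le_rfl, hts⟩, by simp⟩
  rcases hσs.eq_or_lt with rfl | hσs
  · exact hσ
  by_cases hd : Disjoint (Ioo σ s) T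
  · exact tri σ s hσ (hgap σ hσT s hσs hsb hd)
  exfalso
  obtain ⟨η, hη, hηd⟩ := mem_nhdsGT_iff_exists_Ioo_subset.1 (hder σ hσT (hσs.trans_le hsb))
  obtain ⟨q, hq, hqT⟩ := not_disjoint_iff.1 hd
  have hηq : η ≤ q := by
    by_contra! h
    have := hmax ⟨hqT, ⟨hσt.trans hq.1.le, hq.2.le⟩, tri σ q hσ (hηd ⟨hq.1, h⟩)⟩
    exact absurd this (not_le.2 hq.1)
  obtain ⟨τ, ⟨hτT, hτη, hτs⟩, hmin⟩ := (isCompact_Icc (a := η) (b := s)).inter_left hT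
    |>.exists_isLeast ⟨q, hqT, hηq, hq.2.le⟩
  have hη' : σ < η := hη
  have hg := hgap σ hσT τ (hη'.trans_le hτη) (hτs.trans hsb) ?_
  · have := hmax ⟨hτT, ⟨hσt.trans (hη'.trans_le hτη).le, hτs⟩, tri σ τ hσ hg⟩
    exact absurd this (not_le.2 (hη'.trans_le hτη))
  · refine disjoint_left.2 fun x hx hxT => ?_
    rcases lt_or_ge x η with h | h
    · have := hmax ⟨hxT, ⟨hσt.trans hx.1.le, (hx.2.trans_le hτs).le⟩, tri σ x hσ (hηd ⟨hx.1, h⟩)⟩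
      exact absurd this (not_le.2 hx.1)
    · exact absurd (hmin ⟨hxT, h, (hx.2.trans_le hτs).le⟩) (not_le.2 hx.2)

theorem continuousOn_smoothed {u : Plane × ℝ → ℝ} {H : Plane → ℝ} {x₁ : Plane} {r τ M : ℝ}
    {I : Set ℝ} (hu : Measurable u) (hH : Continuous H) (hr : 0 < r)
    (hH0 : ∀ y ∉ Metric.closedBall (0 : Plane) (1 / 2), H y = 0)
    (hM : ∀ x ∈ Metric.closedBall x₁ r, ∀ t ∈ I, |u (x, t - τ)| ≤ M)
    (hc : ∀ x ∈ Metric.closedBall x₁ r, ContinuousOn (fun t => u (x, t - τ)) I) :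
    ContinuousOn (fun P : Plane × ℝ => ∫ y, H y * u (P.1 + r • y, P.2 - τ))
      (Metric.closedBall x₁ (r / 2) ×ˢ I) := by
  obtain ⟨A, hA⟩ := (isCompact_closedBall (0 : Plane) (1 / 2)).exists_bound_of_continuousOn
    hH.continuousOn
  have hA' : ∀ y, |H y| ≤ |A| := fun y => by
    by_cases hy : y ∈ Metric.closedBall (0 : Plane) (1 / 2)
    · exact (hA y hy).trans (le_abs_self A)
    · simp [hH0 y hy]
  have e : ∀ P : Plane × ℝ, ∫ y, H y * u (P.1 + r • y, P.2 - τ) =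
      (r ^ 2)⁻¹ * ∫ v, H (r⁻¹ • (v - P.1)) * u (v, P.2 - τ) := fun P => by
    rw [integral_scale P.1 hr (fun v => H (r⁻¹ • (v - P.1)) * u (v, P.2 - τ)), inv_mul_cancel_left₀ (by positivity)]
    simp [smul_smul, inv_mul_cancel₀ hr.ne']
  have h0 : ∀ x ∈ Metric.closedBall x₁ (r / 2), ∀ v ∉ Metric.closedBall x₁ r,
      H (r⁻¹ • (v - x)) = 0 := fun x hx v hv => hH0 _ fun h => hv <| by
    rw [mem_closedBall_zero_iff, norm_smul, norm_inv, Real.norm_of_nonneg hr.le,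
      inv_mul_le_iff₀ hr, ← dist_eq_norm] at h
    have := dist_triangle v x x₁
    rw [Metric.mem_closedBall] at hx ⊢
    linarith
  simp_rw [e]
  refine continuousOn_const.mul (continuousOn_of_dominated
    (bound := (Metric.closedBall x₁ r).indicator fun _ => |A| * |M|) (fun P _ => ?_)
    (fun P hP => ae_of_all _ fun v => ?_) ((integrableOn_const
      (isCompact_closedBall x₁ r).measure_lt_top.ne).integrable_indicator
        Metric.isClosed_closedBall.measurableSet) (ae_of_all _ fun v => ?_))
  · exact ((hH.comp (by fun_prop)).measurable.mul (hu.comp (by fun_prop))).aestronglyMeasurable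
  · by_cases hv : v ∈ Metric.closedBall x₁ r
    · rw [indicator_of_mem hv, norm_mul]
      gcongr
      · exact hA' _
      · exact (hM v hv P.2 hP.2).trans (le_abs_self M)
    · simp [h0 P.1 hP.1 v hv, hv]
  · by_cases hv : v ∈ Metric.closedBall x₁ r
    · exact (hH.comp (by fun_prop)).continuousOn.mul
        ((hc v hv).comp continuousOn_snd fun P hP => hP.2)
    · exact (continuousOn_const (c := (0 : ℝ))).congr fun P hP => by simp [h0 P.1 hP.1 v hv]

/-- Bounded, separately continuous slice-weak solutions are jointly continuous. -/
theorem SW.continuousOn {u g : Plane × ℝ → ℝ} {x₀ : Plane} {R a b M : ℝ} (hu : Measurable u)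
    (hg : Measurable g) (h : SW u g (Metric.ball x₀ R) (Ioo a b))
    (hM : ∀ x ∈ Metric.ball x₀ R, ∀ t ∈ Ioo a b, |u (x, t)| ≤ M ∧ |g (x, t)| ≤ M)
    (hx : ∀ t ∈ Ioo a b, ContinuousOn (fun x => u (x, t)) (Metric.ball x₀ R))
    (ht : ∀ x ∈ Metric.ball x₀ R, ContinuousOn (fun t => u (x, t)) (Ioo a b)) :
    ContinuousOn u (Metric.ball x₀ R ×ˢ Ioo a b) := by
  obtain ⟨z, C, hC, hz, -, hz0, H⟩ := exists_short_time_bound_scaled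
  rintro ⟨x₁, t₁⟩ ⟨hx₁, ht₁⟩
  refine ContinuousAt.continuousWithinAt ?_
  obtain ⟨r, hr, hrs⟩ : ∃ r, 0 < r ∧ r ≤ 1 ∧ Metric.closedBall x₁ r ⊆ Metric.ball x₀ R := by
    obtain ⟨r, hr, h⟩ := Metric.nhds_basis_closedBall.mem_iff.1 (Metric.isOpen_ball.mem_nhds hx₁)
    exact ⟨min r 1, lt_min hr one_pos, min_le_right _ _,
      (Metric.closedBall_subset_closedBall (min_le_left _ _)).trans h⟩
  obtain ⟨hr1, hrs⟩ := hrs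
  obtain ⟨ε, hε, hεI⟩ : ∃ ε, 0 < ε ∧ Icc (t₁ - 2 * ε) (t₁ + ε) ⊆ Ioo a b := by
    refine ⟨min (t₁ - a) (b - t₁) / 3, by have := lt_min (sub_pos.2 ht₁.1) (sub_pos.2 ht₁.2); linarith,
      fun t h => ⟨?_, ?_⟩⟩
    · linarith [h.1, min_le_left (t₁ - a) (b - t₁), sub_pos.2 ht₁.1]
    · linarith [h.2, min_le_right (t₁ - a) (b - t₁), sub_pos.2 ht₁.2]
  have hM0 : 0 ≤ M := (abs_nonneg _).trans (hM x₁ hx₁ t₁ ht₁).1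
  suffices ContinuousOn u (Metric.closedBall x₁ (r / 2) ×ˢ Icc (t₁ - ε) (t₁ + ε)) from
    this.continuousAt (prod_mem_nhds (Metric.closedBall_mem_nhds _ (by linarith))
      (Icc_mem_nhds (by linarith) (by linarith)))
  refine continuousOn_of_uniform_approx_of_continuousOn fun W hW => ?_
  obtain ⟨κ, hκ, hκW⟩ := Metric.mem_uniformity_dist.1 hW
  obtain ⟨δ, hδ, hδ1, hδ2⟩ : ∃ δ, 0 < δ ∧ r ^ 2 * δ ≤ ε ∧ C * M * δ < κ := by
    refine ⟨min ε (κ / (C * M + 1)), by positivity, ?_, ?_⟩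
    · have : r ^ 2 ≤ 1 := pow_le_one₀ hr.le hr1
      have h1 := min_le_left ε (κ / (C * M + 1))
      have h2 : 0 < min ε (κ / (C * M + 1)) := by positivity
      nlinarith
    · have h1 := min_le_right ε (κ / (C * M + 1))
      rw [le_div_iff₀ (by positivity)] at h1
      have h2 : 0 < min ε (κ / (C * M + 1)) := by positivity
      linarith
  have hcb : ∀ x ∈ Metric.closedBall x₁ (r / 2), Metric.closedBall x (r / 2) ⊆ Metric.ball x₀ R :=
    fun x hx => (Metric.closedBall_subset_closedBall' (by
      rw [Metric.mem_closedBall] at hx; linarith)).trans hrs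
  have hIc : ∀ t ∈ Icc (t₁ - ε) (t₁ + ε), Icc (t - r ^ 2 * δ) t ⊆ Ioo a b := fun t ht =>
    (Icc_subset_Icc (by linarith [ht.1]) ht.2).trans hεI
  have hmem : ∀ t ∈ Icc (t₁ - ε) (t₁ + ε), t - r ^ 2 * δ ∈ Ioo a b := fun t ht =>
    hIc t ht (left_mem_Icc.2 (by nlinarith [pow_pos hr 2]))
  have hmem' : ∀ t ∈ Icc (t₁ - ε) (t₁ + ε), t ∈ Ioo a b := fun t ht =>
    hIc t ht (right_mem_Icc.2 (by nlinarith [pow_pos hr 2]))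
  refine ⟨_, continuousOn_smoothed (H := fun y => HK y δ * z y) (τ := r ^ 2 * δ) (M := M) hu
    ((by unfold HK; fun_prop : Continuous fun y => HK y δ).mul hz.continuous) hr (fun y hy => by simp [hz0 y hy])
    (fun x hx t ht => (hM x (hrs hx) _ (hmem t ht)).1)
    (fun x hx => (ht x (hrs hx)).comp (by fun_prop) hmem), ?_⟩
  rintro ⟨x, t⟩ ⟨hxm, htm⟩
  refine hκW ?_
  rw [Real.dist_eq]
  have hxb : x ∈ Metric.ball x₀ R := hcb x hxm (Metric.mem_closedBall_self (by linarith))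
  have key := H u g M δ x t r hr hr1 hδ hu hg (h.mono (hcb x hxm) (hIc t htm))
    (fun y hy s hs => hM y (hcb x hxm hy) s (hIc t htm hs))
    ((hx t (hmem' t htm)).continuousAt (Metric.isOpen_ball.mem_nhds hxb))
  simp only [mul_assoc] at key ⊢
  exact key.trans_lt (by simpa only [mul_assoc] using hδ2)

theorem measurable_lap (F : Plane → ℝ) : Measurable (lap F) := by
  unfold lap
  exact Finset.measurable_sum _ fun i _ => measurable_fderiv_apply_const ℝ _ _

/-- Measurable nonnegative functions on space-time which are separately regular classical solutions
on `Ω × J`. -/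
structure IsSol (f : ℝ → ℝ) (u : Plane × ℝ → ℝ) (Ω : Set Plane) (J : Set ℝ) : Prop where
  isOpen : IsOpen Ω
  isOpen_time : IsOpen J
  measurable : Measurable u
  nonneg : ∀ P, 0 ≤ u P
  space : ∀ t ∈ J, ContDiffOn ℝ 2 (fun x => u (x, t)) Ω
  time : ∀ x ∈ Ω, ContDiffOn ℝ 1 (fun t => u (x, t)) J
  eq : ∀ x ∈ Ω, ∀ t ∈ J,
    deriv (fun s => u (x, s)) t = lap (fun y => u (y, t)) x + f (u (x, t))

namespace IsSol

variable {f : ℝ → ℝ} {u : Plane × ℝ → ℝ} {Ω : Set Plane} {J : Set ℝ}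

theorem hasDerivAt (h : IsSol f u Ω J) {x : Plane} {t : ℝ} (hx : x ∈ Ω) (ht : t ∈ J) :
    HasDerivAt (fun s => u (x, s)) (lap (fun y => u (y, t)) x + f (u (x, t))) t := by
  rw [← h.eq x hx t ht]
  exact (((h.time x hx).contDiffAt (h.isOpen_time.mem_nhds ht)).differentiableAt
    (by simp)).hasDerivAt

theorem continuousOn_lap (h : IsSol f u Ω J) {t : ℝ} (ht : t ∈ J) :
    ContinuousOn (lap fun y => u (y, t)) Ω := fun _ hx =>
  (continuousAt_lap ((h.space t ht).contDiffAt (h.isOpen.mem_nhds hx))).continuousWithinAt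

theorem continuousOn_rhs_time (h : IsSol f u Ω J) {x : Plane} (hx : x ∈ Ω) :
    ContinuousOn (fun t => lap (fun y => u (y, t)) x + f (u (x, t))) J :=
  ((h.time x hx).continuousOn_deriv_of_isOpen h.isOpen_time le_rfl).congr fun t ht =>
    (h.eq x hx t ht).symm

theorem hasDerivWithinAt_of_regular (h : IsSol f u Ω J) (hf : Continuous f) {ψ : Plane × ℝ → ℝ}
    {K : Set Plane} {t₁ t₂ t M : ℝ} (hψ : IsTest ψ K t₁ t₂) (hK : K ⊆ Ω) (hJ : Icc t₁ t₂ ⊆ J)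
    (hM : ∀ x ∈ K, ∀ t ∈ Icc t₁ t₂, |u (x, t)| ≤ M ∧ |f (u (x, t))| ≤ M) (ht : t ∈ Ioo t₁ t₂)
    (hr : ∀ x ∈ K, (x, t) ∈ regularSet f u) :
    HasDerivWithinAt (fun t => ∫ x, u (x, t) * ψ (x, t)) (tdens u (fun P => f (u P)) ψ t)
      (Ioi t) t := by
  obtain ⟨U, -, hKU, δ, hδ, hR⟩ := exists_reg_of_compact hf h.measurable hψ.isCompact hr
  have hc : ∀ x ∈ K, ContinuousOn (fun t => u (x, t)) (Icc t₁ t₂) := fun x hx =>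
    (h.time x (hK hx)).continuousOn.mono hJ
  exact hR.2.hasDerivWithinAt hψ hKU h.measurable (hf.measurable.comp h.measurable) hM
    (fun x hx => ⟨hc x hx, hf.comp_continuousOn (hc x hx)⟩) ht (by constructor <;> linarith)

end IsSol

/-- Time-Lipschitz bound across a time interval in the interior of which the solution is regular. -/
theorem exists_gap_bound : ∃ C : ℝ, 0 < C ∧ ∀ {f : ℝ → ℝ} {u : Plane × ℝ → ℝ} {Ω : Set Plane}
    {J : Set ℝ}, IsSol f u Ω J → Continuous f → ∀ {x : Plane} {r a s M : ℝ}, 0 < r → r ≤ 1 →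
    a < s → Metric.closedBall x (r / 2) ⊆ Ω → Icc a s ⊆ J →
    (∀ y ∈ Metric.closedBall x (r / 2), ∀ t ∈ Icc a s, |u (y, t)| ≤ M ∧ |f (u (y, t))| ≤ M) →
    (∀ y ∈ Metric.closedBall x (r / 2), |lap (fun y => u (y, a)) y| ≤ M) →
    (∀ y ∈ Metric.closedBall x (r / 2), ∀ t ∈ Ioo a s, (y, t) ∈ regularSet f u) →
    |u (x, s) - u (x, a)| ≤ C * M * ((s - a) / r ^ 2) := by
  obtain ⟨z, C, hC, -, -, -, H⟩ := exists_short_time_bound_scaled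
  refine ⟨2 * C, by positivity, ?_⟩
  intro f u Ω J h hf x r a s M hr hr1 has hB hJ hM hL hreg
  have hr2 : 0 < r ^ 2 := by positivity
  have haI : a ∈ Icc a s := left_mem_Icc.2 has.le
  have hsI : s ∈ Icc a s := right_mem_Icc.2 has.le
  have hxB : x ∈ Metric.closedBall x (r / 2) := Metric.mem_closedBall_self (by linarith)
  have hct : ∀ y ∈ Metric.closedBall x (r / 2), ContinuousOn (fun t => u (y, t)) (Icc a s) :=
    fun y hy => (h.time y (hB hy)).continuousOn.mono hJ
  have hcx : ∀ t ∈ Icc a s, ContinuousAt (fun y => u (y, t)) x := fun t ht =>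
    (h.space t (hJ ht)).continuousOn.continuousAt (h.isOpen.mem_nhds (hB hxB))
  have hg := hf.measurable.comp h.measurable
  have e : s - r ^ 2 * ((s - a) / r ^ 2) = a := by field_simp; ring
  have hδ : 0 < (s - a) / r ^ 2 := div_pos (sub_pos.2 has) hr2
  have s₁ : SW u (fun P => f (u P)) (Metric.closedBall x (r / 2)) (Icc a s) := by
    refine SW.of_right_deriv ordConnected_Icc h.measurable hg
      (fun K _ hKB t₁ h₁ t₂ h₂ => ⟨M, fun y hy t ht => hM y (hKB hy) t (Icc_subset_Icc h₁.1 h₂.2 ht)⟩)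
      (fun y hy => ⟨hct y hy, hf.comp_continuousOn (hct y hy)⟩) ?_
    intro ψ K t₁ t₂ hψ hKB hI t ht
    have h12 := (ht.1.trans ht.2).le
    refine h.hasDerivWithinAt_of_regular hf hψ (hKB.trans hB) (hI.trans hJ)
      (fun y hy t ht => hM y (hKB hy) t (hI ht)) ht fun y hy => hreg y (hKB hy) t ?_
    exact ⟨(hI (left_mem_Icc.2 h12)).1.trans_lt ht.1, ht.2.trans_le (hI (right_mem_Icc.2 h12)).2⟩
  have hv : Measurable fun P : Plane × ℝ => u (P.1, a) := h.measurable.comp (by fun_prop)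
  have hgv : Measurable fun P : Plane × ℝ => -lap (fun y => u (y, a)) P.1 :=
    ((measurable_lap _).comp measurable_fst).neg
  have hMv : ∀ y ∈ Metric.closedBall x (r / 2), ∀ t ∈ Icc a s,
      |u (y, a)| ≤ M ∧ |-lap (fun y => u (y, a)) y| ≤ M := fun y hy t _ =>
    ⟨(hM y hy a haI).1, by rw [abs_neg]; exact hL y hy⟩
  have s₂ : SW (fun P => u (P.1, a)) (fun P => -lap (fun y => u (y, a)) P.1)
      (Metric.closedBall x (r / 2)) (Icc a s) := by
    refine SW.of_right_deriv ordConnected_Icc hv hgv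
      (fun K _ hKB t₁ h₁ t₂ h₂ => ⟨M, fun y hy t ht => hMv y (hKB hy) t (Icc_subset_Icc h₁.1 h₂.2 ht)⟩)
      (fun y _ => ⟨continuousOn_const (c := u (y, a)), continuousOn_const (c := -lap (fun y => u (y, a)) y)⟩) ?_
    intro ψ K t₁ t₂ hψ hKB hI t ht
    refine hasDerivWithinAt_of_lipschitz (C := 0) (δ := 1) hψ h.isOpen (hKB.trans hB) hv hgv
      (fun y hy t ht => hMv y (hKB hy) t (hI ht)) ht one_pos (h.space a (hJ haI)) (fun y _ => ?_)
      fun y _ s _ => by simp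
    simpa using hasDerivWithinAt_const t (Ioi t) (u (y, a))
  have k₁ := H u (fun P => f (u P)) M _ x s r hr hr1 hδ h.measurable hg (by rwa [e])
    (by rwa [e]) (hcx s hsI)
  have k₂ := H (fun P => u (P.1, a)) _ M _ x s r hr hr1 hδ hv hgv (by rwa [e])
    (by rwa [e]) (hcx a haI)
  rw [e] at k₁
  simp only at k₂
  rw [abs_sub_comm] at k₂
  have := abs_add_le _ _ |>.trans (add_le_add k₁ k₂)
  rw [sub_add_sub_cancel] at this
  linarith

/-- Separately regular solutions are jointly continuous slice-weak solutions. -/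
theorem IsSol.subset_regularSet {p ℓ : ℝ} {f : ℝ → ℝ} (hp : 1 < p) (hℓ : 0 < ℓ) (hf : Continuous f)
    (hlim : Tendsto (fun s => s ^ (-p) * f s) atTop (𝓝 ℓ)) {u : Plane × ℝ → ℝ} {Ω : Set Plane}
    {J : Set ℝ} (h : IsSol f u Ω J) : Ω ×ˢ J ⊆ regularSet f u := by
  rintro ⟨x₁, t₁⟩ ⟨hx₁, ht₁⟩
  by_contra hP₁
  obtain ⟨R, hR, hRs⟩ := Metric.nhds_basis_closedBall.mem_iff.1
    ((h.isOpen.prod h.isOpen_time).mem_nhds (x := (x₁, t₁)) ⟨hx₁, ht₁⟩)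
  rw [← closedBall_prod_same] at hRs
  have hRΩ : Metric.closedBall x₁ R ⊆ Ω := fun x hx =>
    (hRs (mk_mem_prod hx (Metric.mem_closedBall_self hR.le))).1
  have hRJ : Metric.closedBall t₁ R ⊆ J := fun t ht =>
    (hRs (mk_mem_prod (Metric.mem_closedBall_self hR.le) ht)).2
  have hopen : IsOpen (Metric.ball x₁ R ×ˢ Metric.ball t₁ R) :=
    Metric.isOpen_ball.prod Metric.isOpen_ball
  have hcR : IsClosed (regularSet f u)ᶜ := isOpen_regularSet.isClosed_compl
  obtain ⟨⟨x₀, t₀⟩, hP₀, m, hm, V, hV, hPV, hb⟩ := exists_slice_bound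
    (φ := fun P : Plane × ℝ => (u P, lap (fun y => u (y, P.2)) P.1 + f (u P)))
    (Y := (Metric.ball x₁ R ×ˢ Metric.ball t₁ R) ∩ (regularSet f u)ᶜ)
    (isCompact_closedBall x₁ R) (isCompact_closedBall t₁ R)
    (hopen.isLocallyClosed.inter hcR.isLocallyClosed)
    ⟨(x₁, t₁), ⟨Metric.mem_ball_self hR, Metric.mem_ball_self hR⟩, hP₁⟩
    (inter_subset_left.trans (prod_mono Metric.ball_subset_closedBall Metric.ball_subset_closedBall))
    (fun s hs => by
      have hc := (h.space s (hRJ hs)).continuousOn.mono hRΩ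
      exact hc.prodMk (((h.continuousOn_lap (hRJ hs)).mono hRΩ).add (hf.comp_continuousOn hc)))
    (fun x hx => ((h.time x (hRΩ hx)).continuousOn.mono hRJ).prodMk
      ((h.continuousOn_rhs_time (hRΩ hx)).mono hRJ))
  obtain ⟨ρ, hρ, hρ1, hρs⟩ : ∃ ρ, 0 < ρ ∧ ρ ≤ 1 ∧ Metric.closedBall x₀ ρ ×ˢ
      Icc (t₀ - ρ ^ 2) (t₀ + ρ ^ 2) ⊆ (Metric.ball x₁ R ×ˢ Metric.ball t₁ R) ∩ V := by
    obtain ⟨ρ, hρ, hs⟩ := Metric.nhds_basis_closedBall.mem_iff.1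
      ((hopen.inter hV).mem_nhds (x := (x₀, t₀)) ⟨hP₀.1, hPV⟩)
    refine ⟨min ρ 1, lt_min hρ one_pos, min_le_right _ _, fun P hP => hs ?_⟩
    rw [← closedBall_prod_same]
    have h0 : 0 < min ρ 1 := lt_min hρ one_pos
    have h1 := min_le_left ρ 1
    have h2 := min_le_right ρ 1
    refine ⟨Metric.closedBall_subset_closedBall h1 hP.1, ?_⟩
    rw [Real.closedBall_eq_Icc]
    exact ⟨by nlinarith [hP.2.1], by nlinarith [hP.2.2]⟩
  set S : Set (Plane × ℝ) := (Metric.closedBall x₀ ρ ×ˢ Icc (t₀ - ρ ^ 2) (t₀ + ρ ^ 2)) ∩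
    (regularSet f u)ᶜ with hSdef
  have hS : IsCompact S := ((isCompact_closedBall x₀ ρ).prod isCompact_Icc).inter_right hcR
  have hρ2 : 0 < ρ ^ 2 := by positivity
  have hSb : ∀ P ∈ S, (∀ s ∈ Metric.closedBall t₁ R, |u (P.1, s)| ≤ m) ∧
      ∀ y ∈ Metric.closedBall x₁ R, |u (y, P.2)| ≤ m ∧
        |lap (fun z => u (z, P.2)) y + f (u (y, P.2))| ≤ m := fun P hP => by
    have := hb P ⟨⟨(hρs hP.1).1, hP.2⟩, (hρs hP.1).2⟩
    exact ⟨fun s hs => (le_max_left _ _).trans (this.1 s hs), fun y hy =>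
      ⟨(le_max_left _ _).trans (this.2 y hy), (le_max_right _ _).trans (this.2 y hy)⟩⟩
  have hxR : Metric.closedBall x₀ ρ ⊆ Metric.closedBall x₁ R := fun x hx =>
    Metric.ball_subset_closedBall (hρs (mk_mem_prod hx ⟨by linarith, by linarith⟩ :
      (x, t₀) ∈ Metric.closedBall x₀ ρ ×ˢ Icc (t₀ - ρ ^ 2) (t₀ + ρ ^ 2))).1.1
  have htR : Icc (t₀ - ρ ^ 2) (t₀ + ρ ^ 2) ⊆ Metric.closedBall t₁ R := fun t ht =>
    Metric.ball_subset_closedBall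
      (hρs (mk_mem_prod (Metric.mem_closedBall_self hρ.le) ht)).1.2
  obtain ⟨M₀, hM₀⟩ := exists_local_bound hp hℓ hf hlim h.measurable h.nonneg hS hρ hρ1
    ⟨⟨Metric.mem_closedBall_self hρ.le, by constructor <;> linarith⟩, hP₀.2⟩ hm
    (fun x r a b hx hab hd => reg_of_subset_regularSet hf h.measurable fun P hP => by
      by_contra hPr
      refine disjoint_left.1 hd hP ⟨⟨Metric.ball_subset_closedBall (hx hP.1),
        Ioo_subset_Icc_self (hab hP.2)⟩, hPr⟩)
    (fun P hP y hy => (le_abs_self _).trans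
      ((hSb P hP).2 y (hxR (Metric.ball_subset_closedBall hy))).1)
    (fun P hP t ht => (le_abs_self _).trans ((hSb P hP).1 t (htR (Ioo_subset_Icc_self ht))))
  obtain ⟨A, hA⟩ := (isCompact_Icc (a := (0 : ℝ)) (b := max M₀ m)).exists_bound_of_continuousOn
    hf.continuousOn
  obtain ⟨C, hC, hgap⟩ := exists_gap_bound
  set r := ρ / 8 with hr
  have hr0 : 0 < r := by positivity
  have hr2 : 0 < r ^ 2 := by positivity
  have hrρ : r ^ 2 ≤ ρ ^ 2 := by rw [hr]; nlinarith
  have hA0 : 0 ≤ A := (norm_nonneg _).trans (hA 0 ⟨le_rfl, hm.trans (le_max_right _ _)⟩)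
  set M := max M₀ m + A + m with hMdef
  have hmM : 0 ≤ max M₀ m := hm.trans (le_max_right _ _)
  have hxr : Metric.closedBall x₀ r ⊆ Metric.closedBall x₀ ρ :=
    Metric.closedBall_subset_closedBall (by linarith)
  have hrΩ : Metric.closedBall x₀ r ⊆ Ω := hxr.trans (hxR.trans hRΩ)
  have htr : Icc (t₀ - r ^ 2) (t₀ + r ^ 2) ⊆ Icc (t₀ - ρ ^ 2) (t₀ + ρ ^ 2) :=
    Icc_subset_Icc (by linarith) (by linarith)
  have hrJ : Icc (t₀ - r ^ 2) (t₀ + r ^ 2) ⊆ J := htr.trans (htR.trans hRJ)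
  have hM : ∀ y ∈ Metric.closedBall x₀ r, ∀ t ∈ Icc (t₀ - r ^ 2) (t₀ + r ^ 2),
      |u (y, t)| ≤ M ∧ |f (u (y, t))| ≤ M := fun y hy t ht => by
    have h1 : u (y, t) ≤ max M₀ m := (hM₀ y hy t ht).trans (le_max_left _ _)
    refine ⟨by rw [abs_of_nonneg (h.nonneg _)]; linarith, (hA _ ⟨h.nonneg _, h1⟩).trans (by linarith)⟩
  set T : Set ℝ := Prod.snd '' (S ∩ Metric.closedBall x₀ r ×ˢ Icc (t₀ - r ^ 2) (t₀ + r ^ 2)) with hTdef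
  have hT : IsClosed T := ((hS.inter ((isCompact_closedBall x₀ r).prod
    isCompact_Icc)).image continuous_snd).isClosed
  have hTI : T ⊆ Icc (t₀ - r ^ 2) (t₀ + r ^ 2) := by
    rintro _ ⟨P, hP, rfl⟩; exact hP.2.2
  have hTb : ∀ t ∈ T, ∀ y ∈ Metric.closedBall x₀ r,
      |lap (fun z => u (z, t)) y + f (u (y, t))| ≤ m := by
    rintro _ ⟨P, hP, rfl⟩ y hy
    exact ((hSb P hP.1).2 y (hxR (hxr hy))).2
  have hTl : ∀ t ∈ T, ∀ y ∈ Metric.closedBall x₀ r, |lap (fun z => u (z, t)) y| ≤ M := by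
    rintro t ht y hy
    have h1 : |f (u (y, t))| ≤ A :=
      hA _ ⟨h.nonneg _, (hM₀ y hy t (hTI ht)).trans (le_max_left _ _)⟩
    have := abs_sub (lap (fun z => u (z, t)) y + f (u (y, t))) (f (u (y, t)))
    rw [add_sub_cancel_right] at this
    linarith [hTb t ht y hy]
  have hTr : ∀ t ∈ Icc (t₀ - r ^ 2) (t₀ + r ^ 2), t ∉ T → ∀ y ∈ Metric.closedBall x₀ r,
      (y, t) ∈ regularSet f u := fun t ht htT y hy => by
    by_contra hcon
    exact htT ⟨(y, t), ⟨⟨⟨hxr hy, htr ht⟩, hcon⟩, hy, ht⟩, rfl⟩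
  have hC₂ : 0 ≤ C * M / r ^ 2 := by positivity
  have hlip : ∀ x ∈ Metric.closedBall x₀ (r / 2), ∀ t ∈ T, ∀ s, t ≤ s → s ≤ t₀ + r ^ 2 →
      |u (x, s) - u (x, t)| ≤ (C * M / r ^ 2 + m + 1) * (s - t) := by
    intro x hx t ht s hts hs
    have hxx : Metric.closedBall x (r / 2) ⊆ Metric.closedBall x₀ r :=
      Metric.closedBall_subset_closedBall' (by rw [Metric.mem_closedBall] at hx; linarith)
    have hx' : x ∈ Metric.closedBall x₀ r := hxx (Metric.mem_closedBall_self (by linarith))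
    refine abs_sub_le_of_gaps (F := fun s => u (x, s)) hT (fun a ha => ?_) (fun a ha s has hs hd => ?_)
      (fun a ha hab => ?_) ht hts hs
    · exact (h.time x (hrΩ hx')).continuousOn.mono
        ((Icc_subset_Icc_left (hTI ha).1).trans hrJ)
    · have hI : Icc a s ⊆ Icc (t₀ - r ^ 2) (t₀ + r ^ 2) := Icc_subset_Icc (hTI ha).1 hs
      refine (hgap h hf (M := M) hr0 (by linarith) has (hxx.trans hrΩ) (hI.trans hrJ)
        (fun y hy t ht => hM y (hxx hy) t (hI ht)) (fun y hy => hTl a ha y (hxx hy))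
        fun y hy t ht => hTr t (hI (Ioo_subset_Icc_self ht)) (disjoint_left.1 hd ht) y
          (hxx hy)).trans ?_
      rw [← mul_div_assoc, ← div_mul_eq_mul_div]
      have := sub_pos.2 has
      gcongr
      linarith
    · have hd := (h.hasDerivAt (hrΩ hx') (hrJ (hTI ha))).hasDerivWithinAt (s := Ioi a)
      rw [hasDerivWithinAt_iff_tendsto_slope' self_notMem_Ioi] at hd
      have hlt := hd.norm.eventually_lt_const (u := C * M / r ^ 2 + m + 1) (by
        rw [Real.norm_eq_abs]; linarith [hTb a ha x hx'])
      filter_upwards [hlt, self_mem_nhdsWithin] with s hs has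
      have has' : 0 < s - a := sub_pos.2 has
      rw [slope_def_field, norm_div, Real.norm_of_nonneg has'.le, div_lt_iff₀ has'] at hs
      exact hs.le
  have hb2 : Metric.ball x₀ (r / 2) ⊆ Metric.closedBall x₀ (r / 2) := Metric.ball_subset_closedBall
  have hb2r : Metric.ball x₀ (r / 2) ⊆ Metric.closedBall x₀ r :=
    hb2.trans (Metric.closedBall_subset_closedBall (by linarith))
  have hg := hf.measurable.comp h.measurable
  have hct : ∀ x ∈ Metric.ball x₀ (r / 2), ContinuousOn (fun t => u (x, t))
      (Ioo (t₀ - r ^ 2) (t₀ + r ^ 2)) := fun x hx =>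
    (h.time x (hrΩ (hb2r hx))).continuousOn.mono (Ioo_subset_Icc_self.trans hrJ)
  have hSW : SW u (fun P => f (u P)) (Metric.ball x₀ (r / 2))
      (Ioo (t₀ - r ^ 2) (t₀ + r ^ 2)) := by
    refine SW.of_right_deriv ordConnected_Ioo h.measurable hg
      (fun K _ hKB t₁ h₁ t₂ h₂ => ⟨M, fun y hy t ht => hM y (hb2r (hKB hy)) t
        (Icc_subset_Icc h₁.1.le h₂.2.le ht)⟩)
      (fun y hy => ⟨hct y hy, hf.comp_continuousOn (hct y hy)⟩) ?_
    intro ψ K t₁ t₂ hψ hKB hI t ht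
    have hI' := hI.trans Ioo_subset_Icc_self
    have htI := hI (Ioo_subset_Icc_self ht)
    have hMK : ∀ y ∈ K, ∀ t ∈ Icc t₁ t₂, |u (y, t)| ≤ M ∧ |f (u (y, t))| ≤ M := fun y hy t ht =>
      hM y (hb2r (hKB hy)) t (hI' ht)
    have hKΩ := hKB.trans (hb2r.trans hrΩ)
    by_cases htT : t ∈ T
    · exact hasDerivWithinAt_of_lipschitz (δ := t₀ + r ^ 2 - t) hψ h.isOpen hKΩ h.measurable hg hMK ht
        (sub_pos.2 htI.2) (h.space t (hrJ (hTI htT)))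
        (fun y hy => (h.hasDerivAt (hKΩ hy) (hrJ (hTI htT))).hasDerivWithinAt)
        fun y hy s hs => hlip y (hb2 (hKB hy)) t htT s hs.1.le (by linarith [hs.2])
    · exact h.hasDerivWithinAt_of_regular hf hψ hKΩ (hI'.trans hrJ) hMK ht
        fun y hy => hTr t (Ioo_subset_Icc_self htI) htT y (hb2r (hKB hy))
  refine hP₀.2 ⟨Metric.ball x₀ (r / 2), Metric.isOpen_ball, Metric.mem_ball_self (by linarith),
    r ^ 2, hr2, ?_, hSW⟩
  exact hSW.continuousOn h.measurable hg
    (fun x hx t ht => hM x (hb2r hx) t (Ioo_subset_Icc_self ht))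
    (fun t ht => (h.space t (hrJ (Ioo_subset_Icc_self ht))).continuousOn.mono (hb2r.trans hrΩ)) hct

theorem ball_infDist_frontier_subset {E : Type*} [NormedAddCommGroup E] [NormedSpace ℝ E]
    {Ω : Set E} (hΩ : IsOpen Ω) {x : E} (hx : x ∈ Ω) {r : ℝ} (hr : 0 < r)
    (h : r ≤ Metric.infDist x (frontier Ω)) : Metric.ball x r ⊆ Ω := by
  refine (convex_ball x r).isPreconnected.subset_left_of_subset_union hΩ
    isClosed_closure.isOpen_compl (disjoint_compl_right.mono_left subset_closure) (fun y hy => ?_)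
    ⟨x, Metric.mem_ball_self hr, hx⟩
  by_contra hcon
  rw [mem_union, not_or, mem_compl_iff, not_not] at hcon
  have hyf : y ∈ frontier Ω := by rw [hΩ.frontier_eq]; exact ⟨hcon.2, hcon.1⟩
  have := Metric.infDist_le_dist_of_mem (x := x) hyf
  rw [Metric.mem_ball, dist_comm] at hy
  linarith

theorem lap_congr {F G : Plane → ℝ} {x : Plane} (h : F =ᶠ[𝓝 x] G) : lap F x = lap G x := by
  unfold lap
  refine Finset.sum_congr rfl fun i _ => ?_
  have : (fun y => fderiv ℝ F y (EuclideanSpace.single i 1)) =ᶠ[𝓝 x]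
      fun y => fderiv ℝ G y (EuclideanSpace.single i 1) :=
    h.fderiv.mono fun y hy => congrArg (fun L : Plane →L[ℝ] ℝ => L (EuclideanSpace.single i 1)) hy
  exact congrArg (fun L : Plane →L[ℝ] ℝ => L (EuclideanSpace.single i 1)) this.fderiv_eq

/-- Separately continuous functions, extended by zero, are measurable. -/
theorem measurable_indicator_of_separately_continuousOn {u : Plane × ℝ → ℝ} {Ω : Set Plane}
    {J : Set ℝ} (hΩ : MeasurableSet Ω) (hJ : MeasurableSet J)
    (hx : ∀ t ∈ J, ContinuousOn (fun x => u (x, t)) Ω)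
    (ht : ∀ x ∈ Ω, ContinuousOn (fun t => u (x, t)) J) :
    Measurable ((Ω ×ˢ J).indicator u) := by
  have h : StronglyMeasurable (Function.uncurry fun (t : J) (x : Plane) =>
      Ω.indicator (fun x => u (x, t)) x) := by
    refine stronglyMeasurable_uncurry_of_continuous_of_stronglyMeasurable (fun x => ?_) fun t => ?_
    · by_cases hxΩ : x ∈ Ω
      · simp only [indicator_of_mem hxΩ]
        exact (ht x hxΩ).comp_continuous continuous_subtype_val fun t => t.2
      · simp only [indicator_of_notMem hxΩ]
        exact continuous_const
    · have : Measurable (Ω.piecewise (fun x => u (x, (t : ℝ))) fun _ => (0 : ℝ)) :=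
        (hx t t.2).measurable_piecewise continuousOn_const hΩ
      convert this.stronglyMeasurable using 1
      ext y
      simp [indicator, piecewise]
  refine measurable_of_restrict_of_restrict_compl (measurable_snd hJ) ?_ ?_
  · have : Measurable fun P : (Prod.snd ⁻¹' J : Set (Plane × ℝ)) =>
        ((⟨P.1.2, P.2⟩ : J), P.1.1) :=
      ((measurable_snd.comp measurable_subtype_coe).subtype_mk).prodMk
        (measurable_fst.comp measurable_subtype_coe)
    convert h.measurable.comp this using 1
    ext ⟨⟨x, t⟩, hP⟩
    have hP' : t ∈ J := hP
    simp [indicator, hP']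
  · convert measurable_const (a := (0 : ℝ)) using 1
    ext ⟨⟨x, t⟩, hP⟩
    have hP' : t ∉ J := hP
    simp [indicator, hP']

theorem rpow_min_le {a b γ A B : ℝ} (hA : 0 ≤ A) (hB : 0 ≤ B) (ha : a ^ γ ≤ 1 + A)
    (hb : b ^ γ ≤ 1 + B) : min a b ^ γ ≤ 1 + (A + B) := by
  rcases min_choice a b with h | h <;> rw [h] <;> linarith

theorem sqrt_rpow_neg {a β : ℝ} (ha : 0 ≤ a) : √a ^ (-(2 * β)) = a ^ (-β) := by
  rw [Real.sqrt_eq_rpow, ← Real.rpow_mul ha]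
  ring_nf

theorem exists_classical_bound {p ℓ : ℝ} {f : ℝ → ℝ} (hp : 1 < p) (hfc : ContinuousOn f (Ici 0))
    (hℓ : 0 < ℓ) (hlim : Tendsto (fun u : ℝ => u ^ (-p) * f u) atTop (𝓝 ℓ)) :
    ∃ C, 0 < C ∧ ∀ (Ω : Set Plane) (J : Set ℝ) (u : Plane × ℝ → ℝ), IsOpen Ω → IsOpen J →
      (∀ t ∈ J, ContDiffOn ℝ 2 (fun x => u (x, t)) Ω) →
      (∀ x ∈ Ω, ContDiffOn ℝ 1 (fun t => u (x, t)) J) → (∀ x ∈ Ω, ∀ t ∈ J, 0 ≤ u (x, t)) →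
      (∀ x ∈ Ω, ∀ t ∈ J,
        deriv (fun s => u (x, s)) t = lap (fun y => u (y, t)) x + f (u (x, t))) →
      ∀ (x : Plane) (t r : ℝ), 0 < r → r ≤ 1 → Metric.ball x r ⊆ Ω →
        Ioo (t - r ^ 2) (t + r ^ 2) ⊆ J → u (x, t) ≤ C * r ^ (-(2 * (1 / (p - 1)))) := by
  have hf : Continuous fun s => f (max s 0) :=
    hfc.comp_continuous (by fun_prop) fun s => le_max_right s 0
  have hlim' : Tendsto (fun s => s ^ (-p) * f (max s 0)) atTop (𝓝 ℓ) := by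
    refine hlim.congr' ?_
    filter_upwards [eventually_ge_atTop 0] with s hs
    rw [max_eq_left hs]
  obtain ⟨C, hC, H⟩ := exists_interior_bound hp hℓ hf hlim'
  refine ⟨C, hC, fun Ω J u hΩ hJ hx ht hu0 heq x t r hr hr1 hxr htr => ?_⟩
  set v := (Ω ×ˢ J).indicator u with hv
  have hvu : ∀ x ∈ Ω, ∀ t ∈ J, v (x, t) = u (x, t) := fun x hx t ht =>
    indicator_of_mem (mk_mem_prod hx ht) u
  have hv0 : ∀ P, 0 ≤ v P := fun P => indicator_nonneg (fun Q hQ => hu0 Q.1 hQ.1 Q.2 hQ.2) P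
  have hsol : IsSol (fun s => f (max s 0)) v Ω J := by
    refine ⟨hΩ, hJ, measurable_indicator_of_separately_continuousOn hΩ.measurableSet
      hJ.measurableSet (fun t h => (hx t h).continuousOn) (fun x h => (ht x h).continuousOn), hv0,
      fun t h => (hx t h).congr fun y hy => hvu y hy t h,
      fun x h => (ht x h).congr fun s hs => hvu x h s hs, fun x hxΩ t htJ => ?_⟩
    have e₁ : (fun s => v (x, s)) =ᶠ[𝓝 t] fun s => u (x, s) := by
      filter_upwards [hJ.mem_nhds htJ] with s hs using hvu x hxΩ s hs
    have e₂ : (fun y => v (y, t)) =ᶠ[𝓝 x] fun y => u (y, t) := by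
      filter_upwards [hΩ.mem_nhds hxΩ] with y hy using hvu y hy t htJ
    rw [e₁.deriv_eq, lap_congr e₂, heq x hxΩ t htJ, hvu x hxΩ t htJ, max_eq_left (hu0 x hxΩ t htJ)]
  have hreg := reg_of_subset_regularSet hf hsol.measurable
    ((prod_mono hxr htr).trans (hsol.subset_regularSet hp hℓ hf hlim'))
  have := H v x t r hr hr1 hsol.measurable hreg.2 hreg.1 fun P _ => hv0 P
  have hr2 : 0 < r ^ 2 := by positivity
  rwa [hvu x (hxr (Metric.mem_ball_self hr)) t (htr ⟨by linarith, by linarith⟩),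
    ← mul_one_div] at this

end Interior

/-- Universal a priori bound for nonnegative classical solutions of
`∂ₜ u = Δu + f(u)` in `Ω × (T₁,T₂)`, `Ω ⊆ ℝ²`, where `f(u) ~ ℓ u^p` as `u → ∞`.
The constant `C` depends only on `f` (and `p`, `ℓ`), not on `Ω`, `T₁`, `T₂` or `u`. -/
theorem universal_bound_f
    (p : ℝ) (hp : 1 < p) (f : ℝ → ℝ) (hfc : ContinuousOn f (Ici 0))
    (ℓ : ℝ) (hℓ : 0 < ℓ)
    (hlim : Filter.Tendsto (fun u : ℝ => u ^ (-p) * f u) Filter.atTop (nhds ℓ)) :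
    ∃ C > 0, ∀ (Ω : Set (EuclideanSpace ℝ (Fin 2))), IsOpen Ω → Ω.Nonempty →
      ∀ T₁ T₂ : EReal, T₁ < T₂ →
      ∀ u : EuclideanSpace ℝ (Fin 2) × ℝ → ℝ,
        (∀ t : ℝ, T₁ < (t : EReal) → (t : EReal) < T₂ →
          ContDiffOn ℝ 2 (fun x => u (x, t)) Ω) →
        (∀ x ∈ Ω, ContDiffOn ℝ 1 (fun t => u (x, t))
          {t : ℝ | T₁ < (t : EReal) ∧ (t : EReal) < T₂}) →
        (∀ x ∈ Ω, ∀ t : ℝ, T₁ < (t : EReal) → (t : EReal) < T₂ → 0 ≤ u (x, t)) →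
        (∀ x ∈ Ω, ∀ t : ℝ, T₁ < (t : EReal) → (t : EReal) < T₂ →
          deriv (fun s => u (x, s)) t = lap (fun y => u (y, t)) x + f (u (x, t))) →
        ∀ x ∈ Ω, ∀ t : ℝ, T₁ < (t : EReal) → (t : EReal) < T₂ →
          u (x, t) ≤ C * (1
            + (if T₁ = ⊥ then 0 else (t - T₁.toReal) ^ (-(1 / (p - 1))))
            + (if T₂ = ⊤ then 0 else (T₂.toReal - t) ^ (-(1 / (p - 1))))
            + Metric.infDist x (frontier Ω) ^ (-(2 * (1 / (p - 1))))) := by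
  obtain ⟨C, hC, H⟩ := exists_classical_bound hp hfc hℓ hlim
  refine ⟨C, hC, fun Ω hΩ _ T₁ T₂ _ u hux hut hu0 heq x hx t ht₁ ht₂ => ?_⟩
  have hJ : IsOpen {t : ℝ | T₁ < (t : EReal) ∧ (t : EReal) < T₂} :=
    isOpen_Ioo.preimage continuous_coe_real_ereal
  obtain ⟨a, A, ha, hA, ha1, haJ, hAe⟩ : ∃ a A : ℝ, 0 < a ∧ 0 ≤ A ∧
      a ^ (-(2 * (1 / (p - 1)))) ≤ 1 + A ∧ (∀ s, t - a ^ 2 < s → T₁ < (s : EReal)) ∧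
      A = if T₁ = ⊥ then 0 else (t - T₁.toReal) ^ (-(1 / (p - 1))) := by
    by_cases h : T₁ = ⊥
    · exact ⟨1, 0, one_pos, le_rfl, by simp, fun s _ => by simp [h, EReal.bot_lt_coe], by simp [h]⟩
    lift T₁ to ℝ using ⟨ne_top_of_lt ht₁, h⟩
    rw [EReal.coe_lt_coe_iff] at ht₁
    have h0 := sub_pos.2 ht₁
    refine ⟨√(t - T₁), (t - T₁) ^ (-(1 / (p - 1))), Real.sqrt_pos.2 h0, by positivity, ?_,
      fun s hs => ?_, by simp⟩
    · rw [sqrt_rpow_neg h0.le]; linarith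
    · rw [Real.sq_sqrt h0.le] at hs
      exact EReal.coe_lt_coe_iff.2 (by linarith)
  obtain ⟨b, B, hb, hB, hb1, hbJ, hBe⟩ : ∃ b B : ℝ, 0 < b ∧ 0 ≤ B ∧
      b ^ (-(2 * (1 / (p - 1)))) ≤ 1 + B ∧ (∀ s, s < t + b ^ 2 → (s : EReal) < T₂) ∧
      B = if T₂ = ⊤ then 0 else (T₂.toReal - t) ^ (-(1 / (p - 1))) := by
    by_cases h : T₂ = ⊤
    · exact ⟨1, 0, one_pos, le_rfl, by simp, fun s _ => by simp [h, EReal.coe_lt_top], by simp [h]⟩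
    lift T₂ to ℝ using ⟨h, ne_bot_of_gt ht₂⟩
    rw [EReal.coe_lt_coe_iff] at ht₂
    have h0 := sub_pos.2 ht₂
    refine ⟨√(T₂ - t), (T₂ - t) ^ (-(1 / (p - 1))), Real.sqrt_pos.2 h0, by positivity, ?_,
      fun s hs => ?_, by simp⟩
    · rw [sqrt_rpow_neg h0.le]; linarith
    · rw [Real.sq_sqrt h0.le] at hs
      exact EReal.coe_lt_coe_iff.2 (by linarith)
  obtain ⟨d, hd, hd1, hdΩ⟩ : ∃ d : ℝ, 0 < d ∧ d ^ (-(2 * (1 / (p - 1)))) ≤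
      1 + Metric.infDist x (frontier Ω) ^ (-(2 * (1 / (p - 1)))) ∧ Metric.ball x d ⊆ Ω := by
    have hD : 0 ≤ Metric.infDist x (frontier Ω) ^ (-(2 * (1 / (p - 1)))) :=
      Real.rpow_nonneg Metric.infDist_nonneg _
    rcases (frontier Ω).eq_empty_or_nonempty with h | h
    · refine ⟨1, one_pos, by simpa using hD, ?_⟩
      rcases frontier_eq_empty_iff.1 h with h | h
      · exact absurd hx (by simp [h])
      · simp [h]
    · have h0 : 0 < Metric.infDist x (frontier Ω) :=
        (isClosed_frontier.notMem_iff_infDist_pos h).1 fun hxf => by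
          rw [hΩ.frontier_eq] at hxf; exact hxf.2 hx
      exact ⟨_, h0, by linarith, ball_infDist_frontier_subset hΩ hx h0 le_rfl⟩
  have hD : 0 ≤ Metric.infDist x (frontier Ω) ^ (-(2 * (1 / (p - 1)))) :=
    Real.rpow_nonneg Metric.infDist_nonneg _
  set r := min (min (min 1 a) b) d with hr
  have hr0 : 0 < r := lt_min (lt_min (lt_min one_pos ha) hb) hd
  have hra : r ≤ a := (min_le_left _ _).trans ((min_le_left _ _).trans (min_le_right _ _))
  have hrb : r ≤ b := (min_le_left _ _).trans (min_le_right _ _)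
  have hr1 : r ≤ 1 := (min_le_left _ _).trans ((min_le_left _ _).trans (min_le_left _ _))
  have key := H Ω {t : ℝ | T₁ < (t : EReal) ∧ (t : EReal) < T₂} u hΩ hJ (fun t h => hux t h.1 h.2)
    hut (fun x hx t h => hu0 x hx t h.1 h.2) (fun x hx t h => heq x hx t h.1 h.2) x t r hr0 hr1
    ((Metric.ball_subset_ball (min_le_right _ _)).trans hdΩ) fun s hs =>
      ⟨haJ s (by have := pow_le_pow_left₀ hr0.le hra 2; linarith [hs.1]),
        hbJ s (by have := pow_le_pow_left₀ hr0.le hrb 2; linarith [hs.2])⟩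
  refine key.trans ?_
  rw [← hAe, ← hBe]
  gcongr
  have h1 := rpow_min_le le_rfl hA (γ := -(2 * (1 / (p - 1)))) (a := 1) (by simp) ha1
  rw [zero_add] at h1
  have h2 := rpow_min_le (add_nonneg hA hB) hD (rpow_min_le hA hB h1 hb1) hd1
  linarith
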